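/- arXiv:2210.09567 — 4 statements merged into one kernel-verified Lean document; each statement's English description precedes it below -/
import Mathlib

section
/- Let 1/2 < α < 1 and R > 0, and let K = K(α, R) be the bowtie set. Let f be continuous on K, analytic on the interior of K, and not analytic at 0, in the sense that there do not exist ε > 0 and a function g analytic on the open disc {|z| < ε} with g(z) = f(z) for all z ∈ K with |z| < ε. Then there do not exist a nonempty open set V whose closure is contained in the interior of K, constants C ≥ 1 and c > 0, and a sequence of polynomials (P_n)_{n≥1} with deg P_n ≤ n satisfying both sup_{z∈K} |f(z) − P_n(z)| ≤ C · E_n(f, K) and sup_{z∈closure(V)} |f(z) − P_n(z)| ≤ C · E_n(f, K) · e^{−c n} for all n. -/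
open Filter

/-- The bowtie set: union of the two closed circular sectors of radius `R` and
half-angle `α π / 2` around the positive and negative real axis. -/
noncomputable def bowtie (α R : ℝ) : Set ℂ :=
  {z : ℂ | ∃ r θ : ℝ, 0 ≤ r ∧ r ≤ R ∧
    (|θ| ≤ α * Real.pi / 2 ∨ |θ - Real.pi| ≤ α * Real.pi / 2) ∧
    z = r * Complex.exp (θ * Complex.I)}

/-- Sup of `|f - P|` over a set `E`. -/
noncomputable def supErr (f : ℂ → ℂ) (E : Set ℂ) (P : Polynomial ℂ) : ℝ :=
  ⨆ z : E, ‖f z - P.eval (z : ℂ)‖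

/-- `E_n(f, K)`: best uniform polynomial approximation error of degree at most `n`. -/
noncomputable def bestE (f : ℂ → ℂ) (K : Set ℂ) (n : ℕ) : ℝ :=
  ⨅ P : {P : Polynomial ℂ // P.natDegree ≤ n}, supErr f K P.1

/-- `g` is a uniform limit of polynomials on `K`. -/
def Appr (K : Set ℂ) (g : ℂ → ℂ) : Prop :=
  ∀ ε : ℝ, 0 < ε → ∃ p : Polynomial ℂ, ∀ z ∈ K, ‖g z - p.eval z‖ ≤ ε

lemma Appr.add {K : Set ℂ} {g h : ℂ → ℂ} (hg : Appr K g) (hh : Appr K h) :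
    Appr K (fun z => g z + h z) := by
  intro ε hε
  obtain ⟨p, hp⟩ := hg (ε / 2) (by positivity)
  obtain ⟨q, hq⟩ := hh (ε / 2) (by positivity)
  refine ⟨p + q, fun z hz => ?_⟩
  have h1 := hp z hz
  have h2 := hq z hz
  rw [Polynomial.eval_add]
  calc ‖g z + h z - (p.eval z + q.eval z)‖ = ‖(g z - p.eval z) + (h z - q.eval z)‖ := by ring_nf
    _ ≤ _ := norm_add_le _ _
    _ ≤ ε := by linarith

lemma poly_bdd {K : Set ℂ} (hK : IsCompact K) (q : Polynomial ℂ) :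
    ∃ B : ℝ, 0 < B ∧ ∀ z ∈ K, ‖q.eval z‖ ≤ B := by
  obtain ⟨B, hB⟩ := hK.exists_bound_of_continuousOn (f := fun z => q.eval z)
    q.continuous.continuousOn
  exact ⟨max B 1, by positivity, fun z hz => (hB z hz).trans (le_max_left _ _)⟩

lemma Appr.mul_poly {K : Set ℂ} (hK : IsCompact K) {g : ℂ → ℂ} (hg : Appr K g)
    (q : Polynomial ℂ) : Appr K (fun z => g z * q.eval z) := by
  intro ε hε
  obtain ⟨B, hB0, hB⟩ := poly_bdd hK q
  obtain ⟨p, hp⟩ := hg (ε / B) (by positivity)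
  refine ⟨p * q, fun z hz => ?_⟩
  rw [Polynomial.eval_mul, ← sub_mul, norm_mul]
  calc _ ≤ ε / B * B := mul_le_mul (hp z hz) (hB z hz) (norm_nonneg _) (by positivity)
    _ = ε := by field_simp

lemma Appr.sum {K : Set ℂ} {g : ℕ → ℂ → ℂ} (n : ℕ) (hg : ∀ k, Appr K (g k)) :
    Appr K (fun z => ∑ k ∈ Finset.range n, g k z) := by
  induction n with
  | zero => intro ε hε; exact ⟨0, fun z hz => by simpa using hε.le⟩
  | succ n ih =>
    simp only [Finset.sum_range_succ]
    exact ih.add (hg n)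

lemma Appr.of_unif {K : Set ℂ} {g : ℂ → ℂ}
    (h : ∀ ε : ℝ, 0 < ε → ∃ g' : ℂ → ℂ, Appr K g' ∧ ∀ z ∈ K, ‖g z - g' z‖ ≤ ε) : Appr K g := by
  intro ε hε
  obtain ⟨g', hg', h1⟩ := h (ε / 2) (by positivity)
  obtain ⟨p, hp⟩ := hg' (ε / 2) (by positivity)
  refine ⟨p, fun z hz => ?_⟩
  have a := h1 z hz
  have b := hp z hz
  have := norm_sub_le_norm_sub_add_norm_sub (g z) (g' z) (p.eval z)
  linarith

lemma diffOn_iter {U : Set ℂ} (hU : IsOpen U) {f : ℂ → ℂ} (hf : DifferentiableOn ℂ f U) (k : ℕ) :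
    DifferentiableOn ℂ (iteratedDeriv k f) U := by
  induction k with
  | zero => simpa using hf
  | succ k ih => rw [iteratedDeriv_succ]; exact ih.deriv hU

/-- Runge's theorem for star-shaped compact sets. -/
lemma runge_star {K U : Set ℂ} (hK : IsCompact K)
    (hs : ∀ z ∈ K, ∀ t : ℝ, 0 ≤ t → t ≤ 1 → (t : ℂ) * z ∈ K) (hU : IsOpen U) (hKU : K ⊆ U)
    {f : ℂ → ℂ} (hf : DifferentiableOn ℂ f U) : Appr K f := by
  obtain ⟨d, hd, hdU⟩ := hK.exists_cthickening_subset_open hU hKU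
  obtain ⟨B, hB0, hB⟩ : ∃ B : ℝ, 0 < B ∧ ∀ z ∈ K, ‖z‖ ≤ B := by
    simpa using poly_bdd hK Polynomial.X
  obtain ⟨m, hm⟩ := exists_nat_gt (2 * B / d)
  have hm0 : (0 : ℝ) < m := lt_of_le_of_lt (by positivity) hm
  have hmB : B / m ≤ d / 2 := by
    rw [div_lt_iff₀ hd] at hm
    rw [div_le_iff₀ hm0]
    nlinarith
  have key : ∀ j : ℕ, j ≤ m → ∀ f : ℂ → ℂ, DifferentiableOn ℂ f U →
      Appr K (fun z => f (((j / m : ℝ) : ℂ) * z)) := by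
    intro j
    induction j with
    | zero =>
      intro _ f _ ε hε
      exact ⟨Polynomial.C (f 0), fun z _ => by simpa using hε.le⟩
    | succ j ih =>
      intro hj f hf
      have hj' : j ≤ m := by omega
      have hjm : (j : ℝ) / m ≤ 1 := by
        rw [div_le_one hm0]; exact_mod_cast hj'
      obtain ⟨M, hM⟩ := (hK.cthickening (r := d)).exists_bound_of_continuousOn
        (hf.continuousOn.mono hdU)
      apply Appr.of_unif
      intro ε hε
      obtain ⟨n, hn⟩ : ∃ n : ℕ, |M| * (1 / 2 : ℝ) ^ n / (1 - 1 / 2) ≤ ε := by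
        obtain ⟨n, hn⟩ := exists_pow_lt_of_lt_one (x := ε / (2 * (|M| + 1)))
          (by positivity) (show (1 / 2 : ℝ) < 1 by norm_num)
        refine ⟨n, ?_⟩
        rw [lt_div_iff₀ (by positivity)] at hn
        have : 0 < (1 / 2 : ℝ) ^ n := by positivity
        have : |M| * (1 / 2 : ℝ) ^ n / (1 - 1 / 2) = 2 * |M| * (1 / 2 : ℝ) ^ n := by ring
        rw [this]
        nlinarith
      refine ⟨fun z => ∑ k ∈ Finset.range n, iteratedDeriv k f (((j / m : ℝ) : ℂ) * z) *
        (Polynomial.C ((k.factorial : ℂ)⁻¹ * ((m : ℂ)⁻¹) ^ k) * Polynomial.X ^ k).eval z, ?_, ?_⟩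
      · apply Appr.sum
        intro k
        exact Appr.mul_poly hK (ih hj' _ (diffOn_iter hU hf k)) _
      · intro z hz
        set w : ℂ := ((j / m : ℝ) : ℂ) * z with hw
        have hwK : w ∈ K := hs z hz _ (by positivity) hjm
        have hball : Metric.closedBall w d ⊆ Metric.cthickening d K :=
          Metric.closedBall_subset_cthickening hwK d
        have hfd : DifferentiableOn ℂ f (Metric.closedBall w d) := hf.mono (hball.trans hdU)
        have hz' : ‖z / m‖ ≤ d / 2 := by
          rw [norm_div, Complex.norm_natCast]
          exact le_trans (by gcongr; exact hB z hz) hmB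
        have hmem : w + z / m ∈ Metric.ball w d := by
          rw [mem_ball_iff_norm, add_sub_cancel_left]; linarith
        have hsum := Complex.hasSum_taylorSeries_on_ball
          (hfd.mono Metric.ball_subset_closedBall) hmem
        have hest := norm_sub_le_of_geometric_bound_of_hasSum (r := 1 / 2) (C := |M|)
          (by norm_num) (f := fun k => (k.factorial : ℂ)⁻¹ • (w + z / m - w) ^ k •
            iteratedDeriv k f w) ?_ hsum n
        · have e1 : (((j + 1 : ℕ) / m : ℝ) : ℂ) * z = w + z / m := by
            rw [hw]; push_cast; ring
          rw [e1, norm_sub_rev]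
          refine le_trans (le_of_eq ?_) (hest.trans hn)
          congr 2
          apply Finset.sum_congr rfl
          intro k _
          simp only [Polynomial.eval_mul, Polynomial.eval_C, Polynomial.eval_pow,
            Polynomial.eval_X, smul_eq_mul, add_sub_cancel_left]
          rw [← hw, div_eq_mul_inv z, mul_pow]; ring
        · intro k
          have hc := Complex.norm_iteratedDeriv_le_of_forall_mem_sphere_norm_le (c := w) (R := d)
            (C := |M|) (f := f) k hd
            ((hfd.mono (by rw [closure_ball _ hd.ne'])).diffContOnCl)
            (fun u hu => (hM u (hball (Metric.sphere_subset_closedBall hu))).trans (le_abs_self M))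
          rw [add_sub_cancel_left, smul_eq_mul, smul_eq_mul, norm_mul, norm_mul, norm_inv, norm_pow,
            Complex.norm_natCast]
          have hk : (0 : ℝ) < k.factorial := by positivity
          calc (k.factorial : ℝ)⁻¹ * (‖z / m‖ ^ k * ‖iteratedDeriv k f w‖)
              ≤ (k.factorial : ℝ)⁻¹ * ((d / 2) ^ k * (k.factorial * |M| / d ^ k)) := by gcongr
            _ = |M| * (1 / 2) ^ k := by
              rw [div_pow, div_pow, one_pow]; field_simp
  have := key m le_rfl f hf
  rw [div_self hm0.ne'] at this
  simpa using this

/-- Cartesian description of the bowtie. -/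
def KT (T R : ℝ) : Set ℂ := {z : ℂ | ‖z‖ ≤ R ∧ |z.im| ≤ T * |z.re|}

/-- The right lobe. -/
def KP (T R : ℝ) : Set ℂ := {z : ℂ | ‖z‖ ≤ R ∧ |z.im| ≤ T * z.re}

lemma KP_re {T R : ℝ} (hT : 0 < T) {z : ℂ} (hz : z ∈ KP T R) : 0 ≤ z.re := by
  have := (abs_nonneg _).trans hz.2
  exact nonneg_of_mul_nonneg_right this hT

lemma KP_sub {T R : ℝ} (hT : 0 < T) : KP T R ⊆ KT T R := by
  intro z hz
  exact ⟨hz.1, by rw [abs_of_nonneg (KP_re hT hz)]; exact hz.2⟩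

lemma KT_neg {T R : ℝ} {z : ℂ} (hz : z ∈ KT T R) : -z ∈ KT T R := by
  simpa [KT] using hz

lemma KT_cases {T R : ℝ} {z : ℂ} (hz : z ∈ KT T R) :
    z ∈ KP T R ∨ -z ∈ KP T R := by
  rcases le_total 0 z.re with h | h
  · left; exact ⟨hz.1, by simpa [abs_of_nonneg h] using hz.2⟩
  · right; exact ⟨by simpa using hz.1, by simpa [abs_of_nonpos h] using hz.2⟩

lemma KT_compact (T R : ℝ) : IsCompact (KT T R) := by
  refine (isCompact_closedBall (0 : ℂ) R).of_isClosed_subset ?_ ?_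
  · have h1 : IsClosed {z : ℂ | ‖z‖ ≤ R} := isClosed_le (by fun_prop) (by fun_prop)
    have h2 : IsClosed {z : ℂ | |z.im| ≤ T * |z.re|} := isClosed_le (by fun_prop) (by fun_prop)
    exact h1.inter h2
  · intro z hz; simpa using hz.1

lemma KP_compact (T R : ℝ) : IsCompact (KP T R) := by
  refine (isCompact_closedBall (0 : ℂ) R).of_isClosed_subset ?_ ?_
  · have h1 : IsClosed {z : ℂ | ‖z‖ ≤ R} := isClosed_le (by fun_prop) (by fun_prop)
    have h2 : IsClosed {z : ℂ | |z.im| ≤ T * z.re} := isClosed_le (by fun_prop) (by fun_prop)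
    exact h1.inter h2
  · intro z hz; simpa using hz.1

lemma KT_star {T R : ℝ} (z : ℂ) (hz : z ∈ KT T R) (t : ℝ) (h0 : 0 ≤ t) (h1 : t ≤ 1) :
    (t : ℂ) * z ∈ KT T R := by
  have hn := norm_nonneg z
  refine ⟨?_, ?_⟩
  · rw [norm_mul, Complex.norm_real, Real.norm_of_nonneg h0]; nlinarith [hz.1]
  · simp only [Complex.mul_re, Complex.mul_im, Complex.ofReal_re, Complex.ofReal_im, zero_mul,
      sub_zero, add_zero, abs_mul, abs_of_nonneg h0]
    nlinarith [hz.2]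

lemma KP_star {T R : ℝ} (z : ℂ) (hz : z ∈ KP T R) (t : ℝ) (h0 : 0 ≤ t) (h1 : t ≤ 1) :
    (t : ℂ) * z ∈ KP T R := by
  have hn := norm_nonneg z
  refine ⟨?_, ?_⟩
  · rw [norm_mul, Complex.norm_real, Real.norm_of_nonneg h0]; nlinarith [hz.1]
  · simp only [Complex.mul_re, Complex.mul_im, Complex.ofReal_re, Complex.ofReal_im, zero_mul,
      sub_zero, add_zero, abs_mul, abs_of_nonneg h0]
    nlinarith [hz.2]

lemma KP_convex (T R : ℝ) : Convex ℝ (KP T R) := by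
  intro x hx y hy a b ha hb hab
  refine ⟨?_, ?_⟩
  · calc ‖a • x + b • y‖ ≤ ‖a • x‖ + ‖b • y‖ := norm_add_le _ _
      _ = a * ‖x‖ + b * ‖y‖ := by
        rw [norm_smul, norm_smul, Real.norm_of_nonneg ha, Real.norm_of_nonneg hb]
      _ ≤ a * R + b * R := by gcongr; exacts [hx.1, hy.1]
      _ = R := by rw [← add_mul, hab, one_mul]
  · simp only [Complex.add_re, Complex.add_im, Complex.real_smul, Complex.mul_re, Complex.mul_im,
      Complex.ofReal_re, Complex.ofReal_im, zero_mul, sub_zero, add_zero]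
    calc |a * x.im + b * y.im| ≤ |a * x.im| + |b * y.im| := abs_add_le _ _
      _ = a * |x.im| + b * |y.im| := by rw [abs_mul, abs_mul, abs_of_nonneg ha, abs_of_nonneg hb]
      _ ≤ a * (T * x.re) + b * (T * y.re) := by gcongr; exacts [hx.2, hy.2]
      _ = _ := by ring

lemma KP_interior (T R : ℝ) {z : ℂ} (h1 : ‖z‖ < R) (h2 : |z.im| < T * z.re) :
    z ∈ interior (KP T R) := by
  refine interior_maximal (t := {z : ℂ | ‖z‖ < R} ∩ {z : ℂ | |z.im| < T * z.re}) ?_ ?_ ⟨h1, h2⟩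
  · intro w hw; exact ⟨le_of_lt hw.1, le_of_lt hw.2⟩
  · exact (isOpen_lt (by fun_prop) (by fun_prop)).inter (isOpen_lt (by fun_prop) (by fun_prop))

/-- Mergelyan on the right lobe. -/
lemma KP_appr {T R : ℝ} (hT : 0 < T) (hR : 0 < R) {f : ℂ → ℂ} (hc : ContinuousOn f (KP T R))
    (hd : DifferentiableOn ℂ f (interior (KP T R))) : Appr (KP T R) f := by
  apply Appr.of_unif
  intro ε hε
  have huc := (KP_compact T R).uniformContinuousOn_of_continuous hc
  rw [Metric.uniformContinuousOn_iff_le] at huc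
  obtain ⟨δ, hδ, hu⟩ := huc ε hε
  set a : ℂ := ((R / 2 : ℝ) : ℂ) with ha
  have ham : a ∈ interior (KP T R) := by
    apply KP_interior
    · rw [ha, Complex.norm_real, Real.norm_of_nonneg (by positivity)]; linarith
    · simp [ha]; positivity
  obtain ⟨t, ht0, ht1, htδ⟩ : ∃ t : ℝ, 0 < t ∧ t ≤ 1 ∧ t * (2 * R) ≤ δ := by
    refine ⟨min 1 (δ / (2 * R)), by positivity, min_le_left _ _, ?_⟩
    calc _ ≤ δ / (2 * R) * (2 * R) := by gcongr; exact min_le_right _ _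
      _ = δ := by field_simp
  have hmap : ∀ z ∈ KP T R, t • a + (1 - t) • z ∈ interior (KP T R) := fun z hz =>
    (KP_convex T R).combo_interior_self_mem_interior ham hz ht0 (by linarith) (by ring)
  refine ⟨fun z => f (t • a + (1 - t) • z), ?_, ?_⟩
  · refine runge_star (KP_compact T R) KP_star
      (U := (fun z : ℂ => t • a + (1 - t) • z) ⁻¹' (interior (KP T R))) ?_ hmap ?_
    · exact isOpen_interior.preimage (by fun_prop)
    · refine hd.comp (Differentiable.differentiableOn ?_) (fun z hz => hz)
      have : (fun z : ℂ => t • a + (1 - t) • z) = fun z : ℂ => (t : ℂ) * a + ((1 - t : ℝ) : ℂ) * z := by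
        ext z; simp
      rw [this]; fun_prop
  · intro z hz
    rw [← dist_eq_norm]
    apply hu z hz _ (interior_subset (hmap z hz))
    rw [dist_eq_norm]
    have e : z - (t • a + (1 - t) • z) = (t : ℂ) * (z - a) := by
      simp; ring
    rw [e, norm_mul, Complex.norm_real, Real.norm_of_nonneg ht0.le]
    refine le_trans ?_ htδ
    have h1 := norm_sub_le z a
    have h2 := hz.1
    have h3 : ‖a‖ ≤ R := (interior_subset ham).1
    gcongr; linarith

/-- Polynomial approximation of `z` on the right, `0` on the left. -/
lemma half_appr {T R : ℝ} (hT : 0 < T) : ∀ ε : ℝ, 0 < ε → ∃ q : Polynomial ℂ,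
    ∀ z ∈ KP T R, ‖z - q.eval z‖ ≤ ε ∧ ‖q.eval (-z)‖ ≤ ε := by
  intro ε hε
  set S : ℂ → ℂ := fun z => (z ^ 2 + (ε : ℂ) ^ 2) ^ ((1 / 2 : ℝ) : ℂ) with hS
  have hslit : ∀ z ∈ KT T R, z ^ 2 + (ε : ℂ) ^ 2 ∈ Complex.slitPlane := by
    intro z hz
    rw [Complex.mem_slitPlane_iff]
    by_contra! hcon
    have hre := hcon.1
    have him := hcon.2
    simp [pow_two] at hre him
    have h0 : z.im = 0 := by
      have h2 := hz.2
      have : z.re * z.im = 0 := by linarith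
      rcases mul_eq_zero.1 this with h | h
      · rw [h] at h2; simpa using h2
      · exact h
    rw [h0] at hre
    nlinarith [mul_self_nonneg z.re]
  have hA : Appr (KT T R) S := by
    refine runge_star (KT_compact T R) KT_star
      (U := (fun z : ℂ => z ^ 2 + (ε : ℂ) ^ 2) ⁻¹' Complex.slitPlane) ?_ hslit ?_
    · exact Complex.isOpen_slitPlane.preimage (by fun_prop)
    · intro z hz
      refine DifferentiableAt.differentiableWithinAt ?_
      exact DifferentiableAt.cpow (by fun_prop) (by fun_prop) hz
  have hest : ∀ z ∈ KP T R, ‖S z - z‖ ≤ ε := by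
    intro z hz
    have hsl := hslit z (KP_sub hT hz)
    have hsq : S z ^ 2 = z ^ 2 + (ε : ℂ) ^ 2 := by
      rw [hS]
      simp only
      rw [← Complex.cpow_nat_mul]
      norm_num
    have hSre : 0 < (S z).re := by
      rw [hS]; simp only
      rw [Complex.cpow_ofReal_re]
      have hne : z ^ 2 + (ε : ℂ) ^ 2 ≠ 0 := Complex.slitPlane_ne_zero hsl
      have h1 := Complex.arg_le_pi (z ^ 2 + (ε : ℂ) ^ 2)
      have h2 := Complex.neg_pi_lt_arg (z ^ 2 + (ε : ℂ) ^ 2)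
      have h3 := (Complex.mem_slitPlane_iff_arg.1 hsl).1
      have h4 := lt_of_le_of_ne h1 h3
      apply mul_pos
      · exact Real.rpow_pos_of_pos (norm_pos_iff.2 hne) _
      · apply Real.cos_pos_of_mem_Ioo; constructor <;> linarith
    have hzre := KP_re hT hz
    have him : (S z).re * (S z).im = z.re * z.im := by
      have := congrArg Complex.im hsq
      simp [pow_two] at this
      linarith
    have hin : 0 ≤ (S z).im * z.im := by
      have h1 : (S z).re * ((S z).im * z.im) = z.re * (z.im * z.im) := by
        rw [← mul_assoc, him]; ring
      have h2 : 0 ≤ (S z).re * ((S z).im * z.im) := by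
        rw [h1]; exact mul_nonneg hzre (mul_self_nonneg _)
      exact nonneg_of_mul_nonneg_right h2 hSre
    have hle : ‖S z - z‖ ≤ ‖S z + z‖ := by
      rw [← sq_le_sq₀ (norm_nonneg _) (norm_nonneg _), ← Complex.normSq_eq_norm_sq,
        ← Complex.normSq_eq_norm_sq, Complex.normSq_apply, Complex.normSq_apply]
      simp only [Complex.sub_re, Complex.sub_im, Complex.add_re, Complex.add_im]
      nlinarith [mul_nonneg hSre.le hzre]
    have hprod : ‖S z - z‖ * ‖S z + z‖ = ε ^ 2 := by
      rw [← norm_mul]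
      have : (S z - z) * (S z + z) = (ε : ℂ) ^ 2 := by linear_combination hsq
      rw [this, norm_pow, Complex.norm_real, Real.norm_of_nonneg hε.le]
    have h5 : ‖S z - z‖ ^ 2 ≤ ε ^ 2 := by
      rw [← hprod, pow_two]; gcongr
    exact (sq_le_sq₀ (norm_nonneg _) hε.le).1 h5
  obtain ⟨p, hp⟩ := hA ε hε
  refine ⟨Polynomial.C (1 / 2) * (Polynomial.X + p), fun z hz => ?_⟩
  have h1 := hest z hz
  have h2 := hp z (KP_sub hT hz)
  have h3 := hp (-z) (KT_neg (KP_sub hT hz))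
  have h4 : S (-z) = S z := by simp [hS]
  rw [h4] at h3
  simp only [Polynomial.eval_mul, Polynomial.eval_C, Polynomial.eval_add, Polynomial.eval_X]
  constructor
  · have : z - 1 / 2 * (z + p.eval z) = (1 / 2 : ℂ) * ((S z - p.eval z) - (S z - z)) := by ring
    rw [this, norm_mul]
    have := norm_sub_le (S z - p.eval z) (S z - z)
    have hh : ‖(1 / 2 : ℂ)‖ = 1 / 2 := by norm_num
    rw [hh]
    linarith
  · have : 1 / 2 * (-z + p.eval (-z)) = (1 / 2 : ℂ) * ((S z - z) - (S z - p.eval (-z))) := by ring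
    rw [this, norm_mul]
    have := norm_sub_le (S z - z) (S z - p.eval (-z))
    have hh : ‖(1 / 2 : ℂ)‖ = 1 / 2 := by norm_num
    rw [hh]
    linarith

lemma half_appr' {T R : ℝ} (hT : 0 < T) (hR : 0 < R) {f : ℂ → ℂ} (hc : ContinuousOn f (KP T R))
    (hd : DifferentiableOn ℂ f (interior (KP T R))) (h0 : f 0 = 0) :
    ∀ ε : ℝ, 0 < ε → ∃ q : Polynomial ℂ,
    ∀ z ∈ KP T R, ‖f z - q.eval z‖ ≤ ε ∧ ‖q.eval (-z)‖ ≤ ε := by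
  intro ε hε
  obtain ⟨p, hp⟩ := KP_appr hT hR hc hd (ε / 4) (by positivity)
  have hp0 : ‖p.eval 0‖ ≤ ε / 4 := by
    have := hp 0 ⟨by simpa using hR.le, by simp⟩
    simpa [h0] using this
  obtain ⟨p1, hp1⟩ : ∃ p1 : Polynomial ℂ, p - Polynomial.C (p.eval 0) = Polynomial.X * p1 := by
    have : Polynomial.X ∣ p - Polynomial.C (p.eval 0) := by
      rw [Polynomial.X_dvd_iff, Polynomial.coeff_zero_eq_eval_zero]; simp
    exact this
  have hpe : ∀ z, p.eval z = p.eval 0 + z * p1.eval z := by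
    intro z
    have := congrArg (Polynomial.eval z) hp1
    simp at this
    linear_combination this
  obtain ⟨B, hB0, hB⟩ := poly_bdd (KT_compact T R) p1
  obtain ⟨q, hq⟩ := half_appr (R := R) hT (ε / (2 * B)) (by positivity)
  refine ⟨q * p1, fun z hz => ?_⟩
  obtain ⟨h1, h2⟩ := hq z hz
  have b1 := hB z (KP_sub hT hz)
  have b2 := hB (-z) (KT_neg (KP_sub hT hz))
  rw [Polynomial.eval_mul, Polynomial.eval_mul]
  have e0 : ε / (2 * B) * B = ε / 2 := by field_simp
  constructor
  · have e : f z - q.eval z * p1.eval z =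
      (f z - p.eval z) + (p.eval 0 + (z - q.eval z) * p1.eval z) := by
      rw [hpe z]; ring
    have n1 := norm_add_le (f z - p.eval z) (p.eval 0 + (z - q.eval z) * p1.eval z)
    have n2 := norm_add_le (p.eval 0) ((z - q.eval z) * p1.eval z)
    have n3 : ‖(z - q.eval z) * p1.eval z‖ ≤ ε / (2 * B) * B := by
      rw [norm_mul]; exact mul_le_mul h1 b1 (norm_nonneg _) (by positivity)
    have := hp z hz
    rw [e]; linarith
  · have n3 : ‖q.eval (-z) * p1.eval (-z)‖ ≤ ε / (2 * B) * B := by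
      rw [norm_mul]; exact mul_le_mul h2 b2 (norm_nonneg _) (by positivity)
    linarith

/-- Mergelyan's theorem on the bowtie. -/
lemma KT_appr {T R : ℝ} (hT : 0 < T) (hR : 0 < R) {f : ℂ → ℂ} (hc : ContinuousOn f (KT T R))
    (hd : DifferentiableOn ℂ f (interior (KT T R))) : Appr (KT T R) f := by
  intro ε hε
  have hinter : interior (KP T R) ⊆ interior (KT T R) := interior_mono (KP_sub hT)
  have hneg : ∀ z ∈ interior (KP T R), -z ∈ interior (KT T R) := by
    intro z hz
    refine interior_maximal (t := Neg.neg ⁻¹' interior (KP T R)) ?_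
      (isOpen_interior.preimage continuous_neg) (by simpa using hz)
    intro w hw
    have := KT_neg (KP_sub hT (interior_subset hw))
    simpa using this
  obtain ⟨q1, hq1⟩ := half_appr' hT hR (f := fun z => f z - f 0)
    ((hc.mono (KP_sub hT)).sub continuousOn_const) ((hd.mono hinter).sub_const _) (by simp)
    (ε / 2) (by positivity)
  obtain ⟨q2, hq2⟩ := half_appr' hT hR (f := fun z => f (-z) - f 0)
    ((hc.comp continuousOn_neg (fun z hz => KT_neg (KP_sub hT hz))).sub continuousOn_const)
    ((hd.comp (differentiable_neg.differentiableOn) hneg).sub_const _) (by simp)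
    (ε / 2) (by positivity)
  refine ⟨Polynomial.C (f 0) + (q1 + q2.comp (-Polynomial.X)), fun z hz => ?_⟩
  simp only [Polynomial.eval_add, Polynomial.eval_C, Polynomial.eval_comp, Polynomial.eval_neg,
    Polynomial.eval_X]
  rcases KT_cases hz with h | h
  · have h1 := (hq1 z h).1
    have h2 := (hq2 z h).2
    have := norm_sub_le (f z - f 0 - q1.eval z) (q2.eval (-z))
    have e : f z - (f 0 + (q1.eval z + q2.eval (-z))) =
      (f z - f 0 - q1.eval z) - (q2.eval (-z)) := by ring
    rw [e]; linarith
  · have h1 := (hq1 _ h).2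
    have h2 := (hq2 _ h).1
    rw [neg_neg] at h1 h2
    have := norm_sub_le (f z - f 0 - q2.eval (-z)) (q1.eval z)
    have e : f z - (f 0 + (q1.eval z + q2.eval (-z))) =
      (f z - f 0 - q2.eval (-z)) - (q1.eval z) := by ring
    rw [e]; linarith

lemma max_ball (Q : Polynomial ℂ) (a : ℂ) {s M : ℝ} (hs : 0 < s)
    (h : ∀ z, ‖z - a‖ = s → ‖Q.eval z‖ ≤ M) : ∀ z, ‖z - a‖ ≤ s → ‖Q.eval z‖ ≤ M := by
  intro z hz
  refine Complex.norm_le_of_forall_mem_frontier_norm_le (f := fun z => Q.eval z)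
    (Metric.isBounded_ball (x := a) (r := s)) Q.differentiable.diffContOnCl ?_ ?_
  · intro w hw
    rw [frontier_ball _ hs.ne'] at hw
    exact h w (mem_sphere_iff_norm.1 hw)
  · rw [closure_ball _ hs.ne']; exact mem_closedBall_iff_norm.2 hz

/-- Hadamard's three circles theorem. -/
lemma three_circles (Q : Polynomial ℂ) (a : ℂ) {ρ s r M x y θ : ℝ} (hρ : 0 < ρ) (hρs : ρ ≤ s)
    (hsr : s ≤ r) (hρr : ρ < r) (hM : 0 < M)
    (hθ : Real.log (r / s) = θ * Real.log (r / ρ))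
    (h1 : ∀ z, ‖z - a‖ = ρ → ‖Q.eval z‖ ≤ M * Real.exp (-x))
    (h2 : ∀ z, ‖z - a‖ = r → ‖Q.eval z‖ ≤ M * Real.exp y) :
    ∀ z, ‖z - a‖ ≤ s → ‖Q.eval z‖ ≤ M * Real.exp (-(θ * x) + (1 - θ) * y) := by
  have hs : 0 < s := hρ.trans_le hρs
  have hr : 0 < r := hs.trans_le hsr
  apply max_ball Q a hs
  intro z hz
  have hza : z - a ≠ 0 := by rw [← norm_pos_iff, hz]; exact hs
  have hlog : Real.log ρ < Real.log r := Real.log_lt_log hρ hρr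
  have hre : (Complex.log (z - a)).re = Real.log s := by rw [Complex.log_re, hz]
  have hn : ∀ w : ℂ, ‖a + Complex.exp w - a‖ = Real.exp w.re := by
    intro w; rw [add_sub_cancel_left, Complex.norm_exp]
  have hdiff : Differentiable ℂ (fun w : ℂ => Q.eval (a + Complex.exp w)) :=
    Q.differentiable.comp (by fun_prop)
  have key := Complex.HadamardThreeLines.norm_le_interp_of_mem_verticalClosedStrip'
    (f := fun w : ℂ => Q.eval (a + Complex.exp w)) (z := Complex.log (z - a))
    (a := M * Real.exp (-x)) (b := M * Real.exp y) hlog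
    (by
      show (Complex.log (z - a)).re ∈ Set.Icc _ _
      rw [hre]; exact ⟨Real.log_le_log hρ hρs, Real.log_le_log hs hsr⟩)
    hdiff.diffContOnCl
    (by
      obtain ⟨B, hB0, hB⟩ := poly_bdd (isCompact_closedBall a r) Q
      refine ⟨B, ?_⟩
      rintro _ ⟨w, hw, rfl⟩
      apply hB
      rw [mem_closedBall_iff_norm, hn]
      have : w.re ≤ Real.log r := hw.2
      calc Real.exp w.re ≤ Real.exp (Real.log r) := Real.exp_le_exp.2 this
        _ = r := Real.exp_log hr)
    (by
      intro w hw
      apply h1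
      rw [hn, show w.re = Real.log ρ from hw, Real.exp_log hρ])
    (by
      intro w hw
      apply h2
      rw [hn, show w.re = Real.log r from hw, Real.exp_log hr])
  simp only [Complex.exp_log hza, add_sub_cancel, hre] at key
  rw [Real.log_div hr.ne' hs.ne', Real.log_div hr.ne' hρ.ne'] at hθ
  have hτ : (Real.log s - Real.log ρ) / (Real.log r - Real.log ρ) = 1 - θ := by
    rw [div_eq_iff (by linarith)]; linarith
  rw [hτ] at key
  refine key.trans (le_of_eq ?_)
  rw [Real.mul_rpow hM.le (Real.exp_pos _).le, Real.mul_rpow hM.le (Real.exp_pos _).le,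
    ← Real.exp_mul, ← Real.exp_mul]
  calc _ = (M ^ (1 - (1 - θ)) * M ^ (1 - θ)) *
        (Real.exp (-x * (1 - (1 - θ))) * Real.exp (y * (1 - θ))) := by ring
    _ = _ := by
      rw [← Real.rpow_add hM, ← Real.exp_add]
      rw [show 1 - (1 - θ) + (1 - θ) = 1 by ring, Real.rpow_one]
      congr 2; ring

/-- Bernstein-Walsh for a disc. -/
lemma bw_disc (Q : Polynomial ℂ) (N : ℕ) (hN : Q.natDegree ≤ N) (a : ℂ) {ρ M : ℝ} (hρ : 0 < ρ)
    (h : ∀ z, ‖z - a‖ = ρ → ‖Q.eval z‖ ≤ M) :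
    ∀ z, ρ ≤ ‖z - a‖ → ‖Q.eval z‖ ≤ M * (‖z - a‖ / ρ) ^ N := by
  intro z hz
  set q : Polynomial ℂ := Q.comp (Polynomial.X + Polynomial.C a) with hq
  have hqN : q.natDegree ≤ N := by
    rw [hq, Polynomial.natDegree_comp, Polynomial.natDegree_X_add_C, mul_one]; exact hN
  have hqe : ∀ x, q.eval x = Q.eval (x + a) := by intro x; simp [hq]
  have hrev : ∀ x : ℂ, x ≠ 0 → (Polynomial.reflect N q).eval x⁻¹ * x ^ N = q.eval x := by
    intro x hx
    let _ := invertibleOfNonzero hx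
    have := Polynomial.eval₂_reflect_mul_pow (RingHom.id ℂ) x N q hqN
    simpa [Polynomial.eval₂_id] using this
  have hb := max_ball (Polynomial.reflect N q) 0 (s := ρ⁻¹) (M := M * (ρ⁻¹) ^ N) (by positivity) ?_
  · have hx : z - a ≠ 0 := by rw [← norm_pos_iff]; linarith
    have h1 := hrev _ hx
    rw [hqe, sub_add_cancel] at h1
    rw [← h1, norm_mul, norm_pow]
    have h2 := hb (z - a)⁻¹ (by
      rw [sub_zero, norm_inv]; exact inv_anti₀ hρ hz)
    calc _ ≤ M * ρ⁻¹ ^ N * ‖z - a‖ ^ N := by gcongr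
      _ = _ := by rw [div_eq_mul_inv, mul_pow]; ring
  · intro w hw
    rw [sub_zero] at hw
    have hw0 : w ≠ 0 := by rw [← norm_pos_iff, hw]; positivity
    have h1 := hrev w⁻¹ (inv_ne_zero hw0)
    rw [inv_inv, hqe] at h1
    have h2 := h (w⁻¹ + a) (by rw [add_sub_cancel_right, norm_inv, hw, inv_inv])
    rw [← h1, norm_mul, norm_pow, norm_inv, hw, inv_inv] at h2
    rw [inv_pow, ← div_eq_mul_inv, le_div_iff₀ (by positivity)]
    exact h2

/-- Propagation of smallness. -/
lemma propagate {Ω : Set ℂ} (hΩ : IsOpen Ω) (hpc : IsPreconnected Ω) (Q : ℕ → Polynomial ℂ)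
    {M : ℝ} (hM : 0 < M) (hQ : ∀ n : ℕ, 1 ≤ n → ∀ z ∈ Ω, ‖(Q n).eval z‖ ≤ M) {a : ℂ} (ha : a ∈ Ω)
    (hs : ∃ c : ℝ, 0 < c ∧ ∀ᶠ z in nhds a, ∀ n : ℕ, 1 ≤ n →
      ‖(Q n).eval z‖ ≤ M * Real.exp (-(c * n))) :
    ∀ b ∈ Ω, ∃ c : ℝ, 0 < c ∧ ∀ᶠ z in nhds b, ∀ n : ℕ, 1 ≤ n →
      ‖(Q n).eval z‖ ≤ M * Real.exp (-(c * n)) := by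
  set S : Set ℂ := {b | ∃ c : ℝ, 0 < c ∧ ∀ᶠ z in nhds b, ∀ n : ℕ, 1 ≤ n →
      ‖(Q n).eval z‖ ≤ M * Real.exp (-(c * n))} with hS
  have hSo : IsOpen S := by
    rw [isOpen_iff_mem_nhds]
    rintro b ⟨c, hc, hb⟩
    filter_upwards [hb.eventually_nhds] with w hw
    exact ⟨c, hc, hw⟩
  refine hpc.subset_of_closure_inter_subset hSo ⟨a, ha, hs⟩ ?_
  rintro b ⟨hbS, hbΩ⟩
  obtain ⟨d, hd, hdΩ⟩ := Metric.isOpen_iff.1 hΩ b hbΩ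
  obtain ⟨e, heS, hbe⟩ := Metric.mem_closure_iff.1 hbS (d / 8) (by positivity)
  obtain ⟨c, hc, he⟩ := heS
  obtain ⟨ρ', hρ', hball⟩ := Metric.eventually_nhds_iff_ball.1 he
  set ρ := min (ρ' / 2) (d / 8) with hρd
  have hρ : 0 < ρ := by positivity
  have hρ1 : ρ < ρ' := lt_of_le_of_lt (min_le_left _ _) (by linarith)
  have hρ2 : ρ ≤ d / 8 := min_le_right _ _
  have hbe' : ‖b - e‖ < d / 8 := by rwa [dist_eq_norm] at hbe
  set θ := Real.log ((d / 2) / (d / 4)) / Real.log ((d / 2) / ρ) with hθ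
  have hl1 : 0 < Real.log ((d / 2) / (d / 4)) := by
    apply Real.log_pos; rw [lt_div_iff₀ (by positivity)]; linarith
  have hl2 : 0 < Real.log ((d / 2) / ρ) := by
    apply Real.log_pos; rw [lt_div_iff₀ (by positivity)]; linarith
  have hθ0 : 0 < θ := by positivity
  refine ⟨θ * c, by positivity, ?_⟩
  filter_upwards [Metric.ball_mem_nhds b (show 0 < d / 8 by positivity)] with z hz n hn
  have hz' : ‖z - b‖ < d / 8 := mem_ball_iff_norm.1 hz
  have := three_circles (Q n) e (ρ := ρ) (s := d / 4) (r := d / 2) (M := M) (x := c * n) (y := 0)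
    (θ := θ) hρ (by linarith) (by linarith) (by linarith) hM
    (by rw [hθ, div_mul_cancel₀ _ hl2.ne'])
    (fun w hw => hball w (by rw [mem_ball_iff_norm, hw]; exact hρ1) n hn)
    (fun w hw => by
      rw [Real.exp_zero, mul_one]
      apply hQ n hn
      apply hdΩ
      rw [mem_ball_iff_norm]
      have := norm_sub_le_norm_sub_add_norm_sub w e b
      rw [norm_sub_rev e b] at this
      linarith) z (by
      have := norm_sub_le_norm_sub_add_norm_sub z b e
      linarith)
  refine this.trans (le_of_eq ?_)
  congr 2; ring

lemma small_compact {L : Set ℂ} (hL : IsCompact L) (Q : ℕ → Polynomial ℂ)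
    {M : ℝ} (hM : 0 < M)
    (h : ∀ b ∈ L, ∃ c : ℝ, 0 < c ∧ ∀ᶠ z in nhds b, ∀ n : ℕ, 1 ≤ n →
      ‖(Q n).eval z‖ ≤ M * Real.exp (-(c * n))) :
    ∃ c : ℝ, 0 < c ∧ ∀ z ∈ L, ∀ n : ℕ, 1 ≤ n → ‖(Q n).eval z‖ ≤ M * Real.exp (-(c * n)) := by
  refine hL.induction_on (p := fun s => ∃ c : ℝ, 0 < c ∧ ∀ z ∈ s, ∀ n : ℕ, 1 ≤ n →
    ‖(Q n).eval z‖ ≤ M * Real.exp (-(c * n))) ?_ ?_ ?_ ?_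
  · exact ⟨1, one_pos, by simp⟩
  · rintro s t hst ⟨c, hc, h⟩
    exact ⟨c, hc, fun z hz => h z (hst hz)⟩
  · rintro s t ⟨c, hc, h⟩ ⟨c', hc', h'⟩
    refine ⟨min c c', by positivity, ?_⟩
    rintro z (hz | hz) n hn
    · refine (h z hz n hn).trans ?_
      gcongr; exact min_le_left _ _
    · refine (h' z hz n hn).trans ?_
      gcongr; exact min_le_right _ _
  · intro x hx
    obtain ⟨c, hc, hb⟩ := h x hx
    exact ⟨_, mem_nhdsWithin_of_mem_nhds hb, c, hc, fun z hz => hz⟩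

/-- Decay inside the right lobe. -/
lemma inner_decay (Q : Polynomial ℂ) {r M c : ℝ} (hr : 0 < r) (hM : 0 < M)
    (h1 : ∀ z : ℂ, ‖z‖ ≤ r → |z.im| ≤ z.re → ‖Q.eval z‖ ≤ M)
    (h2 : ∀ z : ℂ, ‖z‖ = r → |z.im| ≤ z.re → ‖Q.eval z‖ ≤ M * Real.exp (-c)) (hc : 0 ≤ c) :
    ∀ z : ℂ, ‖z‖ < r → |z.im| < z.re →
      ‖Q.eval z‖ ≤ M * Real.exp (-(c / r ^ 2 * (z.re ^ 2 - z.im ^ 2))) := by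
  intro z hz1 hz2
  set D : Set ℂ := {z : ℂ | ‖z‖ < r} ∩ {z : ℂ | |z.im| < z.re} with hD
  have hDo : IsOpen D := (isOpen_lt (by fun_prop) (by fun_prop)).inter
    (isOpen_lt (by fun_prop) (by fun_prop))
  have hcl : closure D ⊆ {z : ℂ | ‖z‖ ≤ r} ∩ {z : ℂ | |z.im| ≤ z.re} := by
    apply closure_minimal
    · rintro w ⟨hw1, hw2⟩
      simp only [Set.mem_ofPred_eq] at hw1 hw2
      exact ⟨by simpa using hw1.le, by simpa using hw2.le⟩
    · exact (isClosed_le (by fun_prop) (by fun_prop)).inter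
        (isClosed_le (by fun_prop) (by fun_prop))
  have hne : ∀ z : ℂ, ‖Complex.exp (((c / r ^ 2 : ℝ) : ℂ) * z ^ 2)‖ =
      Real.exp (c / r ^ 2 * (z.re ^ 2 - z.im ^ 2)) := by
    intro z
    rw [Complex.norm_exp, Complex.re_ofReal_mul]
    simp [pow_two]
  have key := Complex.norm_le_of_forall_mem_frontier_norm_le (U := D) (C := M)
    (f := fun z => Q.eval z * Complex.exp (((c / r ^ 2 : ℝ) : ℂ) * z ^ 2)) ?_ ?_ ?_
    (subset_closure (show z ∈ D from ⟨hz1, hz2⟩))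
  · simp only [norm_mul, hne] at key
    rw [Real.exp_neg, ← div_eq_mul_inv, le_div_iff₀ (Real.exp_pos _)]
    exact key
  · exact (Metric.isBounded_ball (x := (0 : ℂ)) (r := r)).subset
      (fun w hw => by simpa using hw.1)
  · exact (Q.differentiable.mul (by fun_prop)).diffContOnCl
  · intro w hw
    rw [hDo.frontier_eq] at hw
    obtain ⟨hw1, hw2⟩ := hcl hw.1
    simp only [Set.mem_ofPred_eq] at hw1 hw2
    simp only [norm_mul, hne]
    rcases lt_or_eq_of_le hw1 with h | h
    · have h3 : |w.im| = w.re := by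
        by_contra hcon
        exact hw.2 ⟨h, lt_of_le_of_ne hw2 hcon⟩
      have h4 : w.re ^ 2 - w.im ^ 2 = 0 := by rw [← h3, sq_abs]; ring
      rw [h4, mul_zero, Real.exp_zero, mul_one]
      exact h1 w hw1 hw2
    · have h3 := h2 w h hw2
      have h4 : w.re ^ 2 - w.im ^ 2 ≤ r ^ 2 := by
        have := Complex.sq_norm w
        rw [Complex.normSq_apply, h] at this
        nlinarith [sq_nonneg w.im]
      have h5 : c / r ^ 2 * (w.re ^ 2 - w.im ^ 2) ≤ c := by
        calc _ ≤ c / r ^ 2 * r ^ 2 := by gcongr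
          _ = c := by field_simp
      calc _ ≤ M * Real.exp (-c) * Real.exp c := by gcongr
        _ = M := by rw [mul_assoc, ← Real.exp_add]; simp

lemma cpow_re_lb {T γ : ℝ} (hT : 1 < T) (hγ0 : 0 < γ)
    (hγ : Real.arctan (1 / T) * γ < Real.pi / 2) (w : ℂ) (hw : T * |w.im| ≤ w.re) :
    ‖w‖ ^ γ * Real.cos (Real.arctan (1 / T) * γ) ≤ (w ^ (γ : ℂ)).re := by
  rw [Complex.cpow_ofReal_re]
  rcases eq_or_ne w 0 with rfl | h0
  · simp [Real.zero_rpow hγ0.ne']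
  have hre : 0 < w.re := by
    have h1 : 0 ≤ T * |w.im| := by positivity
    rcases lt_or_eq_of_le (h1.trans hw) with h | h
    · exact h
    · exfalso; apply h0
      rw [← h] at hw
      have : |w.im| = 0 := by nlinarith [abs_nonneg w.im]
      exact Complex.ext h.symm (by simpa using this)
  have harg : |w.arg| ≤ Real.arctan (1 / T) := by
    have hlt := Complex.abs_arg_lt_pi_div_two_iff.2 (Or.inl hre)
    rw [abs_lt] at hlt
    have e : w.arg = Real.arctan (w.im / w.re) := by
      rw [← Complex.tan_arg, Real.arctan_tan hlt.1 hlt.2]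
    have hb : |w.im / w.re| ≤ 1 / T := by
      rw [abs_div, abs_of_pos hre, div_le_div_iff₀ hre (by linarith)]; linarith
    rw [abs_le] at hb ⊢
    rw [e]
    constructor
    · rw [← Real.arctan_neg]; exact Real.arctan_mono hb.1
    · exact Real.arctan_mono hb.2
  have hcos : Real.cos (Real.arctan (1 / T) * γ) ≤ Real.cos (w.arg * γ) := by
    rw [← Real.cos_abs (w.arg * γ)]
    apply Real.cos_le_cos_of_nonneg_of_le_pi (abs_nonneg _)
    · linarith [Real.pi_pos]
    · rw [abs_mul, abs_of_pos hγ0]; gcongr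
  gcongr

lemma sector_growth {T R γ κ A0 A M : ℝ} (hT : 1 < T) (hR : 0 < R) (hγ0 : 0 < γ)
    (hγ : Real.arctan (1 / T) * γ < Real.pi / 2) (hκ : κ = Real.cos (Real.arctan (1 / T) * γ))
    (hA0 : 0 ≤ A0) (hA : A = A0 / (κ * R ^ γ)) (hM : 0 < M) (N : ℕ)
    (F : ℂ → ℂ) (hF : Differentiable ℂ F)
    (h1 : ∀ w : ℂ, ‖w‖ ≤ R → T * |w.im| = w.re → ‖F w‖ ≤ M)
    (h2 : ∀ w : ℂ, ‖w‖ = R → ‖F w‖ ≤ M * Real.exp (N * A0)) :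
    ∀ w : ℂ, ‖w‖ < R → T * |w.im| < w.re → ‖F w‖ ≤ M * Real.exp (N * A * ‖w‖ ^ γ) := by
  intro z hz1 hz2
  have hκ0 : 0 < κ := by
    rw [hκ]
    apply Real.cos_pos_of_mem_Ioo
    refine ⟨?_, hγ⟩
    have : 0 < Real.arctan (1 / T) := Real.arctan_pos.2 (by positivity)
    have : 0 < Real.arctan (1 / T) * γ := by positivity
    linarith [Real.pi_pos]
  have hRγ : 0 < R ^ γ := Real.rpow_pos_of_pos hR _
  have hA00 : 0 ≤ A := by rw [hA]; positivity
  set D : Set ℂ := {z : ℂ | ‖z‖ < R} ∩ {z : ℂ | T * |z.im| < z.re} with hD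
  have hDo : IsOpen D := (isOpen_lt (by fun_prop) (by fun_prop)).inter
    (isOpen_lt (by fun_prop) (by fun_prop))
  have hcl : closure D ⊆ {z : ℂ | ‖z‖ ≤ R} ∩ {z : ℂ | T * |z.im| ≤ z.re} := by
    apply closure_minimal
    · rintro w ⟨hw1, hw2⟩
      simp only [Set.mem_ofPred_eq] at hw1 hw2
      exact ⟨by simpa using hw1.le, by simpa using hw2.le⟩
    · exact (isClosed_le (by fun_prop) (by fun_prop)).inter
        (isClosed_le (by fun_prop) (by fun_prop))
  have hne : ∀ z : ℂ, ‖Complex.exp (-((N * A : ℝ) : ℂ) * z ^ (γ : ℂ))‖ =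
      Real.exp (-(N * A * (z ^ (γ : ℂ)).re)) := by
    intro z
    rw [Complex.norm_exp, neg_mul, Complex.neg_re, Complex.re_ofReal_mul]
  have hlb : ∀ w : ℂ, T * |w.im| ≤ w.re → ‖w‖ ^ γ * κ ≤ (w ^ (γ : ℂ)).re := by
    intro w hw; rw [hκ]; exact cpow_re_lb hT hγ0 hγ w hw
  have hT0 : 0 < T := by linarith
  have key := Complex.norm_le_of_forall_mem_frontier_norm_le (U := D) (C := M)
    (f := fun z => F z * Complex.exp (-((N * A : ℝ) : ℂ) * z ^ (γ : ℂ))) ?_ ?_ ?_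
    (subset_closure (show z ∈ D from ⟨hz1, hz2⟩))
  · simp only [norm_mul, hne] at key
    rw [Real.exp_neg, ← div_eq_mul_inv, div_le_iff₀ (Real.exp_pos _)] at key
    refine key.trans ?_
    have hle : (z ^ (γ : ℂ)).re ≤ ‖z‖ ^ γ := by
      rw [Complex.cpow_ofReal_re]
      have := Real.cos_le_one (z.arg * γ)
      have h3 : 0 ≤ ‖z‖ ^ γ := by positivity
      nlinarith
    gcongr
  · exact (Metric.isBounded_ball (x := (0 : ℂ)) (r := R)).subset
      (fun w hw => by simpa using hw.1)
  · constructor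
    · intro w hw
      have hw2 : T * |w.im| < w.re := hw.2
      have hre : 0 < w.re := lt_of_le_of_lt (by positivity) hw2
      refine DifferentiableAt.differentiableWithinAt ?_
      refine (hF w).mul (DifferentiableAt.cexp (DifferentiableAt.const_mul ?_ _))
      exact DifferentiableAt.cpow differentiableAt_id (differentiableAt_const _) (Or.inl hre)
    · intro w hw
      have hw2 : T * |w.im| ≤ w.re := (hcl hw).2
      have hre : 0 ≤ w.re := le_trans (by positivity) hw2
      refine ContinuousAt.continuousWithinAt ?_
      refine hF.continuous.continuousAt.mul (ContinuousAt.cexp (continuousAt_const.mul ?_))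
      exact Complex.continuousAt_cpow_const_of_re_pos (Or.inl hre) (by simpa using hγ0)
  · intro w hw
    rw [hDo.frontier_eq] at hw
    obtain ⟨hw1, hw2⟩ := hcl hw.1
    simp only [Set.mem_ofPred_eq] at hw1 hw2
    simp only [norm_mul, hne]
    have hl := hlb w hw2
    rcases lt_or_eq_of_le hw1 with h | h
    · have h3 : T * |w.im| = w.re := by
        by_contra hcon
        exact hw.2 ⟨h, lt_of_le_of_ne hw2 hcon⟩
      have h4 : 0 ≤ (w ^ (γ : ℂ)).re := le_trans (by positivity) hl
      have h5 : Real.exp (-(N * A * (w ^ (γ : ℂ)).re)) ≤ 1 := by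
        rw [Real.exp_le_one_iff, neg_nonpos]; positivity
      calc _ ≤ M * 1 := mul_le_mul (h1 w hw1 h3) h5 (Real.exp_pos _).le hM.le
        _ = M := mul_one M
    · have h3 := h2 w h
      rw [h] at hl
      have h5 : (N : ℝ) * A0 ≤ N * A * (w ^ (γ : ℂ)).re := by
        calc (N : ℝ) * A0 = N * A * (R ^ γ * κ) := by rw [hA]; field_simp
          _ ≤ _ := by gcongr
      calc _ ≤ M * Real.exp (N * A0) * Real.exp (-(N * A0)) := by gcongr
        _ = M := by rw [mul_assoc, ← Real.exp_add]; simp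

/-- Growth of polynomials near the origin. -/
lemma growth {T R : ℝ} (hT : 1 < T) (hR : 0 < R) : ∃ γ A : ℝ, 2 < γ ∧ 0 ≤ A ∧
    ∀ (N : ℕ) (Q : Polynomial ℂ) (M : ℝ), 0 < M → Q.natDegree ≤ N →
    (∀ z ∈ KT T R, ‖Q.eval z‖ ≤ M) → ∀ z : ℂ, ‖z‖ < R →
    ‖Q.eval z‖ ≤ M * Real.exp (N * A * ‖z‖ ^ γ) := by
  have hT0 : 0 < T := by linarith
  set b := Real.arctan (1 / T) with hb
  have hb0 : 0 < b := Real.arctan_pos.2 (by positivity)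
  have hb1 : b < Real.pi / 4 := by
    rw [← Real.arctan_one, hb]
    apply Real.arctan_strictMono
    rw [div_lt_one hT0]; exact hT
  set γ := 1 + Real.pi / (4 * b) with hγ
  have hγ2 : 2 < γ := by
    have : 1 < Real.pi / (4 * b) := by rw [lt_div_iff₀ (by positivity)]; linarith
    linarith
  have hγb : b * γ < Real.pi / 2 := by
    have : b * γ = b + Real.pi / 4 := by rw [hγ]; field_simp
    linarith
  -- a small disc inside the lobe
  set a : ℂ := ((R / 2 : ℝ) : ℂ) with ha
  have ham : a ∈ interior (KP T R) := by
    apply KP_interior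
    · rw [ha, Complex.norm_real, Real.norm_of_nonneg (by positivity)]; linarith
    · simp [ha]; positivity
  obtain ⟨ρ', hρ', hρK⟩ := Metric.isOpen_iff.1 isOpen_interior a ham
  set ρ := min (ρ' / 2) (R / 4) with hρd
  have hρ : 0 < ρ := by positivity
  have hρ1 : ρ < ρ' := lt_of_le_of_lt (min_le_left _ _) (by linarith)
  have hρ2 : ρ ≤ R / 4 := min_le_right _ _
  have hna : ‖a‖ = R / 2 := by
    rw [ha, Complex.norm_real, Real.norm_of_nonneg (by positivity)]
  set A0 := Real.log (2 * R / ρ) with hA0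
  have hA00 : 0 ≤ A0 := Real.log_nonneg (by rw [le_div_iff₀ hρ]; linarith)
  have hκ0 : 0 < Real.cos (b * γ) := by
    apply Real.cos_pos_of_mem_Ioo
    have : 0 < b * γ := by positivity
    exact ⟨by linarith [Real.pi_pos], hγb⟩
  refine ⟨γ, A0 / (Real.cos (b * γ) * R ^ γ), hγ2, by positivity, ?_⟩
  intro N Q M hM hdeg hQ z hz
  have hcrude : ∀ z : ℂ, ‖z‖ = R → ‖Q.eval z‖ ≤ M * Real.exp (N * A0) := by
    intro z hz
    have h1 : ρ ≤ ‖z - a‖ := by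
      have := norm_sub_norm_le z a
      linarith
    have h2 : ‖z - a‖ ≤ 2 * R := by
      have := norm_sub_le z a
      linarith
    have := bw_disc Q N hdeg a hρ (M := M) (fun w hw => hQ w (KP_sub hT0 (interior_subset
      (hρK (by rw [mem_ball_iff_norm, hw]; exact hρ1))))) z h1
    refine this.trans ?_
    rw [mul_comm (N : ℝ), Real.exp_mul, hA0, Real.exp_log (by positivity), Real.rpow_natCast]
    gcongr
  have hgen : ∀ u : ℂ, (u = Complex.I ∨ u = -Complex.I) → ∀ w : ℂ, ‖w‖ < R →
      T * |w.im| < w.re → ‖Q.eval (u * w)‖ ≤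
        M * Real.exp (N * (A0 / (Real.cos (b * γ) * R ^ γ)) * ‖w‖ ^ γ) := by
    intro u hu
    have hun : ‖u‖ = 1 := by rcases hu with rfl | rfl <;> simp
    refine sector_growth hT hR (by linarith) hγb rfl hA00 rfl hM N (fun w => Q.eval (u * w))
      (Q.differentiable.comp (by fun_prop)) ?_ ?_
    · intro w hw1 hw2
      apply hQ
      refine ⟨by rw [norm_mul, hun, one_mul]; exact hw1, ?_⟩
      have hre : 0 ≤ w.re := by rw [← hw2]; positivity
      rcases hu with rfl | rfl
      · simp [abs_of_nonneg hre, hw2]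
      · simp [abs_of_nonneg hre, hw2]
    · intro w hw
      exact hcrude _ (by rw [norm_mul, hun, one_mul]; exact hw)
  by_cases hzK : z ∈ KT T R
  · refine (hQ z hzK).trans ?_
    have : 1 ≤ Real.exp (N * (A0 / (Real.cos (b * γ) * R ^ γ)) * ‖z‖ ^ γ) :=
      Real.one_le_exp (by positivity)
    nlinarith
  · have him : T * |z.re| < |z.im| := by
      by_contra hcon
      exact hzK ⟨hz.le, not_lt.1 hcon⟩
    rcases le_total 0 z.im with h | h
    · have := hgen Complex.I (Or.inl rfl) (-Complex.I * z) (by simpa using hz)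
        (by simpa [abs_of_nonneg h] using him)
      have e : Complex.I * (-Complex.I * z) = z := by
        rw [← mul_assoc]; simp
      rw [e] at this
      simpa using this
    · have := hgen (-Complex.I) (Or.inr rfl) (Complex.I * z) (by simpa using hz)
        (by simpa [abs_of_nonpos h] using him)
      have e : -Complex.I * (Complex.I * z) = z := by
        rw [← mul_assoc]; simp
      rw [e] at this
      simpa using this

/-- The main estimate: the polynomials are exponentially small near the origin. -/
lemma main_est {T R : ℝ} (hT : 1 < T) (hR : 0 < R) (Q : ℕ → Polynomial ℂ) {M : ℝ} (hM : 0 < M)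
    (hdeg : ∀ n : ℕ, 1 ≤ n → (Q n).natDegree ≤ 2 * n)
    (hQ : ∀ n : ℕ, 1 ≤ n → ∀ z ∈ KT T R, ‖(Q n).eval z‖ ≤ M) {a : ℂ}
    (ha : a ∈ interior (KP T R))
    (hs : ∃ c : ℝ, 0 < c ∧ ∀ᶠ z in nhds a, ∀ n : ℕ, 1 ≤ n →
      ‖(Q n).eval z‖ ≤ M * Real.exp (-(c * n))) :
    ∃ η c : ℝ, 0 < η ∧ 0 < c ∧ ∀ n : ℕ, 1 ≤ n → ∀ z : ℂ, ‖z‖ ≤ η →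
      ‖(Q n).eval z‖ ≤ M * Real.exp (-(c * n)) := by
  have hT0 : 0 < T := by linarith
  obtain ⟨γ, A, hγ, hA, hgrow⟩ := growth hT hR
  have hprop := propagate isOpen_interior ((KP_convex T R).interior.isPreconnected) Q hM
    (fun n hn z hz => hQ n hn z (KP_sub hT0 (interior_subset hz))) ha hs
  set r := R / 2 with hr
  have hr0 : 0 < r := by positivity
  have hLc : IsCompact ({z : ℂ | ‖z‖ = r} ∩ {z : ℂ | |z.im| ≤ z.re}) := by
    refine (isCompact_closedBall (0 : ℂ) r).of_isClosed_subset ?_ ?_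
    · exact (isClosed_eq (by fun_prop) (by fun_prop)).inter
        (isClosed_le (by fun_prop) (by fun_prop))
    · rintro z ⟨hz, -⟩
      simp only [Set.mem_ofPred_eq] at hz
      simp [hz]
  obtain ⟨c, hc, hcL⟩ := small_compact hLc Q hM (fun b hb => hprop b (by
    obtain ⟨h1, h2⟩ := hb
    simp only [Set.mem_ofPred_eq] at h1 h2
    apply KP_interior
    · rw [h1]; linarith
    · have hre : 0 < b.re := by
        rcases lt_or_eq_of_le ((abs_nonneg _).trans h2) with h | h
        · exact h
        · exfalso
          rw [← h] at h2
          have h3 : b.im = 0 := by simpa using h2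
          have : b = 0 := Complex.ext h.symm h3
          rw [this, norm_zero] at h1
          linarith
      nlinarith))
  set c0 := c / r ^ 2 with hc0
  have hc00 : 0 < c0 := by positivity
  have hinner : ∀ n : ℕ, 1 ≤ n → ∀ z : ℂ, ‖z‖ < r → |z.im| < z.re →
      ‖(Q n).eval z‖ ≤ M * Real.exp (-(c * n / r ^ 2 * (z.re ^ 2 - z.im ^ 2))) := by
    intro n hn
    refine inner_decay (Q n) hr0 hM ?_ ?_ (by positivity)
    · intro z h1 h2
      have hre := (abs_nonneg _).trans h2
      exact hQ n hn z (KP_sub hT0 ⟨by linarith, by nlinarith⟩)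
    · intro z h1 h2
      exact hcL z ⟨h1, h2⟩ n hn
  set θ := Real.log (30 / 11) / Real.log 30 with hθ
  have hl1 : 0 < Real.log (30 / 11) := Real.log_pos (by norm_num)
  have hl2 : 0 < Real.log 30 := Real.log_pos (by norm_num)
  have hl3 : Real.log (30 / 11) ≤ Real.log 30 := Real.log_le_log (by norm_num) (by norm_num)
  have hθ0 : 0 < θ := by positivity
  have hθ1 : θ ≤ 1 := by rw [hθ, div_le_one hl2]; exact hl3
  obtain ⟨δ, hδ0, hδR, hδ⟩ : ∃ δ : ℝ, 0 < δ ∧ 8 * δ < R ∧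
      32 * A * (4 * δ) ^ (γ - 2) ≤ 0.4 * θ * c0 := by
    have ht : Tendsto (fun δ : ℝ => 32 * A * (4 * δ) ^ (γ - 2)) (nhds 0) (nhds 0) := by
      have h1 : ContinuousAt (fun δ : ℝ => 32 * A * (4 * δ) ^ (γ - 2)) 0 := by
        refine continuousAt_const.mul ?_
        refine ContinuousAt.rpow_const (by fun_prop) (Or.inr (by linarith))
      have h2 : 32 * A * (4 * (0 : ℝ)) ^ (γ - 2) = 0 := by
        rw [mul_zero, Real.zero_rpow (by linarith), mul_zero]
      rw [ContinuousAt, h2] at h1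
      exact h1
    have he := ht.eventually (gt_mem_nhds (show (0 : ℝ) < 0.4 * θ * c0 by positivity))
    have he2 : ∀ᶠ δ : ℝ in nhds 0, 8 * δ < R := by
      have : Tendsto (fun δ : ℝ => 8 * δ) (nhds 0) (nhds (8 * 0)) :=
        Continuous.tendsto (by fun_prop) 0
      exact this.eventually (gt_mem_nhds (by simpa using hR))
    have he3 := (he.and he2).filter_mono (nhdsWithin_le_nhds (s := Set.Ioi (0 : ℝ)))
    obtain ⟨δ, ⟨h1, h2⟩, h3⟩ := (he3.and self_mem_nhdsWithin).exists
    exact ⟨δ, h3, h2, h1.le⟩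
  refine ⟨δ / 10, 0.4 * θ * c0 * δ ^ 2, by positivity, by positivity, ?_⟩
  intro n hn z hz
  have hδn : ‖(δ : ℂ)‖ = δ := by rw [Complex.norm_real, Real.norm_of_nonneg hδ0.le]
  have h3c := three_circles (Q n) (δ : ℂ) (ρ := δ / 10) (s := 11 / 10 * δ) (r := 3 * δ) (M := M)
    (x := c0 * n * (0.8 * δ ^ 2)) (y := (2 * n : ℕ) * A * (4 * δ) ^ γ) (θ := θ) (by positivity)
    (by linarith) (by linarith) (by linarith) hM
    (by
      have e1 : 3 * δ / (11 / 10 * δ) = 30 / 11 := by field_simp; norm_num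
      have e2 : 3 * δ / (δ / 10) = 30 := by field_simp; norm_num
      rw [e1, e2, hθ, div_mul_cancel₀ _ hl2.ne'])
    (by
      intro w hw
      have hwre := Complex.abs_re_le_norm (w - δ)
      have hwim := Complex.abs_im_le_norm (w - δ)
      simp only [Complex.sub_re, Complex.sub_im, Complex.ofReal_re, Complex.ofReal_im,
        sub_zero, hw] at hwre hwim
      rw [abs_le] at hwre
      have hwn : ‖w‖ < r := by
        have := norm_sub_norm_le w (δ : ℂ)
        rw [hw, hδn] at this
        linarith
      refine (hinner n hn w hwn (by linarith)).trans ?_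
      have hq : 0.8 * δ ^ 2 ≤ w.re ^ 2 - w.im ^ 2 := by
        have h1 : (0.9 * δ) ^ 2 ≤ w.re ^ 2 := by
          apply pow_le_pow_left₀ (by positivity); linarith
        have h2 : w.im ^ 2 ≤ (δ / 10) ^ 2 := by
          rw [← sq_abs]; exact pow_le_pow_left₀ (abs_nonneg _) hwim 2
        nlinarith
      have e : c * n / r ^ 2 = c0 * n := by rw [hc0]; ring
      rw [e]
      gcongr)
    (by
      intro w hw
      have hwn : ‖w‖ ≤ 4 * δ := by
        have := norm_sub_norm_le w (δ : ℂ)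
        rw [hw, hδn] at this
        linarith
      refine (hgrow (2 * n) (Q n) M hM (hdeg n hn) (hQ n hn) w (by linarith)).trans ?_
      gcongr) z (by
      have := norm_sub_le z (δ : ℂ)
      rw [hδn] at this
      linarith)
  refine h3c.trans ?_
  have hpow : (4 * δ) ^ γ = (4 * δ) ^ (γ - 2) * (16 * δ ^ 2) := by
    have : (4 * δ) ^ γ = (4 * δ) ^ (γ - 2) * (4 * δ) ^ (2 : ℝ) := by
      rw [← Real.rpow_add (by positivity)]; congr 1; ring
    rw [this, Real.rpow_two]; ring
  have hy : ((2 * n : ℕ) : ℝ) * A * (4 * δ) ^ γ ≤ 0.4 * θ * c0 * δ ^ 2 * n := by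
    rw [hpow]; push_cast
    calc (2 * n : ℝ) * A * ((4 * δ) ^ (γ - 2) * (16 * δ ^ 2))
        = (32 * A * (4 * δ) ^ (γ - 2)) * (δ ^ 2 * n) := by ring
      _ ≤ (0.4 * θ * c0) * (δ ^ 2 * n) := by gcongr
      _ = _ := by ring
  have hy0 : 0 ≤ ((2 * n : ℕ) : ℝ) * A * (4 * δ) ^ γ := by positivity
  have hy1 : (1 - θ) * (((2 * n : ℕ) : ℝ) * A * (4 * δ) ^ γ) ≤
      ((2 * n : ℕ) : ℝ) * A * (4 * δ) ^ γ := by nlinarith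
  gcongr
  nlinarith

lemma trig_aux {β φ : ℝ} (hβ0 : 0 < β) (hβ : β < Real.pi / 2) (hφ : |φ| ≤ β) :
    |Real.sin φ| ≤ Real.tan β * Real.cos φ ∧ 0 ≤ Real.cos φ := by
  rw [abs_le] at hφ
  have hcβ : 0 < Real.cos β := Real.cos_pos_of_mem_Ioo ⟨by linarith, hβ⟩
  have hcφ : 0 < Real.cos φ := Real.cos_pos_of_mem_Ioo ⟨by linarith [hφ.1], by linarith [hφ.2]⟩
  refine ⟨?_, hcφ.le⟩
  rw [Real.tan_eq_sin_div_cos, div_mul_eq_mul_div, le_div_iff₀ hcβ]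
  have h1 : 0 ≤ Real.sin (β - φ) := Real.sin_nonneg_of_nonneg_of_le_pi (by linarith) (by linarith)
  have h2 : 0 ≤ Real.sin (β + φ) := Real.sin_nonneg_of_nonneg_of_le_pi (by linarith) (by linarith)
  rw [Real.sin_sub] at h1
  rw [Real.sin_add] at h2
  rcases abs_cases (Real.sin φ) with h | h <;> rw [h.1] <;> nlinarith

lemma arg_aux {β : ℝ} (hβ0 : 0 < β) (hβ : β < Real.pi / 2) {z : ℂ}
    (hz : |z.im| ≤ Real.tan β * z.re) : |z.arg| ≤ β := by
  rcases eq_or_ne z 0 with rfl | h0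
  · simpa using hβ0.le
  have ht : 0 < Real.tan β := Real.tan_pos_of_pos_of_lt_pi_div_two hβ0 hβ
  have hre : 0 < z.re := by
    rcases lt_or_eq_of_le (nonneg_of_mul_nonneg_right ((abs_nonneg _).trans hz) ht) with h | h
    · exact h
    · exfalso; apply h0
      rw [← h] at hz
      exact Complex.ext h.symm (by simpa using hz)
  have hlt := Complex.abs_arg_lt_pi_div_two_iff.2 (Or.inl hre)
  rw [abs_lt] at hlt
  have e : z.arg = Real.arctan (z.im / z.re) := by
    rw [← Complex.tan_arg, Real.arctan_tan hlt.1 hlt.2]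
  have e2 : β = Real.arctan (Real.tan β) := (Real.arctan_tan (by linarith) hβ).symm
  have hb : |z.im / z.re| ≤ Real.tan β := by
    rw [abs_div, abs_of_pos hre, div_le_iff₀ hre]; exact hz
  rw [abs_le] at hb ⊢
  rw [e, e2]
  constructor
  · rw [← Real.arctan_neg]; exact Real.arctan_mono hb.1
  · exact Real.arctan_mono hb.2

lemma bowtie_eq {α R : ℝ} (h0 : 0 < α) (h1 : α < 1) :
    bowtie α R = KT (Real.tan (α * Real.pi / 2)) R := by
  have hpi := Real.pi_pos
  have hβ0 : 0 < α * Real.pi / 2 := by positivity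
  have hβ : α * Real.pi / 2 < Real.pi / 2 := by nlinarith
  ext z
  constructor
  · rintro ⟨r, θ, hr0, hr, hθ, rfl⟩
    refine ⟨?_, ?_⟩
    · rw [norm_mul, Complex.norm_exp_ofReal_mul_I, mul_one, Complex.norm_real,
        Real.norm_of_nonneg hr0]
      exact hr
    · rw [Complex.im_ofReal_mul, Complex.re_ofReal_mul, Complex.exp_ofReal_mul_I_re,
        Complex.exp_ofReal_mul_I_im, abs_mul, abs_mul, abs_of_nonneg hr0]
      have key : |Real.sin θ| ≤ Real.tan (α * Real.pi / 2) * |Real.cos θ| := by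
        rcases hθ with h | h
        · obtain ⟨a, b⟩ := trig_aux hβ0 hβ h
          rwa [abs_of_nonneg b]
        · obtain ⟨a, b⟩ := trig_aux hβ0 hβ h
          rw [Real.sin_sub_pi, Real.cos_sub_pi, abs_neg] at a
          rw [Real.cos_sub_pi] at b
          rwa [abs_of_nonpos (show Real.cos θ ≤ 0 by linarith)]
      nlinarith
  · intro hz
    rcases KT_cases hz with h | h
    · exact ⟨‖z‖, z.arg, norm_nonneg _, h.1, Or.inl (arg_aux hβ0 hβ h.2),
        (Complex.norm_mul_exp_arg_mul_I z).symm⟩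
    · refine ⟨‖z‖, (-z).arg + Real.pi, norm_nonneg _, hz.1, Or.inr ?_, ?_⟩
      · rw [add_sub_cancel_right]; exact arg_aux hβ0 hβ h.2
      · have := Complex.norm_mul_exp_arg_mul_I (-z)
        rw [norm_neg] at this
        push_cast
        rw [add_mul, Complex.exp_add, Complex.exp_pi_mul_I, mul_neg_one, mul_neg, this, neg_neg]

lemma bestE_le {f : ℂ → ℂ} {K : Set ℂ} {n : ℕ} (p : Polynomial ℂ) (hp : p.natDegree ≤ n) {ε : ℝ}
    (hε : 0 ≤ ε) (h : ∀ z ∈ K, ‖f z - p.eval z‖ ≤ ε) : bestE f K n ≤ ε := by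
  have h1 : bestE f K n ≤ supErr f K p := by
    refine ciInf_le (f := fun P : {P : Polynomial ℂ // P.natDegree ≤ n} => supErr f K P.1) ?_ ⟨p, hp⟩
    refine ⟨0, ?_⟩
    rintro _ ⟨P, rfl⟩
    exact Real.iSup_nonneg (fun z => norm_nonneg _)
  refine h1.trans ?_
  exact Real.iSup_le (fun z => h z z.2) hε

lemma interior_lobe {T R : ℝ} {a : ℂ} (ha : a ∈ interior (KT T R)) :
    a ∈ interior (KP T R) ∨ -a ∈ interior (KP T R) := by
  rcases lt_trichotomy a.re 0 with h | h | h
  · right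
    refine interior_maximal (t := (Neg.neg ⁻¹' interior (KT T R)) ∩ {z : ℂ | 0 < z.re}) ?_
      ((isOpen_interior.preimage continuous_neg).inter (isOpen_lt (by fun_prop) (by fun_prop)))
      ⟨by simpa using ha, by simpa using h⟩
    rintro w ⟨hw1, hw2⟩
    have hw1 := interior_subset (show -w ∈ interior (KT T R) from hw1)
    have hw2 : 0 < w.re := hw2
    exact ⟨by simpa using hw1.1, by simpa [abs_of_pos hw2] using hw1.2⟩
  · exfalso
    obtain ⟨ε, hε, hb⟩ := Metric.isOpen_iff.1 isOpen_interior a ha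
    have h1 := (interior_subset ha).2
    have h2 := (interior_subset (hb (show a + ((ε / 2 : ℝ) : ℂ) * Complex.I ∈ Metric.ball a ε by
      rw [mem_ball_iff_norm, add_sub_cancel_left, norm_mul, Complex.norm_I, Complex.norm_real,
        Real.norm_of_nonneg (by positivity)]
      linarith))).2
    rw [h] at h1
    simp only [Complex.add_re, Complex.add_im, Complex.re_ofReal_mul, Complex.im_ofReal_mul, h,
      Complex.I_re, Complex.I_im] at h2
    have h3 : a.im = 0 := by simpa using h1
    rw [h3] at h2
    have h4 : ε / 2 = 0 := by simpa using h2
    linarith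
  · left
    refine interior_maximal (t := interior (KT T R) ∩ {z : ℂ | 0 < z.re}) ?_
      (isOpen_interior.inter (isOpen_lt (by fun_prop) (by fun_prop)))
      ⟨ha, by simpa using h⟩
    rintro w ⟨hw1, hw2⟩
    have hw1 := interior_subset hw1
    have hw2 : 0 < w.re := hw2
    exact ⟨hw1.1, by simpa [abs_of_pos hw2] using hw1.2⟩

lemma main_est' {T R : ℝ} (hT : 1 < T) (hR : 0 < R) (Q : ℕ → Polynomial ℂ) {M : ℝ} (hM : 0 < M)
    (hdeg : ∀ n : ℕ, 1 ≤ n → (Q n).natDegree ≤ 2 * n)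
    (hQ : ∀ n : ℕ, 1 ≤ n → ∀ z ∈ KT T R, ‖(Q n).eval z‖ ≤ M) {V : Set ℂ}
    (hV : IsOpen V) (hne : V.Nonempty) (hVK : V ⊆ interior (KT T R)) {c : ℝ} (hc : 0 < c)
    (hs : ∀ n : ℕ, 1 ≤ n → ∀ z ∈ V, ‖(Q n).eval z‖ ≤ M * Real.exp (-(c * n))) :
    ∃ η c : ℝ, 0 < η ∧ 0 < c ∧ ∀ n : ℕ, 1 ≤ n → ∀ z : ℂ, ‖z‖ ≤ η →
      ‖(Q n).eval z‖ ≤ M * Real.exp (-(c * n)) := by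
  obtain ⟨a, haV⟩ := hne
  rcases interior_lobe (hVK haV) with h | h
  · refine main_est hT hR Q hM hdeg hQ h ⟨c, hc, ?_⟩
    filter_upwards [hV.mem_nhds haV] with z hz n hn
    exact hs n hn z hz
  · obtain ⟨η, c', hη, hc', hh⟩ := main_est hT hR (fun n => (Q n).comp (-Polynomial.X)) hM
      (fun n hn => by
        rw [Polynomial.natDegree_comp, Polynomial.natDegree_neg, Polynomial.natDegree_X, mul_one]
        exact hdeg n hn)
      (fun n hn z hz => by
        simpa using hQ n hn (-z) (KT_neg hz)) h ⟨c, hc, by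
        have : Neg.neg ⁻¹' V ∈ nhds (-a) :=
          (hV.preimage continuous_neg).mem_nhds (by simpa using haV)
        filter_upwards [this] with z hz n hn
        simpa using hs n hn (-z) hz⟩
    refine ⟨η, c', hη, hc', fun n hn z hz => ?_⟩
    simpa using hh n hn (-z) (by simpa using hz)

theorem stmt_3 (α R : ℝ) (hα1 : 1 / 2 < α) (hα2 : α < 1) (hR : 0 < R)
    (f : ℂ → ℂ) (hf_cont : ContinuousOn f (bowtie α R))
    (hf_an : DifferentiableOn ℂ f (interior (bowtie α R)))
    (hf_not : ¬ ∃ (ε : ℝ) (g : ℂ → ℂ), 0 < ε ∧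
      DifferentiableOn ℂ g (Metric.ball (0 : ℂ) ε) ∧
      ∀ z ∈ bowtie α R, ‖z‖ < ε → g z = f z) :
    ¬ ∃ (V : Set ℂ) (C c : ℝ) (P : ℕ → Polynomial ℂ),
      V.Nonempty ∧ IsOpen V ∧ closure V ⊆ interior (bowtie α R) ∧
      1 ≤ C ∧ 0 < c ∧
      (∀ n : ℕ, 1 ≤ n → (P n).natDegree ≤ n) ∧
      (∀ n : ℕ, 1 ≤ n → ∀ z ∈ bowtie α R,
        ‖f z - (P n).eval z‖ ≤ C * bestE f (bowtie α R) n) ∧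
      (∀ n : ℕ, 1 ≤ n → ∀ z ∈ closure V,
        ‖f z - (P n).eval z‖ ≤
          C * bestE f (bowtie α R) n * Real.exp (-c * n)) := by
  rintro ⟨V, C, c, P, hVne, hVo, hVK, hC, hc, hdeg, hPK, hPV⟩
  apply hf_not
  have hpi := Real.pi_pos
  set T := Real.tan (α * Real.pi / 2) with hTdef
  have hK : bowtie α R = KT T R := bowtie_eq (by linarith) hα2
  have hT : 1 < T := by
    rw [hTdef, ← Real.tan_pi_div_four]
    apply Real.tan_lt_tan_of_lt_of_lt_pi_div_two <;> nlinarith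
  rw [hK] at hf_cont hf_an hVK hPK hPV ⊢
  obtain ⟨S, hS⟩ := (KT_compact T R).exists_bound_of_continuousOn hf_cont
  have hEb : ∀ n, bestE f (KT T R) n ≤ |S| := fun n =>
    bestE_le 0 (by simp) (abs_nonneg _)
      (fun z hz => by simpa using (hS z hz).trans (le_abs_self S))
  have hCE : ∀ n, C * bestE f (KT T R) n ≤ C * |S| := fun n => by
    have := hEb n
    gcongr
  set M := 2 * C * (|S| + 1) with hM
  have hM0 : 0 < M := by positivity
  have hCM : C * |S| + C * |S| ≤ M := by rw [hM]; nlinarith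
  set Q : ℕ → Polynomial ℂ := fun n => P (n + 1) - P n with hQdef
  have hQe : ∀ n z, (Q n).eval z = (f z - (P n).eval z) - (f z - (P (n + 1)).eval z) := by
    intro n z; simp [hQdef]
  obtain ⟨η, c', hη, hc', hsm⟩ := main_est' hT hR Q hM0 (V := V) (c := c)
    (fun n hn => by
      refine (Polynomial.natDegree_sub_le _ _).trans (max_le ?_ ?_)
      · exact (hdeg (n + 1) (by omega)).trans (by omega)
      · exact (hdeg n hn).trans (by omega))
    (fun n hn z hz => by
      rw [hQe]
      have h1 := norm_sub_le (f z - (P n).eval z) (f z - (P (n + 1)).eval z)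
      have h2 := hPK n hn z hz
      have h3 := hPK (n + 1) (by omega) z hz
      have h4 := hCE n
      have h5 := hCE (n + 1)
      linarith)
    hVo hVne (subset_closure.trans hVK) hc
    (fun n hn z hz => by
      rw [hQe]
      have h1 := norm_sub_le (f z - (P n).eval z) (f z - (P (n + 1)).eval z)
      have h2 := hPV n hn z (subset_closure hz)
      have h3 := hPV (n + 1) (by omega) z (subset_closure hz)
      have h4 := hCE n
      have h5 := hCE (n + 1)
      have e1 : Real.exp (-c * (n + 1 : ℕ)) ≤ Real.exp (-(c * n)) := by
        apply Real.exp_le_exp.2; push_cast; nlinarith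
      have e2 : Real.exp (-c * n) = Real.exp (-(c * n)) := by rw [neg_mul]
      rw [e2] at h2
      have h6 : C * bestE f (KT T R) n * Real.exp (-(c * n)) ≤ C * |S| * Real.exp (-(c * n)) := by
        gcongr
      have h7 : C * bestE f (KT T R) (n + 1) * Real.exp (-c * (n + 1 : ℕ)) ≤
          C * |S| * Real.exp (-(c * n)) := by
        calc _ ≤ C * |S| * Real.exp (-c * (n + 1 : ℕ)) := by gcongr
          _ ≤ _ := by gcongr
      have h8 : (C * |S| + C * |S|) * Real.exp (-(c * n)) ≤ M * Real.exp (-(c * n)) := by gcongr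
      linarith)
  have hconv : ∀ z ∈ KT T R, Tendsto (fun N : ℕ => (P (N + 1)).eval z) atTop (nhds (f z)) := by
    intro z hz
    rw [Metric.tendsto_atTop]
    intro ε hε
    obtain ⟨p, hp⟩ := KT_appr (by linarith) hR hf_cont hf_an (ε / (2 * C)) (by positivity)
    refine ⟨p.natDegree, fun n hn => ?_⟩
    rw [dist_comm, dist_eq_norm]
    have h1 := hPK (n + 1) (by omega) z hz
    have h2 : bestE f (KT T R) (n + 1) ≤ ε / (2 * C) :=
      bestE_le p (by omega) (by positivity) hp
    calc _ ≤ C * bestE f (KT T R) (n + 1) := h1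
      _ ≤ C * (ε / (2 * C)) := by gcongr
      _ = ε / 2 := by field_simp
      _ < ε := by linarith
  have hsum : Summable (fun n : ℕ => M * Real.exp (-(c' * (n + 1 : ℕ)))) := by
    have h1 : Summable (fun n : ℕ => Real.exp (-c') ^ n) :=
      summable_geometric_of_lt_one (Real.exp_pos _).le (by
        rw [Real.exp_lt_one_iff]; linarith)
    have h2 := ((summable_nat_add_iff 1).2 h1).mul_left M
    refine h2.congr (fun n => ?_)
    rw [← Real.exp_nat_mul]
    congr 2; ring
  have hbd : ∀ (n : ℕ) (w : ℂ), w ∈ Metric.ball (0 : ℂ) η →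
      ‖(Q (n + 1)).eval w‖ ≤ M * Real.exp (-(c' * (n + 1 : ℕ))) := by
    intro n w hw
    exact hsm (n + 1) (by omega) w (by
      rw [mem_ball_zero_iff] at hw; exact hw.le)
  refine ⟨η, fun z => (P 1).eval z + ∑' n : ℕ, (Q (n + 1)).eval z, hη, ?_, ?_⟩
  · refine (P 1).differentiable.differentiableOn.add ?_
    exact Complex.differentiableOn_tsum_of_summable_norm hsum
      (fun n => (Q (n + 1)).differentiable.differentiableOn) Metric.isOpen_ball hbd
  · intro z hz hzη
    have hs : Summable (fun n : ℕ => (Q (n + 1)).eval z) :=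
      Summable.of_norm_bounded hsum (fun n => hbd n z (by simpa using hzη))
    have ht := hs.hasSum.tendsto_sum_nat
    have hpart : ∀ N : ℕ, ∑ n ∈ Finset.range N, (Q (n + 1)).eval z =
        (P (N + 1)).eval z - (P 1).eval z := by
      intro N
      have := Finset.sum_range_sub (fun n => (P (n + 1)).eval z) N
      simpa [hQdef] using this
    simp only [hpart] at ht
    have ht2 := (hconv z hz).sub_const ((P 1).eval z)
    have := tendsto_nhds_unique ht ht2
    simp only [this]
    ring
end

section
/- Let Θ ∈ (0, π/2) and set A_Θ := {z ∈ ℂ : 0 < |z| < 1, |arg z| < Θ}. Let A_π := {z ∈ ℂ : |z| < 1} \ {x ∈ ℝ : −1 < x ≤ 0} be the open unit disc with the slit (−1, 0] removed. Let f : ℂ → ℂ be analytic and bounded on A_π, and suppose there exist δ > 0 and M₁ > 0 such that |f(z)| ≤ M₁·|z|^δ for all z ∈ A_π. Fix ρ ∈ (0, 1) and let M := ρ·A_Θ = {ρ z : z ∈ A_Θ}. Then there exist constants C > 0, C₀ > 0 and rational functions r_n = p_n/q_n (with p_n, q_n polynomials of degree at most n and q_n nonvanishing on the closure of M) such that sup_{z∈M}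 |f(z) − r_n(z)| ≤ C₀·e^{−C√n} for all n ≥ 1, and for every compact set E contained in M there exists c > 0 (depending on E) such that e^{c n} · sup_{z∈E} |f(z) − r_n(z)| → 0 as n → ∞. -/
open Filter

/-- The open circular sector `A_Θ = {z : 0 < |z| < 1, |arg z| < Θ}`. -/
noncomputable def sectorA (Θ : ℝ) : Set ℂ :=
  {z : ℂ | 0 < ‖z‖ ∧ ‖z‖ < 1 ∧ |Complex.arg z| < Θ}

/-- The slit disc `A_π`: the open unit disc with the slit `(-1, 0]` removed. -/
def slitDisc : Set ℂ :=
  {z : ℂ | ‖z‖ < 1} \ {z : ℂ | z.im = 0 ∧ -1 < z.re ∧ z.re ≤ 0}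


open MeasureTheory Polynomial in
lemma key_blaschke (μ : Measure ℝ) (ζ : ℝ → ℂ) (hζ : Continuous ζ) (hre : ∀ x, (ζ x).re = 0)
    (l : List ℝ) : (∀ a ∈ l, 0 < a) → ∀ h : ℝ → ℂ, Integrable h μ →
    ∃ p : ℂ[X], p.natDegree ≤ l.length ∧ ∀ z : ℂ, 0 < z.re →
      ‖(∫ x, h x / (ζ x - z) ∂μ) - p.eval z / ((l.map fun a : ℝ => X + C (a : ℂ)).prod).eval z‖ ≤
        (l.map (fun a : ℝ => ‖(z - a) / (z + a)‖)).prod * ∫ x, ‖h x‖ / ‖ζ x - z‖ ∂μ := by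
  induction l with
  | nil =>
    intro _ h hh
    refine ⟨0, by simp, fun z hz => ?_⟩
    simp only [List.map_nil, List.prod_nil, eval_zero, eval_one, zero_div, sub_zero, one_mul]
    refine (norm_integral_le_integral_norm _).trans (le_of_eq ?_)
    simp
  | cons a l ih =>
    intro hl h hh
    have ha : 0 < a := hl a (by simp)
    have hl' : ∀ a ∈ l, 0 < a := fun b hb => hl b (by simp [hb])
    have hne : ∀ z : ℂ, 0 < z.re → ∀ x, ζ x - z ≠ 0 := by
      intro z hz x h0
      have := congrArg Complex.re h0
      simp [hre] at this
      linarith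
    have hna : ∀ x, ζ x - a ≠ 0 := hne a (by simpa using ha)
    have hlow : ∀ z : ℂ, 0 < z.re → ∀ x, z.re ≤ ‖ζ x - z‖ := by
      intro z hz x
      have := Complex.abs_re_le_norm (ζ x - z)
      simp [hre] at this
      exact (le_abs_self _).trans this
    have hint : ∀ h : ℝ → ℂ, Integrable h μ → ∀ z : ℂ, 0 < z.re →
        Integrable (fun x => h x / (ζ x - z)) μ := by
      intro h hh z hz
      have hc : Continuous (fun x => (ζ x - z)⁻¹) :=
        (hζ.sub continuous_const).inv₀ (hne z hz)
      have := hh.mul_bdd (c := (z.re)⁻¹) hc.aestronglyMeasurable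
        (Eventually.of_forall fun x => by
          rw [norm_inv]
          exact inv_anti₀ hz (hlow z hz x))
      simpa [div_eq_mul_inv] using this
    have hunit : ∀ x, ‖(ζ x + a) / (ζ x - a)‖ = 1 := by
      intro x
      have h1 : ‖ζ x + a‖ = ‖ζ x - a‖ := by
        rw [Complex.norm_def, Complex.norm_def]
        congr 1
        simp [Complex.normSq_apply, hre]
      rw [norm_div, h1, div_self]
      exact norm_ne_zero_iff.2 (hna x)
    have hh' : Integrable (fun x => h x * ((ζ x + a) / (ζ x - a))) μ := by
      refine hh.mul_bdd (c := 1) ?_ (Eventually.of_forall fun x => (hunit x).le)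
      exact ((hζ.add continuous_const).div (hζ.sub continuous_const) hna).aestronglyMeasurable
    obtain ⟨p, hp, hpz⟩ := ih hl' _ hh'
    set c : ℂ := ∫ x, h x / (ζ x - a) ∂μ with hc
    set q : ℂ[X] := (l.map fun a : ℝ => X + C (a : ℂ)).prod with hq
    have hqdeg : q.natDegree ≤ l.length := by
      have := natDegree_list_prod_le (l.map fun a : ℝ => X + C (a : ℂ))
      refine this.trans ?_
      refine (List.sum_le_card_nsmul _ 1 ?_).trans ?_
      · simp
      · simp
    refine ⟨C (2 * a * c) * q + (X - C (a : ℂ)) * p, ?_, ?_⟩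
    · refine (natDegree_add_le _ _).trans (max_le ?_ ?_)
      · refine (natDegree_C_mul_le _ _).trans (hqdeg.trans (by simp))
      · refine natDegree_mul_le.trans ?_
        rw [natDegree_X_sub_C]
        simp; omega
    · intro z hz
      have hza : z + a ≠ 0 := by
        intro h0
        have := congrArg Complex.re h0
        simp at this
        linarith
      have hqz : q.eval z ≠ 0 := by
        rw [hq, eval_list_prod]
        apply List.prod_ne_zero
        simp only [List.map_map, List.mem_map, Function.comp, not_exists, not_and]
        intro b hb h0
        have := congrArg Complex.re h0
        have hb' := hl' b hb
        simp at this
        linarith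
      have hsplit : ∫ x, h x / (ζ x - z) ∂μ = 2 * a / (z + a) * c +
          (z - a) / (z + a) * ∫ x, (h x * ((ζ x + a) / (ζ x - a))) / (ζ x - z) ∂μ := by
        rw [hc, ← integral_const_mul, ← integral_const_mul, ← integral_add]
        · refine integral_congr_ae (Eventually.of_forall fun x => ?_)
          have h1 := hne z hz x
          have h2 := hna x
          simp only
          field_simp
          ring
        · exact (hint h hh a (by simpa using ha)).const_mul _
        · exact (hint _ hh' z hz).const_mul _
      have hIH := hpz z hz
      have hnorm : ∫ x, ‖h x * ((ζ x + a) / (ζ x - a))‖ / ‖ζ x - z‖ ∂μ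
          = ∫ x, ‖h x‖ / ‖ζ x - z‖ ∂μ := by
        simp only [norm_mul, hunit, mul_one]
      rw [hnorm] at hIH
      simp only [List.map_cons, List.prod_cons]
      rw [← hq, hsplit]
      have : 2 * a / (z + a) * c +
          (z - a) / (z + a) * (∫ x, (h x * ((ζ x + a) / (ζ x - a))) / (ζ x - z) ∂μ) -
          eval z (C (2 * a * c) * q + (X - C (a : ℂ)) * p) / eval z ((X + C (a : ℂ)) * q) =
          (z - a) / (z + a) * ((∫ x, (h x * ((ζ x + a) / (ζ x - a))) / (ζ x - z) ∂μ)
            - eval z p / eval z q) := by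
        simp only [eval_add, eval_mul, eval_sub, eval_C, eval_X]
        field_simp
        ring
      rw [this, norm_mul, mul_assoc]
      gcongr

open MeasureTheory Polynomial in
lemma key_taylor (μ : Measure ℝ) (ζ : ℝ → ℂ) (hζ : Continuous ζ) (R ρ : ℝ) (hρ : 0 < ρ)
    (hρR : ρ < R) (hre : ∀ x, ‖ζ x‖ = R) (N : ℕ) : ∀ h : ℝ → ℂ, Integrable h μ →
    ∃ p : ℂ[X], p.natDegree ≤ N ∧ ∀ z : ℂ, ‖z‖ ≤ ρ →
      ‖(∫ x, h x * ζ x / (ζ x - z) ∂μ) - p.eval z‖ ≤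
        (ρ / R) ^ N * ((∫ x, ‖h x‖ ∂μ) * (R / (R - ρ))) := by
  have hR : 0 < R := hρ.trans hρR
  have hlow : ∀ z : ℂ, ‖z‖ ≤ ρ → ∀ x, R - ρ ≤ ‖ζ x - z‖ := by
    intro z hz x
    have := norm_sub_norm_le (ζ x) z
    rw [hre] at this
    linarith
  have hne : ∀ z : ℂ, ‖z‖ ≤ ρ → ∀ x, ζ x - z ≠ 0 := by
    intro z hz x
    have := hlow z hz x
    exact norm_pos_iff.1 (by linarith)
  have hz0 : ∀ x, ζ x ≠ 0 := fun x => norm_pos_iff.1 (by rw [hre]; exact hR)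
  have hbd : ∀ z : ℂ, ‖z‖ ≤ ρ → ∀ x, ‖ζ x / (ζ x - z)‖ ≤ R / (R - ρ) := by
    intro z hz x
    rw [norm_div, hre]
    have := hlow z hz x
    gcongr
  have hint : ∀ h : ℝ → ℂ, Integrable h μ → ∀ z : ℂ, ‖z‖ ≤ ρ →
        Integrable (fun x => h x * ζ x / (ζ x - z)) μ := by
    intro h hh z hz
    have hc : Continuous (fun x => ζ x / (ζ x - z)) :=
        hζ.div (hζ.sub continuous_const) (hne z hz)
    have := hh.mul_bdd (c := R / (R - ρ)) hc.aestronglyMeasurable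
        (Eventually.of_forall (hbd z hz))
    simpa [mul_div_assoc] using this
  induction N with
  | zero =>
    intro h hh
    refine ⟨0, by simp, fun z hz => ?_⟩
    simp only [eval_zero, sub_zero, pow_zero, one_mul]
    refine (norm_integral_le_integral_norm _).trans ?_
    rw [← integral_mul_const]
    refine integral_mono (hint h hh z hz).norm (hh.norm.mul_const _) fun x => ?_
    simp only [mul_div_assoc]
    rw [norm_mul]
    gcongr
    exact hbd z hz x
  | succ N ih =>
    intro h hh
    have hh' : Integrable (fun x => h x * (ζ x)⁻¹) μ := by
      refine hh.mul_bdd (c := R⁻¹) (hζ.inv₀ hz0).aestronglyMeasurable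
        (Eventually.of_forall fun x => ?_)
      rw [norm_inv, hre]
    obtain ⟨p, hp, hpz⟩ := ih _ hh'
    refine ⟨C (∫ x, h x ∂μ) + X * p, ?_, fun z hz => ?_⟩
    · refine (natDegree_add_le _ _).trans (max_le ?_ ?_)
      · simp
      · refine natDegree_mul_le.trans ?_
        have := natDegree_X_le (R := ℂ)
        omega
    · have hsplit : ∫ x, h x * ζ x / (ζ x - z) ∂μ = (∫ x, h x ∂μ) +
          z * ∫ x, (h x * (ζ x)⁻¹) * ζ x / (ζ x - z) ∂μ := by
        rw [← integral_const_mul, ← integral_add hh ((hint _ hh' z hz).const_mul z)]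
        refine integral_congr_ae (Eventually.of_forall fun x => ?_)
        have h1 := hne z hz x
        have h2 := hz0 x
        simp only
        field_simp
        ring
      have hI := hpz z hz
      have hnorm : ∫ x, ‖h x * (ζ x)⁻¹‖ ∂μ = (∫ x, ‖h x‖ ∂μ) * R⁻¹ := by
        rw [← integral_mul_const]
        simp only [norm_mul, norm_inv, hre]
      rw [hnorm] at hI
      rw [hsplit]
      simp only [eval_add, eval_mul, eval_C, eval_X]
      rw [add_sub_add_left_eq_sub, ← mul_sub, norm_mul]
      calc ‖z‖ * _ ≤ ρ * ((ρ / R) ^ N * ((∫ x, ‖h x‖ ∂μ) * R⁻¹ * (R / (R - ρ)))) := by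
            gcongr
        _ = _ := by
            rw [pow_succ]
            field_simp

lemma seg_log (γ : ℝ → ℂ) (e : ℂ) (a b : ℝ) (hγ : ∀ t, HasDerivAt γ e t)
    (hs : ∀ t ∈ Set.uIcc a b, γ t ∈ Complex.slitPlane) :
    e * (∫ t in a..b, 1 / γ t) = Complex.log (γ b) - Complex.log (γ a) := by
  rw [← intervalIntegral.integral_const_mul]
  have hc : Continuous γ := continuous_iff_continuousAt.2 fun t => (hγ t).continuousAt
  have h1 := intervalIntegral.integral_eq_sub_of_hasDerivAt
    (f := fun t => Complex.log (γ t)) (f' := fun t => e / γ t) (a := a) (b := b)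
    (fun t ht => (hγ t).clog_real (hs t ht)) ?_
  · rw [← h1]
    congr 1
    ext t
    ring
  · apply ContinuousOn.intervalIntegrable
    exact continuousOn_const.div hc.continuousOn
      fun t ht => Complex.slitPlane_ne_zero (hs t ht)

lemma rect_one_div (a b c d : ℝ) (w : ℂ) (ha : a < w.re) (hb : w.re < b) (hc : c < w.im)
    (hd : w.im < d) :
    (∫ x : ℝ in a..b, 1 / ((x : ℂ) + c * Complex.I - w)) -
      (∫ x : ℝ in a..b, 1 / ((x : ℂ) + d * Complex.I - w)) +
      Complex.I * (∫ y : ℝ in c..d, 1 / ((b : ℂ) + y * Complex.I - w)) -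
      Complex.I * (∫ y : ℝ in c..d, 1 / ((a : ℂ) + y * Complex.I - w)) =
      2 * Real.pi * Complex.I := by
  have hx : ∀ (s : ℂ) (t : ℝ), HasDerivAt (fun t : ℝ => (t : ℂ) + s * Complex.I - w) 1 t := by
    intro s t
    have := ((hasDerivAt_id t).ofReal_comp.add_const (s * Complex.I)).sub_const w
    simpa using this
  have hy : ∀ (s : ℂ) (t : ℝ),
      HasDerivAt (fun t : ℝ => s + (t : ℂ) * Complex.I - w) Complex.I t := by
    intro s t
    have := ((((hasDerivAt_id t).ofReal_comp).mul_const Complex.I).const_add s).sub_const w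
    simpa using this
  have h1 := seg_log _ _ a b (hx c) (fun t ht => by
    right; simp; intro h; linarith)
  have h2 := seg_log _ _ a b (hx d) (fun t ht => by
    right; simp; intro h; linarith)
  have h3 := seg_log _ _ c d (hy b) (fun t ht => by
    left; simp; linarith)
  have h4 := seg_log (fun t : ℝ => -((a : ℂ) + (t : ℂ) * Complex.I - w)) (-Complex.I) c d
    (fun t => (hy a t).neg) (fun t ht => by
    left; simp; linarith)
  have h4' : (-Complex.I) * (∫ t : ℝ in c..d, 1 / (-((a : ℂ) + (t : ℂ) * Complex.I - w))) =
      Complex.I * (∫ y : ℝ in c..d, 1 / ((a : ℂ) + y * Complex.I - w)) := by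
    rw [← intervalIntegral.integral_const_mul, ← intervalIntegral.integral_const_mul]
    congr 1
    ext t
    rw [one_div_neg_eq_neg_one_div]
    ring
  rw [h4'] at h4
  rw [one_mul] at h1 h2
  rw [h1, h2, h3, h4]
  have e1 : Complex.log (-((a : ℂ) + d * Complex.I - w)) =
      Complex.log ((a : ℂ) + d * Complex.I - w) - Real.pi * Complex.I := by
    rw [Complex.log, Complex.log, norm_neg, Complex.arg_neg_eq_arg_sub_pi_of_im_pos]
    · push_cast; ring
    · simp; linarith
  have e2 : Complex.log (-((a : ℂ) + c * Complex.I - w)) =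
      Complex.log ((a : ℂ) + c * Complex.I - w) + Real.pi * Complex.I := by
    rw [Complex.log, Complex.log, norm_neg, Complex.arg_neg_eq_arg_add_pi_of_im_neg]
    · push_cast; ring
    · simp; linarith
  rw [e1, e2]
  ring

lemma rect_cauchy {U : Set ℂ} (hU : IsOpen U) (q : ℂ → ℂ) (hq : DifferentiableOn ℂ q U)
    (a b c d : ℝ) (w : ℂ) (ha : a < w.re) (hb : w.re < b) (hc : c < w.im) (hd : w.im < d)
    (hsub : ∀ v : ℂ, a ≤ v.re → v.re ≤ b → c ≤ v.im → v.im ≤ d → v ∈ U) :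
    (∫ x : ℝ in a..b, q ((x : ℂ) + c * Complex.I) / ((x : ℂ) + c * Complex.I - w)) -
      (∫ x : ℝ in a..b, q ((x : ℂ) + d * Complex.I) / ((x : ℂ) + d * Complex.I - w)) +
      Complex.I * (∫ y : ℝ in c..d, q ((b : ℂ) + y * Complex.I) / ((b : ℂ) + y * Complex.I - w)) -
      Complex.I * (∫ y : ℝ in c..d, q ((a : ℂ) + y * Complex.I) / ((a : ℂ) + y * Complex.I - w)) =
      2 * Real.pi * Complex.I * q w := by
  have hab : a ≤ b := by linarith
  have hcd : c ≤ d := by linarith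
  have hwU : w ∈ U := hsub w ha.le hb.le hc.le hd.le
  have hds : DifferentiableOn ℂ (dslope q w) U :=
    (Complex.differentiableOn_dslope (hU.mem_nhds hwU)).2 hq
  have h0 := Complex.integral_boundary_rect_eq_zero_of_differentiableOn (dslope q w)
    ⟨a, c⟩ ⟨b, d⟩ (hds.mono (by
      intro v hv
      simp only [Complex.mem_reProdIm, Set.uIcc_of_le hab, Set.uIcc_of_le hcd] at hv
      exact hsub v hv.1.1 hv.1.2 hv.2.1 hv.2.2))
  simp only [smul_eq_mul] at h0
  have key : ∀ (γ : ℝ → ℂ) (s t : ℝ), s ≤ t → Continuous γ → (∀ x ∈ Set.Icc s t, γ x ∈ U) →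
      (∀ x, γ x - w ≠ 0) →
      ∫ x in s..t, q (γ x) / (γ x - w) =
        (∫ x in s..t, dslope q w (γ x)) + q w * ∫ x in s..t, 1 / (γ x - w) := by
    intro γ s t hst hγ hγU hne
    rw [← intervalIntegral.integral_const_mul, ← intervalIntegral.integral_add]
    · congr 1
      ext x
      rw [dslope_of_ne _ (sub_ne_zero.1 (hne x)), slope_def_field]
      field_simp [hne x]
      ring
    · apply ContinuousOn.intervalIntegrable
      rw [Set.uIcc_of_le hst]
      exact hds.continuousOn.comp hγ.continuousOn hγU
    · apply Continuous.intervalIntegrable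
      exact continuous_const.mul (continuous_const.div (hγ.sub continuous_const) hne)
  rw [key (fun x : ℝ => (x : ℂ) + c * Complex.I) a b hab (by fun_prop)
      (fun x hx => hsub _ (by simpa using hx.1) (by simpa using hx.2) (by simp)
        (by simpa using hcd))
      (fun x h => by have := congrArg Complex.im h; simp at this; linarith),
    key (fun x : ℝ => (x : ℂ) + d * Complex.I) a b hab (by fun_prop)
      (fun x hx => hsub _ (by simpa using hx.1) (by simpa using hx.2)
        (by simpa using hcd) (by simp))
      (fun x h => by have := congrArg Complex.im h; simp at this; linarith),
    key (fun x : ℝ => (b : ℂ) + x * Complex.I) c d hcd (by fun_prop)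
      (fun x hx => hsub _ (by simpa using hab) (by simp) (by simpa using hx.1)
        (by simpa using hx.2))
      (fun x h => by have := congrArg Complex.re h; simp at this; linarith),
    key (fun x : ℝ => (a : ℂ) + x * Complex.I) c d hcd (by fun_prop)
      (fun x hx => hsub _ (by simp) (by simpa using hab) (by simpa using hx.1)
        (by simpa using hx.2))
      (fun x h => by have := congrArg Complex.re h; simp at this; linarith)]
  have h1 := rect_one_div a b c d w ha hb hc hd
  linear_combination h0 + q w * h1

lemma exp_mem_slitDisc (v : ℂ) (h1 : v.re < 0) (h2 : |v.im| < Real.pi) :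
    Complex.exp v ∈ slitDisc := by
  refine ⟨?_, ?_⟩
  · simp [Complex.norm_exp, h1]
  · rintro ⟨h3, -, h4⟩
    rw [Complex.exp_im] at h3
    rw [Complex.exp_re] at h4
    have h5 : Real.sin v.im = 0 := by
      rcases mul_eq_zero.1 h3 with h | h
      · exact absurd h (Real.exp_pos _).ne'
      · exact h
    rw [abs_lt] at h2
    have h6 := (Real.sin_eq_zero_iff_of_lt_of_lt h2.1 h2.2).1 h5
    rw [h6, Real.cos_zero, mul_one] at h4
    exact absurd (Real.exp_pos v.re) (not_lt.2 h4)

lemma ray_bound (f : ℂ → ℂ) (δ M₁ : ℝ)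
    (hf_dec : ∀ z ∈ slitDisc, ‖f z‖ ≤ M₁ * ‖z‖ ^ δ) (x s : ℝ) (hx : x < 0)
    (hs : |s| < Real.pi) :
    ‖f (Complex.exp ((x : ℂ) + s * Complex.I))‖ ≤ M₁ * Real.exp (δ * x) := by
  have := hf_dec (Complex.exp ((x : ℂ) + s * Complex.I))
    (exp_mem_slitDisc _ (by simpa using hx) (by simpa using hs))
  rw [Complex.norm_exp] at this
  simp at this
  rwa [← Real.exp_mul, mul_comm x] at this

lemma ray_integrable (f : ℂ → ℂ) (hf_an : DifferentiableOn ℂ f slitDisc) (δ M₁ : ℝ) (hδ : 0 < δ)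
    (hf_dec : ∀ z ∈ slitDisc, ‖f z‖ ≤ M₁ * ‖z‖ ^ δ) (b s : ℝ) (hb : b < 0)
    (hs : |s| < Real.pi) :
    MeasureTheory.IntegrableOn (fun x : ℝ => f (Complex.exp ((x : ℂ) + s * Complex.I)))
      (Set.Iic b) := by
  refine MeasureTheory.Integrable.mono' ((integrableOn_exp_mul_Iic hδ b).const_mul M₁) ?_ ?_
  · apply ContinuousOn.aestronglyMeasurable _ measurableSet_Iic
    refine hf_an.continuousOn.comp (by fun_prop) ?_
    intro x hx
    have hx' : x ≤ b := hx
    exact exp_mem_slitDisc _ (by simp; linarith) (by simpa using hs)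
  · filter_upwards [MeasureTheory.ae_restrict_mem measurableSet_Iic] with x hx
    have hx' : x ≤ b := hx
    exact ray_bound f δ M₁ hf_dec x s (by linarith) hs

lemma rect_f (f : ℂ → ℂ) (hf_an : DifferentiableOn ℂ f slitDisc) (z : ℂ) (hz : 0 < z.re)
    (a b : ℝ) (hb0 : b < 0) (ha : a < Real.log ‖z‖) (hb : Real.log ‖z‖ < b) (c : ℝ)
    (hc : c = Real.pi / 2) :
    let K : ℂ → ℂ := fun v => f (Complex.exp v) * Complex.exp v / (Complex.exp v - z)
    (∫ x : ℝ in a..b, K ((x : ℂ) + (-c : ℝ) * Complex.I)) -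
      (∫ x : ℝ in a..b, K ((x : ℂ) + c * Complex.I)) +
      Complex.I * (∫ y : ℝ in (-c)..c, K ((b : ℂ) + y * Complex.I)) -
      Complex.I * (∫ y : ℝ in (-c)..c, K ((a : ℂ) + y * Complex.I)) =
      2 * Real.pi * Complex.I * f z := by
  intro K
  have hz0 : z ≠ 0 := by rintro rfl; simp at hz
  set w := Complex.log z with hw
  have hew : Complex.exp w = z := Complex.exp_log hz0
  have hwre : w.re = Real.log ‖z‖ := Complex.log_re z
  have hwim : |w.im| < Real.pi / 2 := by
    rw [Complex.log_im]
    exact Complex.abs_arg_lt_pi_div_two_iff.2 (Or.inl hz)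
  have hpi := Real.pi_pos
  set U : Set ℂ := {v | v.re < 0 ∧ |v.im| < Real.pi} with hUdef
  have hU : IsOpen U := by
    apply IsOpen.inter
    · exact isOpen_lt Complex.continuous_re continuous_const
    · exact isOpen_lt Complex.continuous_im.abs continuous_const
  have hwU : w ∈ U := ⟨by rw [hwre]; linarith, by linarith⟩
  have hdE : DifferentiableOn ℂ (dslope Complex.exp w) U :=
    (Complex.differentiableOn_dslope (hU.mem_nhds hwU)).2 Complex.differentiable_exp.differentiableOn
  have hdE0 : ∀ v ∈ U, dslope Complex.exp w v ≠ 0 := by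
    intro v hv
    by_cases hvw : v = w
    · rw [hvw, dslope_same, Complex.deriv_exp]
      exact Complex.exp_ne_zero _
    · rw [dslope_of_ne _ hvw, slope_def_field]
      refine div_ne_zero ?_ (sub_ne_zero.2 hvw)
      intro h
      apply hvw
      have h' := sub_eq_zero.1 h
      obtain ⟨n, hn⟩ := Complex.exp_eq_exp_iff_exists_int.1 h'
      have him := congrArg Complex.im hn
      simp at him
      have h3 := abs_lt.1 hv.2
      have h4 := abs_lt.1 hwim
      have hn0 : n = 0 := by
        have h5 : (n : ℝ) < 1 := by
          by_contra hh
          push Not at hh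
          nlinarith
        have h6 : (-1 : ℝ) < n := by
          by_contra hh
          push Not at hh
          nlinarith
        have h5' : n < 1 := by exact_mod_cast h5
        have h6' : -1 < n := by exact_mod_cast h6
        omega
      rw [hn, hn0]; simp
  set q : ℂ → ℂ := fun v => f (Complex.exp v) * Complex.exp v / dslope Complex.exp w v with hq
  have hqd : DifferentiableOn ℂ q U := by
    refine DifferentiableOn.div (DifferentiableOn.mul ?_
      Complex.differentiable_exp.differentiableOn) hdE hdE0
    exact hf_an.comp Complex.differentiable_exp.differentiableOn
      fun v hv => exp_mem_slitDisc v hv.1 hv.2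
  have hqK : ∀ v, v - w ≠ 0 → q v / (v - w) = K v := by
    intro v hv
    simp only [hq, K]
    rw [dslope_of_ne _ (sub_ne_zero.1 hv), slope_def_field, hew]
    rw [div_div, div_mul_cancel₀ _ hv]
  have hqw : q w = f z := by
    simp only [hq]
    rw [dslope_same, Complex.deriv_exp, mul_div_assoc, div_self (Complex.exp_ne_zero _), mul_one, hew]
  have hwim' := abs_lt.1 hwim
  have h := rect_cauchy hU q hqd a b (-c) c w (by rw [hwre]; exact ha) (by rw [hwre]; exact hb)
    (by linarith) (by linarith) (by
      intro v h1 h2 h3 h4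
      refine ⟨by linarith, ?_⟩
      rw [abs_lt]; constructor <;> linarith)
  rw [hqw] at h
  rw [← h]
  rw [← hwre] at ha hb
  have e1 : ∀ x : ℝ, K ((x : ℂ) + (-c : ℝ) * Complex.I) =
      q ((x : ℂ) + (-c : ℝ) * Complex.I) / ((x : ℂ) + (-c : ℝ) * Complex.I - w) := fun x =>
    (hqK _ (fun h => by have := congrArg Complex.im h; simp at this; linarith)).symm
  have e2 : ∀ x : ℝ, K ((x : ℂ) + c * Complex.I) =
      q ((x : ℂ) + c * Complex.I) / ((x : ℂ) + c * Complex.I - w) := fun x =>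
    (hqK _ (fun h => by have := congrArg Complex.im h; simp at this; linarith)).symm
  have e3 : ∀ x : ℝ, K ((b : ℂ) + x * Complex.I) =
      q ((b : ℂ) + x * Complex.I) / ((b : ℂ) + x * Complex.I - w) := fun x =>
    (hqK _ (fun h => by have := congrArg Complex.re h; simp at this; linarith)).symm
  have e4 : ∀ x : ℝ, K ((a : ℂ) + x * Complex.I) =
      q ((a : ℂ) + x * Complex.I) / ((a : ℂ) + x * Complex.I - w) := fun x =>
    (hqK _ (fun h => by have := congrArg Complex.re h; simp at this; linarith)).symm
  simp only [e1, e2, e3, e4]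

lemma re_exp_ray (x s : ℝ) (hs : |s| = Real.pi / 2) :
    (Complex.exp ((x : ℂ) + s * Complex.I)).re = 0 := by
  rw [Complex.exp_re]
  simp
  rw [← Real.cos_abs, hs, Real.cos_pi_div_two]

open MeasureTheory in
lemma ray_split (f : ℂ → ℂ) (hf_an : DifferentiableOn ℂ f slitDisc) (δ M₁ : ℝ) (hδ : 0 < δ)
    (hf_dec : ∀ z ∈ slitDisc, ‖f z‖ ≤ M₁ * ‖z‖ ^ δ) (z : ℂ) (hz : 0 < z.re)
    (b s : ℝ) (hb : b < 0) (hs : |s| = Real.pi / 2) :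
    let Z : ℝ → ℂ := fun x => Complex.exp ((x : ℂ) + s * Complex.I)
    IntegrableOn (fun x => f (Z x) * Z x / (Z x - z)) (Set.Iic b) ∧
    ∫ x in Set.Iic b, f (Z x) * Z x / (Z x - z) = (∫ x in Set.Iic b, f (Z x)) +
      z * ∫ x in Set.Iic b, f (Z x) / (Z x - z) := by
  intro Z
  have hpi := Real.pi_pos
  have hZc : Continuous Z := by fun_prop
  have hlow : ∀ x, z.re ≤ ‖Z x - z‖ := by
    intro x
    have := Complex.abs_re_le_norm (Z x - z)
    simp only [Z, Complex.sub_re, re_exp_ray x s hs, zero_sub, abs_neg] at this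
    exact (le_abs_self _).trans this
  have hne : ∀ x, Z x - z ≠ 0 := fun x => norm_pos_iff.1 (hz.trans_le (hlow x))
  have h1 : IntegrableOn (fun x => f (Z x)) (Set.Iic b) :=
    ray_integrable f hf_an δ M₁ hδ hf_dec b s hb (by rw [hs]; linarith)
  have h2 : IntegrableOn (fun x => f (Z x) / (Z x - z)) (Set.Iic b) := by
    have hc : Continuous (fun x => (Z x - z)⁻¹) := (hZc.sub continuous_const).inv₀ hne
    have := Integrable.mul_bdd (c := (z.re)⁻¹) h1 hc.aestronglyMeasurable
        (Eventually.of_forall fun x => by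
          rw [norm_inv]
          exact inv_anti₀ hz (hlow x))
    simpa [IntegrableOn, div_eq_mul_inv] using this
  have h3 : (fun x => f (Z x) * Z x / (Z x - z)) =
      fun x => f (Z x) + z * (f (Z x) / (Z x - z)) := by
    ext x
    have := hne x
    field_simp
    ring
  rw [h3]
  refine ⟨h1.add (h2.const_mul z), ?_⟩
  rw [integral_add h1 (h2.const_mul z), integral_const_mul]

open MeasureTheory in
lemma half_disc (f : ℂ → ℂ) (hf_an : DifferentiableOn ℂ f slitDisc) (δ M₁ : ℝ) (hδ : 0 < δ)
    (hM₁ : 0 < M₁)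
    (hf_dec : ∀ z ∈ slitDisc, ‖f z‖ ≤ M₁ * ‖z‖ ^ δ) (z : ℂ) (hz : 0 < z.re)
    (b c : ℝ) (hb0 : b < 0) (hb : Real.log ‖z‖ < b) (hc : c = Real.pi / 2) :
    let K : ℂ → ℂ := fun v => f (Complex.exp v) * Complex.exp v / (Complex.exp v - z)
    (∫ x : ℝ in Set.Iic b, K ((x : ℂ) + (-c : ℝ) * Complex.I)) -
      (∫ x : ℝ in Set.Iic b, K ((x : ℂ) + c * Complex.I)) +
      Complex.I * (∫ y : ℝ in (-c)..c, K ((b : ℂ) + y * Complex.I)) =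
      2 * Real.pi * Complex.I * f z := by
  intro K
  have hpi := Real.pi_pos
  have hzpos : 0 < ‖z‖ := norm_pos_iff.2 (by rintro rfl; simp at hz)
  have i1 := (ray_split f hf_an δ M₁ hδ hf_dec z hz b (-c) hb0
    (by rw [abs_neg, hc, abs_of_pos]; positivity)).1
  have i2 := (ray_split f hf_an δ M₁ hδ hf_dec z hz b c hb0
    (by rw [hc, abs_of_pos]; positivity)).1
  have t1 := intervalIntegral_tendsto_integral_Iic b i1 tendsto_id
  have t2 := intervalIntegral_tendsto_integral_Iic b i2 tendsto_id
  have t3 : Tendsto (fun a : ℝ => ∫ y : ℝ in (-c)..c, K ((a : ℂ) + y * Complex.I)) atBot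
      (nhds 0) := by
    have hlim : Tendsto (fun a : ℝ => M₁ * Real.exp (δ * a) * |c - (-c)|) atBot (nhds 0) := by
      have : Tendsto (fun a : ℝ => Real.exp (δ * a)) atBot (nhds 0) :=
        Real.tendsto_exp_atBot.comp (tendsto_id.const_mul_atBot hδ)
      simpa using (this.const_mul M₁).mul_const |c - (-c)|
    refine squeeze_zero_norm' ?_ hlim
    filter_upwards [eventually_lt_atBot (Real.log (‖z‖ / 2)), eventually_lt_atBot 0] with a ha ha0
    refine intervalIntegral.norm_integral_le_of_norm_le_const fun y hy => ?_
    rw [Set.uIoc_of_le (by rw [hc]; linarith)] at hy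
    have hyb : |y| < Real.pi := by
      rw [abs_lt]; constructor <;> linarith [hy.1, hy.2]
    have h1 := ray_bound f δ M₁ hf_dec a y ha0 hyb
    have h2 : ‖Complex.exp ((a : ℂ) + y * Complex.I)‖ = Real.exp a := by
      simp [Complex.norm_exp]
    have h3 : Real.exp a < ‖z‖ / 2 := (Real.lt_log_iff_exp_lt (by positivity)).1 ha
    have h4 : ‖z‖ / 2 ≤ ‖Complex.exp ((a : ℂ) + y * Complex.I) - z‖ := by
      have := norm_sub_norm_le z (Complex.exp ((a : ℂ) + y * Complex.I))
      rw [norm_sub_rev] at this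
      linarith
    simp only [K]
    rw [mul_div_assoc, norm_mul, norm_div, h2]
    have h5 : Real.exp a / ‖Complex.exp ((a : ℂ) + y * Complex.I) - z‖ ≤ 1 := by
      rw [div_le_one (by linarith)]
      linarith
    calc _ ≤ M₁ * Real.exp (δ * a) * 1 := by gcongr
      _ = _ := mul_one _
  have t := ((t1.sub t2).add_const
    (Complex.I * (∫ y : ℝ in (-c)..c, K ((b : ℂ) + y * Complex.I)))).sub (t3.const_mul Complex.I)
  rw [mul_zero, sub_zero] at t
  refine tendsto_nhds_unique t (tendsto_const_nhds.congr' ?_)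
  filter_upwards [eventually_lt_atBot (Real.log ‖z‖)] with a ha
  exact (rect_f f hf_an z hz a b hb0 ha hb c hc).symm

open MeasureTheory in
lemma ray_error (f : ℂ → ℂ) (δ M₁ : ℝ) (hδ : 0 < δ) (hδ1 : δ ≤ 1) (hM₁ : 0 < M₁)
    (hf_dec : ∀ z ∈ slitDisc, ‖f z‖ ≤ M₁ * ‖z‖ ^ δ) (κ : ℝ) (hκ : 0 < κ) (hκ1 : κ ≤ 1)
    (z : ℂ) (hz : 0 < ‖z‖) (hzκ : κ * ‖z‖ ≤ z.re)
    (b s : ℝ) (hb : b < 0) (hs : |s| = Real.pi / 2) :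
    let Z : ℝ → ℂ := fun x => Complex.exp ((x : ℂ) + s * Complex.I)
    ‖z‖ * (∫ x in Set.Iic b, ‖f (Z x)‖ / ‖Z x - z‖) ≤
      ‖z‖ ^ (δ / 2) * (2 * M₁ / κ * ∫ x in Set.Iic b, Real.exp (δ / 2 * x)) := by
  intro Z
  have hpi := Real.pi_pos
  rw [← integral_const_mul, ← integral_const_mul, ← integral_const_mul]
  apply integral_mono_of_nonneg
  · exact Eventually.of_forall fun x => by positivity
  · exact ((integrableOn_exp_mul_Iic (by positivity : 0 < δ / 2) b).const_mul _).const_mul _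
  · filter_upwards [ae_restrict_mem measurableSet_Iic] with x hx
    have hx' : x ≤ b := hx
    have h1 := ray_bound f δ M₁ hf_dec x s (by linarith) (by rw [hs]; linarith)
    have hZn : ‖Z x‖ = Real.exp x := by simp [Z, Complex.norm_exp]
    have hlow : κ * ‖z‖ ≤ ‖Z x - z‖ := by
      have := Complex.abs_re_le_norm (Z x - z)
      simp only [Z, Complex.sub_re, re_exp_ray x s hs, zero_sub, abs_neg] at this
      exact hzκ.trans ((le_abs_self _).trans this)
    set D := ‖Z x - z‖ with hD
    have hDpos : 0 < D := lt_of_lt_of_le (by positivity) hlow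
    have hz2 : ‖z‖ ≤ 2 / κ * D := by
      rw [div_mul_eq_mul_div, le_div_iff₀ hκ]
      nlinarith
    have hZ2 : Real.exp x ≤ 2 / κ * D := by
      have h3 : ‖Z x‖ ≤ D + ‖z‖ := by
        have := norm_add_le (Z x - z) z
        simpa using this
      rw [hZn] at h3
      rw [div_mul_eq_mul_div, le_div_iff₀ hκ]
      nlinarith
    have hprod : Real.exp x ^ (δ / 2) * ‖z‖ ^ (1 - δ / 2) ≤ 2 / κ * D := by
      have hpos : 0 < 2 / κ * D := by positivity
      calc _ ≤ (2 / κ * D) ^ (δ / 2) * (2 / κ * D) ^ (1 - δ / 2) := by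
            gcongr
            linarith
        _ = 2 / κ * D := by
            rw [← Real.rpow_add hpos]; simp
    have hzz : ‖z‖ = ‖z‖ ^ (δ / 2) * ‖z‖ ^ (1 - δ / 2) := by
      rw [← Real.rpow_add hz]; simp
    have hee : Real.exp (δ * x) = Real.exp (δ / 2 * x) * Real.exp x ^ (δ / 2) := by
      rw [← Real.exp_mul, ← Real.exp_add]
      ring_nf
    show ‖z‖ * (‖f (Z x)‖ / D) ≤ _
    rw [← mul_div_assoc, div_le_iff₀ hDpos]
    calc ‖z‖ * ‖f (Z x)‖ ≤ ‖z‖ * (M₁ * Real.exp (δ * x)) := by gcongr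
      _ = (‖z‖ ^ (δ / 2) * ‖z‖ ^ (1 - δ / 2)) * (M₁ * Real.exp (δ * x)) := by rw [← hzz]
      _ = ‖z‖ ^ (δ / 2) * M₁ * Real.exp (δ / 2 * x) *
            (Real.exp x ^ (δ / 2) * ‖z‖ ^ (1 - δ / 2)) := by rw [hee]; ring
      _ ≤ ‖z‖ ^ (δ / 2) * M₁ * Real.exp (δ / 2 * x) * (2 / κ * D) := by gcongr
      _ = _ := by ring

open MeasureTheory Polynomial in
lemma approx_main (f : ℂ → ℂ) (hf_an : DifferentiableOn ℂ f slitDisc) (δ M₁ : ℝ) (hδ : 0 < δ)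
    (hδ1 : δ ≤ 1) (hM₁ : 0 < M₁)
    (hf_dec : ∀ z ∈ slitDisc, ‖f z‖ ≤ M₁ * ‖z‖ ^ δ) (κ : ℝ) (hκ : 0 < κ) (hκ1 : κ ≤ 1)
    (ρ R : ℝ) (hρ : 0 < ρ) (hρR : ρ < R) (hR : R < 1) :
    ∃ K₁ K₂ : ℝ, 0 < K₁ ∧ 0 < K₂ ∧ ∀ (l : List ℝ) (N : ℕ), (∀ a ∈ l, 0 < a) →
      ∃ p : ℂ[X], p.natDegree ≤ max (l.length + N) (l.length + 1) ∧
        ∀ z : ℂ, 0 < ‖z‖ → ‖z‖ ≤ ρ → κ * ‖z‖ ≤ z.re →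
        ‖f z - p.eval z / ((l.map fun a : ℝ => X + C (a : ℂ)).prod).eval z‖ ≤
          K₁ * (l.map (fun a : ℝ => ‖(z - a) / (z + a)‖)).prod * ‖z‖ ^ (δ / 2) +
          K₂ * (ρ / R) ^ N := by
  have hpi := Real.pi_pos
  have hR0 : 0 < R := hρ.trans hρR
  set b := Real.log R with hbdef
  have hb : b < 0 := Real.log_neg hR0 hR
  set c := Real.pi / 2 with hc
  have hcp : 0 < c := by positivity
  have hcc : |c| = Real.pi / 2 := abs_of_pos hcp
  have hcm : |(-c)| = Real.pi / 2 := by rw [abs_neg, hcc]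
  set Zm : ℝ → ℂ := fun x => Complex.exp ((x : ℂ) + (-c : ℝ) * Complex.I) with hZm
  set Zp : ℝ → ℂ := fun x => Complex.exp ((x : ℂ) + c * Complex.I) with hZp
  set Zr : ℝ → ℂ := fun y => Complex.exp ((b : ℂ) + y * Complex.I) with hZr
  set J := 2 * M₁ / κ * ∫ x in Set.Iic b, Real.exp (δ / 2 * x) with hJ
  have hJ0 : 0 ≤ J := by
    have : 0 ≤ ∫ x in Set.Iic b, Real.exp (δ / 2 * x) :=
      integral_nonneg fun x => (Real.exp_pos _).le
    positivity
  set μ := (volume : Measure ℝ).restrict (Set.Ioc (-c) c) with hμ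
  set T := (∫ y, ‖f (Zr y)‖ ∂μ) * (R / (R - ρ)) with hT
  have hT0 : 0 ≤ T := by
    have h1 : 0 ≤ ∫ y, ‖f (Zr y)‖ ∂μ := integral_nonneg fun x => norm_nonneg _
    have h2 : 0 < R - ρ := by linarith
    positivity
  have hint_r : Integrable (fun y => f (Zr y)) μ := by
    rw [hμ, ← IntegrableOn]
    refine (ContinuousOn.integrableOn_Icc ?_).mono_set Set.Ioc_subset_Icc_self
    refine hf_an.continuousOn.comp (by fun_prop) fun y hy => ?_
    refine exp_mem_slitDisc _ (by simpa using hb) ?_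
    simp
    rw [abs_lt]; constructor <;> linarith [hy.1, hy.2]
  have hZrn : ∀ y, ‖Zr y‖ = R := by
    intro y
    simp [Zr, Complex.norm_exp, hbdef, Real.exp_log hR0]
  refine ⟨2 * J + 1, T + 1, by positivity, by positivity, fun l N hl => ?_⟩
  obtain ⟨pm, hpm, hpmz⟩ := key_blaschke (volume.restrict (Set.Iic b)) Zm (by fun_prop)
    (fun x => re_exp_ray x (-c) hcm) l hl (fun x => f (Zm x))
    (ray_integrable f hf_an δ M₁ hδ hf_dec b (-c) hb (by rw [hcm]; linarith))
  obtain ⟨pp, hpp, hppz⟩ := key_blaschke (volume.restrict (Set.Iic b)) Zp (by fun_prop)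
    (fun x => re_exp_ray x c hcc) l hl (fun x => f (Zp x))
    (ray_integrable f hf_an δ M₁ hδ hf_dec b c hb (by rw [hcc]; linarith))
  obtain ⟨pr, hpr, hprz⟩ := key_taylor μ Zr (by fun_prop) R ρ hρ hρR hZrn N
    (fun y => f (Zr y)) hint_r
  set q : ℂ[X] := (l.map fun a : ℝ => X + C (a : ℂ)).prod with hq
  have hqdeg : q.natDegree ≤ l.length := by
    have := natDegree_list_prod_le (l.map fun a : ℝ => X + C (a : ℂ))
    refine this.trans ?_
    refine (List.sum_le_card_nsmul _ 1 ?_).trans ?_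
    · simp
    · simp
  set Am := ∫ x in Set.Iic b, f (Zm x) with hAm
  set Ap := ∫ x in Set.Iic b, f (Zp x) with hAp
  set τ : ℂ := 2 * Real.pi * Complex.I with hτ
  have hτ0 : τ ≠ 0 := by simp [hτ, hpi.ne', Complex.I_ne_zero]
  have hτn : 1 ≤ ‖τ‖ := by
    simp [hτ, abs_of_pos hpi]
    linarith [Real.pi_gt_three]
  refine ⟨C τ⁻¹ * ((C (Am - Ap) + C Complex.I * pr) * q + X * (pm - pp)), ?_, ?_⟩
  · refine (natDegree_C_mul_le _ _).trans ((natDegree_add_le _ _).trans (max_le_max ?_ ?_))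
    · refine natDegree_mul_le.trans ?_
      have : (C (Am - Ap) + C Complex.I * pr).natDegree ≤ N := by
        refine (natDegree_add_le _ _).trans (max_le (by simp) ?_)
        exact (natDegree_C_mul_le _ _).trans hpr
      omega
    · refine natDegree_mul_le.trans ?_
      have h1 := natDegree_X_le (R := ℂ)
      have h2 : (pm - pp).natDegree ≤ l.length :=
        (natDegree_sub_le _ _).trans (max_le hpm hpp)
      omega
  · intro z hz hzρ hzκ
    have hzre : 0 < z.re := lt_of_lt_of_le (by positivity) hzκ
    have hqz : q.eval z ≠ 0 := by
      rw [hq, eval_list_prod]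
      apply List.prod_ne_zero
      simp only [List.map_map, List.mem_map, Function.comp, not_exists, not_and]
      intro b hb h0
      have := congrArg Complex.re h0
      have hb' := hl b hb
      simp at this
      linarith
    have hrep := half_disc f hf_an δ M₁ hδ hM₁ hf_dec z hzre b c hb
      (Real.log_lt_log hz (by linarith)) hc
    simp only at hrep
    have hsm := (ray_split f hf_an δ M₁ hδ hf_dec z hzre b (-c) hb hcm).2
    have hsp := (ray_split f hf_an δ M₁ hδ hf_dec z hzre b c hb hcc).2
    simp only at hsm hsp
    rw [hsm, hsp, intervalIntegral.integral_of_le (by linarith)] at hrep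
    have em := hpmz z hzre
    have ep := hppz z hzre
    have er := hprz z hzρ
    have bm := ray_error f δ M₁ hδ hδ1 hM₁ hf_dec κ hκ hκ1 z hz hzκ b (-c) hb hcm
    have bp := ray_error f δ M₁ hδ hδ1 hM₁ hf_dec κ hκ hκ1 z hz hzκ b c hb hcc
    simp only at bm bp
    set PB := (l.map (fun a : ℝ => ‖(z - a) / (z + a)‖)).prod with hPB
    have hPB0 : 0 ≤ PB := by
      apply List.prod_nonneg
      simp only [List.mem_map]
      rintro _ ⟨a, _, rfl⟩
      positivity
    set Im := ∫ x in Set.Iic b, f (Zm x) / (Zm x - z) with hIm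
    set Ip := ∫ x in Set.Iic b, f (Zp x) / (Zp x - z) with hIp
    set Ir := ∫ y, f (Zr y) * Zr y / (Zr y - z) ∂μ with hIr
    have hrep' : (Am + z * Im) - (Ap + z * Ip) + Complex.I * Ir = τ * f z := hrep
    have hfz : f z - eval z (C τ⁻¹ * ((C (Am - Ap) + C Complex.I * pr) * q + X * (pm - pp))) /
        eval z q = τ⁻¹ * (z * (Im - eval z pm / eval z q) - z * (Ip - eval z pp / eval z q) +
          Complex.I * (Ir - eval z pr)) := by
      have : f z = τ⁻¹ * ((Am + z * Im) - (Ap + z * Ip) + Complex.I * Ir) := by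
        rw [hrep', inv_mul_cancel_left₀ hτ0]
      rw [this]
      simp only [eval_add, eval_mul, eval_sub, eval_C, eval_X]
      field_simp
      ring
    rw [hfz, norm_mul, norm_inv]
    have hem : ‖z * (Im - eval z pm / eval z q)‖ ≤ PB * (‖z‖ ^ (δ / 2) * J) := by
      rw [norm_mul]
      calc _ ≤ ‖z‖ * (PB * ∫ x in Set.Iic b, ‖f (Zm x)‖ / ‖Zm x - z‖) := by gcongr
        _ = PB * (‖z‖ * ∫ x in Set.Iic b, ‖f (Zm x)‖ / ‖Zm x - z‖) := by ring
        _ ≤ _ := by gcongr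
    have hep : ‖z * (Ip - eval z pp / eval z q)‖ ≤ PB * (‖z‖ ^ (δ / 2) * J) := by
      rw [norm_mul]
      calc _ ≤ ‖z‖ * (PB * ∫ x in Set.Iic b, ‖f (Zp x)‖ / ‖Zp x - z‖) := by gcongr
        _ = PB * (‖z‖ * ∫ x in Set.Iic b, ‖f (Zp x)‖ / ‖Zp x - z‖) := by ring
        _ ≤ _ := by gcongr
    have her : ‖Complex.I * (Ir - eval z pr)‖ ≤ (ρ / R) ^ N * T := by
      rw [norm_mul, Complex.norm_I, one_mul]
      exact er
    have hzp : 0 ≤ ‖z‖ ^ (δ / 2) := by positivity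
    have hRp : 0 ≤ (ρ / R) ^ N := by positivity
    calc _ ≤ 1 * (PB * (‖z‖ ^ (δ / 2) * J) + PB * (‖z‖ ^ (δ / 2) * J) + (ρ / R) ^ N * T) := by
          refine mul_le_mul (inv_le_one_of_one_le₀ hτn) ?_ (norm_nonneg _) zero_le_one
          refine (norm_add_le _ _).trans (add_le_add ((norm_sub_le _ _).trans ?_) her)
          exact add_le_add hem hep
      _ ≤ _ := by
          have : 0 ≤ PB * ‖z‖ ^ (δ / 2) := by positivity
          nlinarith

lemma list_prod_le_one {α : Type*} (g : α → ℝ) (l : List α) (h0 : ∀ i ∈ l, 0 ≤ g i)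
    (h1 : ∀ i ∈ l, g i ≤ 1) : 0 ≤ (l.map g).prod ∧ (l.map g).prod ≤ 1 := by
  induction l with
  | nil => simp
  | cons a l ih =>
    have := ih (fun i hi => h0 i (by simp [hi])) (fun i hi => h1 i (by simp [hi]))
    simp only [List.map_cons, List.prod_cons]
    have ha := h0 a (by simp)
    have ha1 := h1 a (by simp)
    exact ⟨mul_nonneg ha this.1, mul_le_one₀ ha1 this.1 this.2⟩

lemma list_prod_le_mem {α : Type*} (g : α → ℝ) (l : List α) (h0 : ∀ i ∈ l, 0 ≤ g i)
    (h1 : ∀ i ∈ l, g i ≤ 1) : ∀ i ∈ l, (l.map g).prod ≤ g i := by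
  induction l with
  | nil => simp
  | cons a l ih =>
    have h0' : ∀ i ∈ l, 0 ≤ g i := fun i hi => h0 i (by simp [hi])
    have h1' : ∀ i ∈ l, g i ≤ 1 := fun i hi => h1 i (by simp [hi])
    have hp := list_prod_le_one g l h0' h1'
    have ha := h0 a (by simp)
    have ha1 := h1 a (by simp)
    intro i hi
    simp only [List.map_cons, List.prod_cons]
    rcases List.mem_cons.1 hi with rfl | hi
    · exact mul_le_of_le_one_right ha hp.2
    · exact (mul_le_of_le_one_left hp.1 ha1).trans (ih h0' h1' i hi)

lemma list_prod_flatMap {α β : Type*} (g : β → ℝ) (F : α → List β) (l : List α) :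
    ((l.flatMap F).map g).prod = (l.map fun i => ((F i).map g).prod).prod := by
  induction l with
  | nil => simp
  | cons a l ih => simp [List.flatMap_cons, ih]

/-- The interpolation nodes (negatives of the poles). -/
noncomputable def nodeList (n : ℕ) : List ℝ :=
  List.replicate (n / 3) 1 ++
    (List.range (Nat.sqrt (n / 3))).flatMap
      (fun i : ℕ => List.replicate (Nat.sqrt (n / 3)) (Real.exp (-(i : ℝ))))

lemma nodeList_pos (n : ℕ) : ∀ a ∈ nodeList n, 0 < a := by
  intro a ha
  simp only [nodeList, List.mem_append, List.mem_flatMap, List.mem_replicate] at ha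
  rcases ha with ⟨_, rfl⟩ | ⟨i, _, _, rfl⟩
  · exact one_pos
  · exact Real.exp_pos _

lemma nodeList_length (n : ℕ) : (nodeList n).length ≤ 2 * (n / 3) := by
  have := Nat.sqrt_le (n / 3)
  simp [nodeList, List.length_flatMap]
  omega

lemma nodeList_prod (g : ℝ → ℝ) (n : ℕ) : ((nodeList n).map g).prod =
    g 1 ^ (n / 3) * ((List.range (Nat.sqrt (n / 3))).map
      fun i : ℕ => g (Real.exp (-(i : ℝ))) ^ (Nat.sqrt (n / 3))).prod := by
  rw [nodeList, List.map_append, List.prod_append, list_prod_flatMap]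
  simp

lemma blaschke_le_one (z : ℂ) (hz : 0 < z.re) (a : ℝ) (ha : 0 < a) :
    ‖(z - a) / (z + a)‖ < 1 := by
  have hpos : 0 < ‖z + a‖ := by
    have := Complex.abs_re_le_norm (z + a)
    simp at this
    rw [abs_of_pos (by linarith)] at this
    linarith
  rw [norm_div, div_lt_one hpos]
  rw [← sq_lt_sq₀ (norm_nonneg _) hpos.le, ← Complex.normSq_eq_norm_sq, ← Complex.normSq_eq_norm_sq,
    Complex.normSq_apply, Complex.normSq_apply]
  simp
  nlinarith [mul_pos hz ha]

lemma blaschke_sector (κ : ℝ) (hκ : 0 < κ) (hκ1 : κ ≤ 1) (z : ℂ) (a : ℝ) (ha : 0 < a)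
    (hz1 : ‖z‖ ≤ a) (hz2 : a * Real.exp (-1) ≤ ‖z‖) (hzκ : κ * ‖z‖ ≤ z.re) :
    ‖(z - a) / (z + a)‖ ≤ Real.sqrt (1 - κ * Real.exp (-1)) := by
  have he := Real.exp_pos (-1)
  have hz0 : 0 < ‖z‖ := lt_of_lt_of_le (by positivity) hz2
  have hre : 0 < z.re := lt_of_lt_of_le (by positivity) hzκ
  apply Real.le_sqrt_of_sq_le
  have hpos : 0 < ‖z + a‖ := by
    have := Complex.abs_re_le_norm (z + a)
    simp at this
    rw [abs_of_pos (by linarith)] at this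
    linarith
  rw [norm_div, div_pow, div_le_iff₀ (by positivity)]
  have h1 : ‖z - a‖ ^ 2 = ‖z + a‖ ^ 2 - 4 * a * z.re := by
    rw [← Complex.normSq_eq_norm_sq, ← Complex.normSq_eq_norm_sq,
      Complex.normSq_apply, Complex.normSq_apply]
    simp
    ring
  have h2 : ‖z + a‖ ≤ 2 * a := by
    have := norm_add_le z (a : ℂ)
    rw [Complex.norm_real, Real.norm_of_nonneg ha.le] at this
    linarith
  have h3 : ‖z + a‖ ^ 2 ≤ (2 * a) ^ 2 := by gcongr
  have h4 : κ * Real.exp (-1) * ‖z + a‖ ^ 2 ≤ 4 * a * z.re := by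
    calc _ ≤ κ * Real.exp (-1) * (2 * a) ^ 2 := by gcongr
      _ = 4 * a * (κ * (a * Real.exp (-1))) := by ring
      _ ≤ 4 * a * (κ * ‖z‖) := by gcongr
      _ ≤ _ := by gcongr
  rw [h1]
  linarith

lemma pow_bound (θ : ℝ) (h0 : 0 < θ) (h1 : θ < 1) (k : ℕ) (x : ℝ) (hx : x ≤ k + 1) :
    θ ^ k ≤ θ⁻¹ * Real.exp (Real.log θ * x) := by
  have hl := Real.log_neg h0 h1
  have : θ ^ k = θ⁻¹ * Real.exp (Real.log θ * (k + 1)) := by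
    rw [← Real.rpow_def_of_pos h0, Real.rpow_add h0, Real.rpow_natCast, Real.rpow_one]
    field_simp
  rw [this]
  refine mul_le_mul_of_nonneg_left (Real.exp_le_exp.2 ?_) (inv_pos.2 h0).le
  exact mul_le_mul_of_nonpos_left hx hl.le

lemma nodeList_bound_compact (n : ℕ) (z : ℂ) (hz : 0 < z.re) :
    ((nodeList n).map (fun a : ℝ => ‖(z - a) / (z + a)‖)).prod ≤ ‖(z - 1) / (z + 1)‖ ^ (n / 3) := by
  rw [nodeList_prod]
  have h := list_prod_le_one (fun i : ℕ => ‖(z - (Real.exp (-(i : ℝ)) : ℝ)) /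
    (z + (Real.exp (-(i : ℝ)) : ℝ))‖ ^ (Nat.sqrt (n / 3))) (List.range (Nat.sqrt (n / 3)))
    (fun i _ => by positivity)
    (fun i _ => pow_le_one₀ (norm_nonneg _) (blaschke_le_one z hz _ (Real.exp_pos _)).le)
  have := mul_le_of_le_one_right (pow_nonneg (norm_nonneg ((z - (1 : ℝ)) / (z + (1 : ℝ)))) (n / 3)) h.2
  simpa using this

lemma nodeList_bound_sector (κ : ℝ) (hκ : 0 < κ) (hκ1 : κ ≤ 1) (n : ℕ) (z : ℂ)
    (hz1 : ‖z‖ < 1) (hzκ : κ * ‖z‖ ≤ z.re) (hz2 : Real.exp (-(Nat.sqrt (n / 3) : ℝ)) < ‖z‖) :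
    ((nodeList n).map (fun a : ℝ => ‖(z - a) / (z + a)‖)).prod ≤
      Real.sqrt (1 - κ * Real.exp (-1)) ^ (Nat.sqrt (n / 3)) := by
  have hz0 : 0 < ‖z‖ := (Real.exp_pos _).trans hz2
  have hz : 0 < z.re := lt_of_lt_of_le (by positivity) hzκ
  rw [nodeList_prod]
  set L := Nat.sqrt (n / 3) with hL
  set g : ℕ → ℝ := fun i : ℕ => ‖(z - (Real.exp (-(i : ℝ)) : ℝ)) /
    (z + (Real.exp (-(i : ℝ)) : ℝ))‖ ^ L with hg
  have hlog : Real.log ‖z‖ < 0 := Real.log_neg hz0 hz1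
  have hlogL : -(L : ℝ) < Real.log ‖z‖ := (Real.lt_log_iff_exp_lt hz0).2 hz2
  set i := ⌊-Real.log ‖z‖⌋₊ with hi
  have hi1 : (i : ℝ) ≤ -Real.log ‖z‖ := Nat.floor_le (by linarith)
  have hi2 : -Real.log ‖z‖ < i + 1 := Nat.lt_floor_add_one _
  have hiL : i < L := by
    have : (i : ℝ) < L := by linarith
    exact_mod_cast this
  have h := list_prod_le_one g (List.range L) (fun i _ => by positivity)
    (fun i _ => pow_le_one₀ (norm_nonneg _) (blaschke_le_one z hz _ (Real.exp_pos _)).le)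
  have h' := list_prod_le_mem g (List.range L) (fun i _ => by positivity)
    (fun i _ => pow_le_one₀ (norm_nonneg _) (blaschke_le_one z hz _ (Real.exp_pos _)).le) i
    (by simpa using hiL)
  have hb := blaschke_sector κ hκ hκ1 z (Real.exp (-(i : ℝ))) (Real.exp_pos _)
    ((Real.log_le_iff_le_exp hz0).1 (by linarith))
    (by rw [← Real.exp_add]; exact (Real.le_log_iff_exp_le hz0).1 (by linarith)) hzκ
  have h1 := pow_le_one₀ (n := n / 3) (norm_nonneg _) (blaschke_le_one z hz 1 one_pos).le
  calc _ ≤ ((List.range L).map g).prod := mul_le_of_le_one_left h.1 h1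
    _ ≤ g i := h'
    _ ≤ _ := by
      simp only [hg]
      gcongr

open Polynomial in
theorem stmt_5 (Θ : ℝ) (hΘ1 : 0 < Θ) (hΘ2 : Θ < Real.pi / 2)
    (f : ℂ → ℂ) (hf_an : DifferentiableOn ℂ f slitDisc)
    (hf_bdd : ∃ B : ℝ, ∀ z ∈ slitDisc, ‖f z‖ ≤ B)
    (δ M₁ : ℝ) (hδ : 0 < δ) (hM₁ : 0 < M₁)
    (hf_dec : ∀ z ∈ slitDisc, ‖f z‖ ≤ M₁ * ‖z‖ ^ δ)
    (ρ : ℝ) (hρ1 : 0 < ρ) (hρ2 : ρ < 1)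
    (M : Set ℂ) (hM : M = (fun z : ℂ => (ρ : ℂ) * z) '' sectorA Θ) :
    ∃ (C C₀ : ℝ) (p q : ℕ → Polynomial ℂ), 0 < C ∧ 0 < C₀ ∧
      (∀ n : ℕ, 1 ≤ n →
        (p n).natDegree ≤ n ∧ (q n).natDegree ≤ n ∧
        ∀ z ∈ closure M, (q n).eval z ≠ 0) ∧
      (∀ n : ℕ, 1 ≤ n → ∀ z ∈ M,
        ‖f z - (p n).eval z / (q n).eval z‖ ≤
          C₀ * Real.exp (-C * Real.sqrt n)) ∧
      (∀ E : Set ℂ, IsCompact E → E ⊆ M → ∃ c : ℝ, 0 < c ∧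
        Tendsto (fun n : ℕ => Real.exp (c * n) *
          ⨆ z : E, ‖f z - (p n).eval (z : ℂ) / (q n).eval (z : ℂ)‖)
          atTop (nhds 0)) := by
  have hpi := Real.pi_pos
  -- reduction to exponent at most one
  set δ' := min δ 1 with hδ'
  have hdpos : 0 < δ' := lt_min hδ one_pos
  have hdle : δ' ≤ 1 := min_le_right _ _
  have hdec : ∀ z ∈ slitDisc, ‖f z‖ ≤ M₁ * ‖z‖ ^ δ' := by
    intro z hz
    refine (hf_dec z hz).trans ?_
    have hz1 : ‖z‖ < 1 := hz.1
    have hz0 : 0 < ‖z‖ := by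
      rw [norm_pos_iff]
      rintro rfl
      exact hz.2 ⟨by simp, by simp, by simp⟩
    gcongr ?_ * ?_
    exact Real.rpow_le_rpow_of_exponent_ge hz0 hz1.le (min_le_left _ _)
  set κ := Real.cos Θ with hκdef
  have hκ : 0 < κ := Real.cos_pos_of_mem_Ioo ⟨by linarith, hΘ2⟩
  have hκ1 : κ ≤ 1 := Real.cos_le_one _
  have hMz : ∀ z ∈ M, 0 < ‖z‖ ∧ ‖z‖ < ρ ∧ κ * ‖z‖ ≤ z.re := by
    rw [hM]
    rintro _ ⟨u, ⟨h0, h1, h2⟩, rfl⟩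
    have hn : ‖(ρ : ℂ) * u‖ = ρ * ‖u‖ := by
      rw [norm_mul, Complex.norm_real, Real.norm_of_nonneg hρ1.le]
    simp only [hn]
    refine ⟨by positivity, by nlinarith, ?_⟩
    have h3 : κ ≤ Real.cos (Complex.arg u) := by
      rw [← Real.cos_abs (Complex.arg u)]
      exact Real.cos_le_cos_of_nonneg_of_le_pi (abs_nonneg _) (by linarith) h2.le
    have h4 : ((ρ : ℂ) * u).re = ρ * (‖u‖ * Real.cos (Complex.arg u)) := by
      rw [Complex.norm_mul_cos_arg]; simp
    rw [h4]
    calc _ = ρ * (‖u‖ * κ) := by ring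
      _ ≤ _ := by gcongr
  have hMre : ∀ z ∈ M, 0 < z.re := fun z hz =>
    lt_of_lt_of_le (mul_pos hκ (hMz z hz).1) (hMz z hz).2.2
  set R := (ρ + 1) / 2 with hR
  have hρR : ρ < R := by linarith
  have hR1 : R < 1 := by linarith
  have hR0 : 0 < R := by linarith
  obtain ⟨K₁, K₂, hK₁, hK₂, happ⟩ := approx_main f hf_an δ' M₁ hdpos hdle hM₁ hdec κ hκ hκ1 ρ R hρ1
    hρR hR1
  choose p hp hpz using fun n : ℕ => happ (nodeList n) (n / 3) (nodeList_pos n)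
  set q : ℕ → ℂ[X] := fun n => ((nodeList n).map fun a : ℝ => X + C (a : ℂ)).prod with hq
  set σ := Real.sqrt (1 - κ * Real.exp (-1)) with hσ
  have hσ1 : σ < 1 := by
    rw [hσ, Real.sqrt_lt' one_pos]
    have := mul_pos hκ (Real.exp_pos (-1))
    linarith
  have hr0 : 0 < ρ / R := by positivity
  have hr1 : ρ / R < 1 := (div_lt_one hR0).2 hρR
  -- general rational function bounds
  set θ := max (max σ (Real.exp (-(δ' / 2)))) (ρ / R) with hθ
  have hθ0 : 0 < θ := lt_of_lt_of_le hr0 (le_max_right _ _)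
  have hθ1 : θ < 1 := by
    refine max_lt (max_lt hσ1 ?_) hr1
    rw [Real.exp_lt_one_iff]
    linarith
  have hlogθ := Real.log_neg hθ0 hθ1
  refine ⟨-(Real.log θ) / 2, (K₁ + K₂) * θ⁻¹, p, q, by linarith, by positivity, ?_, ?_, ?_⟩
  · intro n hn
    have hlen := nodeList_length n
    refine ⟨(hp n).trans (max_le (by omega) (by omega)), ?_, ?_⟩
    · have := natDegree_list_prod_le ((nodeList n).map fun a : ℝ => X + C (a : ℂ))
      refine this.trans ?_
      refine (List.sum_le_card_nsmul _ 1 ?_).trans ?_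
      · simp
      · simp; omega
    · intro z hz
      have hzre : 0 ≤ z.re := by
        have hcl : IsClosed {z : ℂ | 0 ≤ z.re} := isClosed_le continuous_const Complex.continuous_re
        exact closure_minimal (fun z hz => (hMre z hz).le) hcl hz
      rw [hq]
      simp only
      rw [eval_list_prod]
      apply List.prod_ne_zero
      simp only [List.map_map, List.mem_map, Function.comp, not_exists, not_and]
      intro b hb h0
      have := congrArg Complex.re h0
      have hb' := nodeList_pos n b hb
      simp at this
      linarith
  · intro n hn z hz
    obtain ⟨h0, h1, h2⟩ := hMz z hz
    refine (hpz n z h0 h1.le h2).trans ?_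
    set L := Nat.sqrt (n / 3) with hL
    have hLN : L ≤ n / 3 := Nat.sqrt_le_self _
    have hprod := list_prod_le_one (fun a : ℝ => ‖(z - a) / (z + a)‖) (nodeList n)
      (fun a _ => norm_nonneg _)
      (fun a ha => (blaschke_le_one z (hMre z hz) a (nodeList_pos n a ha)).le)
    set PB := ((nodeList n).map (fun a : ℝ => ‖(z - a) / (z + a)‖)).prod with hPB
    have hzs1 : ‖z‖ ^ (δ' / 2) ≤ 1 := Real.rpow_le_one h0.le (by linarith) (by linarith)
    have hzs0 : 0 ≤ ‖z‖ ^ (δ' / 2) := by positivity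
    have hA : PB * ‖z‖ ^ (δ' / 2) ≤ θ ^ L := by
      by_cases hcase : Real.exp (-(L : ℝ)) < ‖z‖
      · have := nodeList_bound_sector κ hκ hκ1 n z (by linarith) h2 hcase
        calc _ ≤ PB := mul_le_of_le_one_right hprod.1 hzs1
          _ ≤ σ ^ L := this
          _ ≤ θ ^ L := by
            refine pow_le_pow_left₀ (Real.sqrt_nonneg _) ?_ _
            exact (le_max_left _ _).trans (le_max_left _ _)
      · push Not at hcase
        calc _ ≤ ‖z‖ ^ (δ' / 2) := mul_le_of_le_one_left hzs0 hprod.2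
          _ ≤ Real.exp (-(L : ℝ)) ^ (δ' / 2) := by gcongr
          _ = Real.exp (-(δ' / 2)) ^ L := by
            rw [← Real.exp_mul, ← Real.exp_nat_mul]; ring_nf
          _ ≤ θ ^ L := by
            refine pow_le_pow_left₀ (Real.exp_pos _).le ?_ _
            exact (le_max_right _ _).trans (le_max_left _ _)
    have hB : (ρ / R) ^ (n / 3) ≤ θ ^ L := by
      calc _ ≤ (ρ / R) ^ L := pow_le_pow_of_le_one hr0.le hr1.le hLN
        _ ≤ θ ^ L := pow_le_pow_left₀ hr0.le (le_max_right _ _) _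
    have hLn : Real.sqrt n / 2 ≤ L + 1 := by
      have h3 : n / 3 < (L + 1) * (L + 1) := Nat.lt_succ_sqrt (n / 3)
      have h4 : n ≤ 4 * ((L + 1) * (L + 1)) := by omega
      have h5 : (n : ℝ) ≤ (2 * (L + 1)) ^ 2 := by
        have : (n : ℝ) ≤ 4 * ((L + 1) * (L + 1)) := by exact_mod_cast h4
        nlinarith
      have h6 : Real.sqrt n ≤ 2 * (L + 1) := Real.sqrt_le_iff.2 ⟨by positivity, h5⟩
      linarith
    have hfin := pow_bound θ hθ0 hθ1 L (Real.sqrt n / 2) hLn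
    calc _ = K₁ * (PB * ‖z‖ ^ (δ' / 2)) + K₂ * (ρ / R) ^ (n / 3) := by ring
      _ ≤ K₁ * θ ^ L + K₂ * θ ^ L := by gcongr
      _ = (K₁ + K₂) * θ ^ L := by ring
      _ ≤ (K₁ + K₂) * (θ⁻¹ * Real.exp (Real.log θ * (Real.sqrt n / 2))) := by gcongr
      _ = _ := by
        rw [← mul_assoc]
        congr 2
        ring
  · intro E hE hEM
    obtain ⟨κE, hκE0, hκE1, hκE⟩ : ∃ κE : ℝ, 0 < κE ∧ κE < 1 ∧
        ∀ z ∈ E, ‖(z - 1) / (z + 1)‖ ≤ κE := by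
      rcases E.eq_empty_or_nonempty with rfl | hne
      · exact ⟨1 / 2, by norm_num, by norm_num, by simp⟩
      · have hcont : ContinuousOn (fun z : ℂ => ‖(z - 1) / (z + 1)‖) E := by
          refine ContinuousOn.norm (ContinuousOn.div (by fun_prop) (by fun_prop) ?_)
          intro z hz h0
          have := congrArg Complex.re h0
          have h1 := hMre z (hEM hz)
          simp at this
          linarith
        obtain ⟨u, huE, hu⟩ := hE.exists_isMaxOn hne hcont
        refine ⟨max (1 / 2) ‖(u - 1) / (u + 1)‖, lt_max_of_lt_left (by norm_num),
          max_lt (by norm_num) ?_, fun z hz => (hu hz).trans (le_max_right _ _)⟩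
        simpa using blaschke_le_one u (hMre u (hEM huE)) 1 one_pos
    set η := max κE (ρ / R) with hη
    have hη0 : 0 < η := lt_of_lt_of_le hr0 (le_max_right _ _)
    have hη1 : η < 1 := max_lt hκE1 hr1
    have hlogη := Real.log_neg hη0 hη1
    refine ⟨-(Real.log η) / 6, by linarith, ?_⟩
    have hsup : ∀ n : ℕ, ⨆ z : E, ‖f z - (p n).eval (z : ℂ) / (q n).eval (z : ℂ)‖ ≤
        (K₁ + K₂) * (η⁻¹ * Real.exp (Real.log η * (n / 3))) := by
      intro n
      refine Real.iSup_le ?_ (by positivity)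
      rintro ⟨z, hzE⟩
      have hz := hEM hzE
      obtain ⟨h0, h1, h2⟩ := hMz z hz
      refine (hpz n z h0 h1.le h2).trans ?_
      have hprod := nodeList_bound_compact n z (hMre z hz)
      have hprod0 := (list_prod_le_one (fun a : ℝ => ‖(z - a) / (z + a)‖) (nodeList n)
        (fun a _ => norm_nonneg _)
        (fun a ha => (blaschke_le_one z (hMre z hz) a (nodeList_pos n a ha)).le)).1
      set PB := ((nodeList n).map (fun a : ℝ => ‖(z - a) / (z + a)‖)).prod with hPB
      have hzs1 : ‖z‖ ^ (δ' / 2) ≤ 1 := Real.rpow_le_one h0.le (by linarith) (by linarith)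
      have hA : PB * ‖z‖ ^ (δ' / 2) ≤ η ^ (n / 3) := by
        calc _ ≤ PB := mul_le_of_le_one_right hprod0 hzs1
          _ ≤ _ := hprod
          _ ≤ η ^ (n / 3) :=
            pow_le_pow_left₀ (norm_nonneg _) ((hκE z hzE).trans (le_max_left _ _)) _
      have hB : (ρ / R) ^ (n / 3) ≤ η ^ (n / 3) := pow_le_pow_left₀ hr0.le (le_max_right _ _) _
      have hn : (n : ℝ) / 3 ≤ (n / 3 : ℕ) + 1 := by
        have : n ≤ 3 * (n / 3 + 1) := by omega
        have h' : (n : ℝ) ≤ 3 * ((n / 3 : ℕ) + 1) := by exact_mod_cast this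
        linarith
      have hfin := pow_bound η hη0 hη1 (n / 3) (n / 3) hn
      calc _ = K₁ * (PB * ‖z‖ ^ (δ' / 2)) + K₂ * (ρ / R) ^ (n / 3) := by ring
        _ ≤ K₁ * η ^ (n / 3) + K₂ * η ^ (n / 3) := by gcongr
        _ = (K₁ + K₂) * η ^ (n / 3) := by ring
        _ ≤ _ := by gcongr
    have hlim : Tendsto (fun n : ℕ => (K₁ + K₂) * η⁻¹ * Real.exp (Real.log η / 6 * n)) atTop
        (nhds 0) := by
      have h1 : Tendsto (fun n : ℕ => Real.log η / 6 * (n : ℝ)) atTop atBot :=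
        (tendsto_natCast_atTop_atTop).const_mul_atTop_of_neg (by linarith)
      simpa using (Real.tendsto_exp_atBot.comp h1).const_mul ((K₁ + K₂) * η⁻¹)
    refine squeeze_zero (fun n => ?_) (fun n => ?_) hlim
    · exact mul_nonneg (Real.exp_pos _).le (Real.iSup_nonneg fun z => norm_nonneg _)
    · calc _ ≤ Real.exp (-(Real.log η) / 6 * n) *
            ((K₁ + K₂) * (η⁻¹ * Real.exp (Real.log η * (n / 3)))) := by
            gcongr
            exact hsup n
        _ = (K₁ + K₂) * η⁻¹ *
            (Real.exp (-(Real.log η) / 6 * n) * Real.exp (Real.log η * (n / 3))) := by ring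
        _ = _ := by
            rw [← Real.exp_add]
            congr 2
            ring
end

section
/- For l > 0 let S_l := {x + iy : −2l ≤ x ≤ 0, |y| ≤ l} ⊂ ℂ. There exist constants C ≥ 1 and c > 0, and for every ε ∈ (0, 1) a constant c(ε) > 0, such that for every l > 0 and every n ≥ 1 there is a complex polynomial R_n of degree at most 3n with R_n(0) = 1 satisfying: (i) |R_n(z)| ≤ 1 for all z ∈ S_l; (ii) |R_n(z)| ≤ C for all z ∈ ℂ with dist(z, S_l) ≤ c·l/n; (iii) |R_n(z)| ≤ C·e^{−c(ε)·n} for all z ∈ S_l with dist(z, ∂S_l) ≥ ε·l. -/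
/-- The closed square `S_l = {x + iy : -2l ≤ x ≤ 0, |y| ≤ l}`. -/
def Sq (l : ℝ) : Set ℂ := {z : ℂ | -(2 * l) ≤ z.re ∧ z.re ≤ 0 ∧ |z.im| ≤ l}

/-- Key bound for `1 + t + t²` on the square of side `1/2`. -/
lemma key_bound (t : ℂ) (h1 : -(1/2) ≤ t.re) (h2 : t.re ≤ 0) (h3 : |t.im| ≤ 1/4) :
    ‖1 + t + t ^ 2‖ ≤ 1 + t.re / 2 := by
  have h4 : t.im ^ 2 ≤ 1 / 16 := by
    have := abs_le.mp h3
    nlinarith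
  have hn : ‖1 + t + t ^ 2‖ ^ 2 = (1 + t.re + (t.re ^ 2 - t.im ^ 2)) ^ 2
      + (t.im + 2 * t.re * t.im) ^ 2 := by
    rw [Complex.sq_norm, Complex.normSq_apply]
    simp [pow_two]
    ring
  have hw : 1 + t.re + t.re ^ 2 ≤ 1 + t.re / 2 := by nlinarith
  have hw0 : 0 ≤ 1 + t.re + t.re ^ 2 := by nlinarith
  refine le_trans (abs_le_of_sq_le_sq' ?_ hw0).2 hw
  rw [hn]
  have : 0 ≤ t.im ^ 2 * (1 - 2 * t.re * (1 + t.re) - t.im ^ 2) := by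
    apply mul_nonneg (sq_nonneg _)
    nlinarith
  nlinarith

lemma edge_mem (l y : ℝ) (hl : 0 < l) (hy : |y| ≤ l) :
    (⟨0, y⟩ : ℂ) ∈ frontier (Sq l) := by
  refine ⟨subset_closure ⟨by simp; linarith, by simp, by simpa using hy⟩, ?_⟩
  intro hi
  obtain ⟨δ, hδ, hb⟩ := Metric.isOpen_iff.mp isOpen_interior _ hi
  have hm : (⟨δ / 2, y⟩ : ℂ) ∈ Metric.ball (⟨0, y⟩ : ℂ) δ := by
    rw [Metric.mem_ball, Complex.dist_eq]
    have : (⟨δ / 2, y⟩ : ℂ) - ⟨0, y⟩ = ((δ / 2 : ℝ) : ℂ) := by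
      apply Complex.ext <;> simp
    rw [this, Complex.norm_real, Real.norm_eq_abs, abs_of_pos (by linarith)]
    linarith
  have := (interior_subset (hb hm)).2.1
  simp only at this
  linarith

lemma scaled (l : ℝ) (hl : 0 < l) (z : ℂ) (hz : z ∈ Sq l) :
    -(1/2) ≤ (z / ((4 * l : ℝ) : ℂ)).re ∧ (z / ((4 * l : ℝ) : ℂ)).re ≤ 0 ∧
      |(z / ((4 * l : ℝ) : ℂ)).im| ≤ 1/4 := by
  obtain ⟨h1, h2, h3⟩ := hz
  have h4 : (0:ℝ) < 4 * l := by linarith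
  rw [Complex.div_ofReal_re, Complex.div_ofReal_im, abs_div, abs_of_pos h4,
    le_div_iff₀ h4, div_le_iff₀ h4, div_le_iff₀ h4]
  refine ⟨by linarith, by linarith, by linarith⟩

theorem stmt_6 : ∃ (C c : ℝ) (cε : ℝ → ℝ), 1 ≤ C ∧ 0 < c ∧
    (∀ ε : ℝ, 0 < ε → ε < 1 → 0 < cε ε) ∧
    ∀ l : ℝ, 0 < l → ∀ n : ℕ, 1 ≤ n → ∃ R : Polynomial ℂ,
      R.natDegree ≤ 3 * n ∧ R.eval 0 = 1 ∧
      (∀ z ∈ Sq l, ‖R.eval z‖ ≤ 1) ∧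
      (∀ z : ℂ, Metric.infDist z (Sq l) ≤ c * l / n → ‖R.eval z‖ ≤ C) ∧
      (∀ ε : ℝ, 0 < ε → ε < 1 → ∀ z ∈ Sq l,
        ε * l ≤ Metric.infDist z (frontier (Sq l)) →
        ‖R.eval z‖ ≤ C * Real.exp (-(cε ε) * n)) := by
  refine ⟨3, 1 / 2, fun ε => ε / 8, by norm_num, by norm_num, fun ε h _ => by positivity, ?_⟩
  intro l hl n hn
  have hn0 : (0:ℝ) < n := by exact_mod_cast hn
  have hn1 : (1:ℝ) ≤ n := by exact_mod_cast hn
  set a : ℂ := ((4 * l : ℝ) : ℂ) with ha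
  have han : ‖a‖ = 4 * l := by
    rw [ha, Complex.norm_real, Real.norm_eq_abs, abs_of_pos (by linarith)]
  let q : Polynomial ℂ := Polynomial.C 1 + Polynomial.C a⁻¹ * Polynomial.X
    + Polynomial.C (a⁻¹ ^ 2) * Polynomial.X ^ 2
  have hq : ∀ z, (q ^ n).eval z = (1 + z / a + (z / a) ^ 2) ^ n := by
    intro z
    simp only [q, Polynomial.eval_pow, Polynomial.eval_add, Polynomial.eval_mul,
      Polynomial.eval_C, Polynomial.eval_X]
    congr 1
    ring
  have hqd : q.natDegree ≤ 2 := by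
    simp only [q]
    compute_degree
  refine ⟨q ^ n, ?_, ?_, ?_, ?_, ?_⟩
  · calc (q ^ n).natDegree ≤ n * q.natDegree := Polynomial.natDegree_pow_le
      _ ≤ n * 2 := Nat.mul_le_mul_left _ hqd
      _ ≤ 3 * n := by omega
  · rw [hq]; simp
  · intro z hz
    obtain ⟨h1, h2, h3⟩ := scaled l hl z hz
    rw [hq, norm_pow]
    exact pow_le_one₀ (norm_nonneg _) ((key_bound _ h1 h2 h3).trans (by linarith))
  · intro z hz
    have hne : (Sq l).Nonempty := ⟨0, by simp [Sq, hl.le]⟩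
    have hlt : Metric.infDist z (Sq l) < l / n := by
      refine lt_of_le_of_lt hz ?_
      exact div_lt_div_of_pos_right (by linarith) hn0
    obtain ⟨s, hs, hd⟩ := (Metric.infDist_lt_iff hne).mp hlt
    obtain ⟨h1, h2, h3⟩ := scaled l hl s hs
    have hk := key_bound _ h1 h2 h3
    rw [hq, norm_pow]
    set t : ℂ := s / a with ht
    set k : ℂ := (z - s) / a with hkdef
    have hzt : z / a = t + k := by rw [ht, hkdef]; ring
    have hkn : ‖k‖ ≤ 1 / (4 * n) := by
      rw [hkdef, norm_div, han, ← Complex.dist_eq]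
      rw [div_le_iff₀ (by linarith)]
      refine hd.le.trans (le_of_eq ?_)
      field_simp
    have hk1 : ‖k‖ ≤ 1 / 4 := by
      refine hkn.trans ?_
      apply one_div_le_one_div_of_le <;> linarith
    have htn : ‖t‖ ≤ 3 / 4 := by
      refine (Complex.norm_le_abs_re_add_abs_im t).trans ?_
      rw [abs_of_nonpos h2]
      linarith
    have hb : ‖1 + z / a + (z / a) ^ 2‖ ≤ 1 / n + 1 := by
      have e : 1 + z / a + (z / a) ^ 2 = (1 + t + t ^ 2) + k * (1 + 2 * t + k) := by
        rw [hzt]; ring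
      have e2 : ‖1 + 2 * t + k‖ ≤ 4 := by
        refine (norm_add₃_le).trans ?_
        rw [norm_mul]
        norm_num
        linarith
      have e3 : ‖k * (1 + 2 * t + k)‖ ≤ 1 / (4 * n) * 4 := by
        rw [norm_mul]
        exact mul_le_mul hkn e2 (norm_nonneg _) (by positivity)
      have e4 : 1 / (4 * (n:ℝ)) * 4 = 1 / n := by field_simp
      rw [e]
      refine (norm_add_le _ _).trans ?_
      linarith
    calc ‖1 + z / a + (z / a) ^ 2‖ ^ n ≤ (Real.exp (1 / n)) ^ n :=
          pow_le_pow_left₀ (norm_nonneg _) (hb.trans (Real.add_one_le_exp _)) _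
      _ = Real.exp 1 := by
          rw [← Real.exp_nat_mul]; congr 1; field_simp
      _ ≤ 3 := by linarith [Real.exp_one_lt_d9]
  · intro ε hε _ z hz hd
    obtain ⟨h1, h2, h3⟩ := scaled l hl z hz
    have hk := key_bound _ h1 h2 h3
    rw [hq, norm_pow]
    have hdist : ε * l ≤ -z.re := by
      refine (hd.trans (Metric.infDist_le_dist_of_mem (edge_mem l z.im hl hz.2.2))).trans ?_
      rw [Complex.dist_eq]
      have : z - ⟨0, z.im⟩ = ((z.re : ℝ) : ℂ) := by
        apply Complex.ext <;> simp
      rw [this, Complex.norm_real, Real.norm_eq_abs, abs_of_nonpos hz.2.1]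
    have hre : (z / a).re ≤ -ε / 4 := by
      rw [ha, Complex.div_ofReal_re, div_le_iff₀ (by linarith)]
      linarith
    have hb : ‖1 + z / a + (z / a) ^ 2‖ ≤ Real.exp (-(ε / 8)) := by
      refine le_trans ?_ (Real.add_one_le_exp _)
      linarith
    calc ‖1 + z / a + (z / a) ^ 2‖ ^ n ≤ (Real.exp (-(ε / 8))) ^ n :=
          pow_le_pow_left₀ (norm_nonneg _) hb _
      _ = Real.exp (-(ε / 8) * n) := by
          rw [← Real.exp_nat_mul]; congr 1; ring
      _ ≤ 3 * Real.exp (-(ε / 8) * n) := by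
          linarith [Real.exp_pos (-(ε / 8) * n)]
end

section
/- Let 1/2 < α < 1, β := 1 − α, let α̃ satisfy β < α̃ < α, and let R > 0 and K = K(α, R) be the bowtie set. Let V be a nonempty open set whose closure is contained in the interior of K, and let c > 0. Then there exist ε > 0, c' > 0, c'' > 0 and C₀ ≥ 1 (depending only on α, α̃, R, V, c) such that for every C > 0, every n ≥ 1, and every complex polynomial Q of degree at most n satisfying sup_{z∈K} |Q(z)| ≤ C and sup_{z∈closure(V)} |Q(z)| ≤ C·e^{−c n}, the inequality |Q(z)| ≤ C₀·C·exp(−c'·n·|z|^{1/α̃} + c''·n·|z|^{1/β}) holds for all z ∈ ℂ with |z| ≤ ε. -/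
open Complex Filter Topology Set in
lemma bt_three_circles (f : ℂ → ℂ) (hf : Differentiable ℂ f) (w0 : ℂ) (s t d κ : ℝ)
    (hs : 0 < s) (hst : s < t) (htd : t < d) (hκ : 0 ≤ κ)
    (h1 : ∀ z, ‖z - w0‖ ≤ s → ‖f z‖ ≤ Real.exp (-κ))
    (h2 : ∀ z, ‖z - w0‖ ≤ d → ‖f z‖ ≤ 1) (z : ℂ) (hz : ‖z - w0‖ ≤ t) :
    ‖f z‖ ≤ Real.exp (-(κ * (Real.log (d / t) / Real.log (d / s)))) := by
  have ht : 0 < t := hs.trans hst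
  have hd : 0 < d := ht.trans htd
  have hds : 0 < Real.log (d / s) := Real.log_pos (by rw [lt_div_iff₀ hs]; linarith)
  have hdt : 0 < Real.log (d / t) := Real.log_pos (by rw [lt_div_iff₀ ht]; linarith)
  have hle : Real.log (d / t) ≤ Real.log (d / s) := by
    apply Real.log_le_log (by positivity); gcongr
  by_cases hzs : ‖z - w0‖ ≤ s
  · refine (h1 z hzs).trans (Real.exp_le_exp.2 ?_)
    have : Real.log (d / t) / Real.log (d / s) ≤ 1 := (div_le_one hds).2 hle
    nlinarith
  push Not at hzs
  have hpos : 0 < ‖z - w0‖ := hs.trans hzs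
  have hne : z - w0 ≠ 0 := norm_pos_iff.1 hpos
  have hnorm : ∀ ζ : ℂ, ‖(w0 + exp ζ) - w0‖ = Real.exp ζ.re := by
    intro ζ; rw [add_sub_cancel_left, Complex.norm_exp]
  have hlogsd : Real.log s < Real.log d := Real.log_lt_log hs (hst.trans htd)
  have key := Complex.HadamardThreeLines.norm_le_interp_of_mem_verticalClosedStrip'
    (f := fun ζ => f (w0 + exp ζ)) (z := Complex.log (z - w0)) (a := Real.exp (-κ)) (b := 1)
    (l := Real.log s) (u := Real.log d) hlogsd
    (by
      simp only [HadamardThreeLines.verticalClosedStrip, mem_preimage, Complex.log_re, mem_Icc]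
      exact ⟨Real.log_le_log hs hzs.le, Real.log_le_log hpos (by linarith)⟩)
    (Differentiable.diffContOnCl (by fun_prop))
    (by
      refine ⟨1, ?_⟩
      rintro _ ⟨ζ, hζ, rfl⟩
      apply h2
      rw [hnorm]
      calc _ ≤ Real.exp (Real.log d) := Real.exp_le_exp.2 hζ.2
        _ = d := Real.exp_log hd)
    (by
      intro ζ hζ
      apply h1
      rw [hnorm, show ζ.re = Real.log s from hζ, Real.exp_log hs])
    (by
      intro ζ hζ
      apply h2
      rw [hnorm, show ζ.re = Real.log d from hζ, Real.exp_log hd])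
  simp only [Complex.exp_log hne, add_sub_cancel, Complex.log_re, Real.one_rpow, mul_one] at key
  refine key.trans ?_
  rw [← Real.exp_mul]
  apply Real.exp_le_exp.2
  rw [neg_mul, neg_le_neg_iff]
  apply mul_le_mul_of_nonneg_left _ hκ
  rw [Real.log_div hd.ne' ht.ne', Real.log_div hd.ne' hs.ne']
  have h3 : 0 < Real.log d - Real.log s := by linarith
  rw [one_sub_div h3.ne']
  gcongr ?_ / _
  have := Real.log_le_log hpos hz
  linarith

open Complex Filter Topology Set in
lemma bt_propagate (U W S : Set ℂ) (hU : IsOpen U) (hUc : IsPreconnected U) (hW : IsOpen W)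
    (hWU : (U ∩ W).Nonempty) (hS : IsCompact S) (hSU : S ⊆ U) (c : ℝ) (hc : 0 < c) :
    ∃ c' : ℝ, 0 < c' ∧ ∀ (g : ℂ → ℂ) (N : ℝ), Differentiable ℂ g → 0 ≤ N →
      (∀ w ∈ U, ‖g w‖ ≤ 1) → (∀ w ∈ W, ‖g w‖ ≤ Real.exp (-c * N)) →
      ∀ w ∈ S, ‖g w‖ ≤ Real.exp (-c' * N) := by
  let T : Set ℂ → Prop := fun A => ∃ c' : ℝ, 0 < c' ∧ ∀ (g : ℂ → ℂ) (N : ℝ), Differentiable ℂ g →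
      0 ≤ N → (∀ w ∈ U, ‖g w‖ ≤ 1) → (∀ w ∈ W, ‖g w‖ ≤ Real.exp (-c * N)) →
      ∀ w ∈ A, ‖g w‖ ≤ Real.exp (-c' * N)
  have Tmono : ∀ A B : Set ℂ, A ⊆ B → T B → T A := by
    rintro A B hAB ⟨c', h0, h⟩
    exact ⟨c', h0, fun g N h1 h2 h3 h4 w hw => h g N h1 h2 h3 h4 w (hAB hw)⟩
  let G : Set ℂ := {z | ∃ s > 0, T (Metric.closedBall z s)}
  have hGo : IsOpen G := by
    rw [Metric.isOpen_iff]
    rintro z ⟨s, hs, hT⟩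
    refine ⟨s / 2, by positivity, fun y hy => ⟨s / 2, by positivity, Tmono _ _ ?_ hT⟩⟩
    apply Metric.closedBall_subset_closedBall'
    rw [Metric.mem_ball] at hy
    linarith
  have hsub : U ⊆ G := by
    apply hUc.subset_of_closure_inter_subset hGo
    · obtain ⟨w, hwU, hwW⟩ := hWU
      refine ⟨w, hwU, ?_⟩
      obtain ⟨s, hs, h⟩ := Metric.isOpen_iff.1 hW w hwW
      refine ⟨s / 2, by positivity, c, hc, fun g N h1 h2 h3 h4 w hw => h4 w (h ?_)⟩
      exact Metric.closedBall_subset_ball (by linarith) hw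
    · rintro z ⟨hzG, hzU⟩
      obtain ⟨e, he, hball⟩ := Metric.isOpen_iff.1 hU z hzU
      obtain ⟨y, ⟨s, hs, c', hc', hT⟩, hzy⟩ := Metric.mem_closure_iff.1 hzG (e / 8) (by positivity)
      -- center y, radii
      set s' := min s (e / 8) with hs'
      have hs'0 : 0 < s' := lt_min hs (by positivity)
      have hs'1 : s' ≤ e / 8 := min_le_right _ _
      have hl1 : 0 < Real.log (e / 2 / (e / 4)) :=
        Real.log_pos (by rw [lt_div_iff₀ (by positivity)]; linarith)
      have hl2 : 0 < Real.log (e / 2 / s') :=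
        Real.log_pos (by rw [lt_div_iff₀ (by positivity)]; linarith)
      refine ⟨e / 8, by positivity, c' * (Real.log (e / 2 / (e / 4)) / Real.log (e / 2 / s')),
        by positivity, fun g N h1 h2 h3 h4 w hw => ?_⟩
      have := bt_three_circles g h1 y s' (e / 4) (e / 2) (c' * N) hs'0 (by linarith) (by linarith)
        (by positivity) (fun x hx => by
          rw [← neg_mul]
          apply hT g N h1 h2 h3 h4
          rw [Metric.mem_closedBall, dist_eq_norm]
          exact hx.trans (min_le_left _ _))
        (fun x hx => by
          apply h3; apply hball
          rw [Metric.mem_ball]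
          have h5 := dist_triangle x y z
          rw [dist_comm z y] at hzy
          rw [← dist_eq_norm] at hx
          linarith) w (by
          rw [← dist_eq_norm]
          have h5 := dist_triangle w z y
          rw [Metric.mem_closedBall] at hw
          linarith)
      refine this.trans (le_of_eq ?_)
      congr 1; ring
  change T S
  refine hS.induction_on (p := T) ⟨1, one_pos, by simp⟩ (fun A B hAB hB => Tmono A B hAB hB) ?_ ?_
  · rintro A B ⟨c1, h1, hA⟩ ⟨c2, h2, hB⟩
    refine ⟨min c1 c2, lt_min h1 h2, fun g N g1 g2 g3 g4 w hw => ?_⟩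
    rcases hw with hw | hw
    · refine (hA g N g1 g2 g3 g4 w hw).trans (Real.exp_le_exp.2 ?_)
      have := min_le_left c1 c2
      nlinarith
    · refine (hB g N g1 g2 g3 g4 w hw).trans (Real.exp_le_exp.2 ?_)
      have := min_le_right c1 c2
      nlinarith
  · intro x hx
    obtain ⟨s, hs, hT⟩ := hsub (hSU hx)
    exact ⟨Metric.closedBall x s, mem_nhdsWithin_of_mem_nhds (Metric.closedBall_mem_nhds x hs), hT⟩

open Complex Filter Topology Set in
lemma bt_halfstrip (F : ℂ → ℂ) (hF : Differentiable ℂ F) (l : ℂ) (hl : ‖l‖ ≤ 1)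
    (hlim : Tendsto F (comap re atBot) (𝓝 l)) (a b L : ℝ) (hab : a < b)
    (ha : ∀ w : ℂ, w.re ≤ L → w.im = a → ‖F w‖ ≤ 1)
    (hb : ∀ w : ℂ, w.re ≤ L → w.im = b → ‖F w‖ ≤ 1)
    (hL : ∀ w : ℂ, w.re = L → a ≤ w.im → w.im ≤ b → ‖F w‖ ≤ 1)
    (w : ℂ) (hw : w.re ≤ L) (hwa : a ≤ w.im) (hwb : w.im ≤ b) : ‖F w‖ ≤ 1 := by
  apply le_of_forall_pos_le_add
  intro δ hδ
  have hev : ∀ᶠ w in comap re atBot, ‖F w‖ < 1 + δ :=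
    hlim.norm.eventually (gt_mem_nhds (by linarith))
  rw [eventually_comap, eventually_atBot] at hev
  obtain ⟨T, hT⟩ := hev
  set T' := min T (min (w.re) L - 1) with hT'
  have hT1 : T' ≤ T := min_le_left _ _
  have hT2 : T' ≤ min w.re L - 1 := min_le_right _ _
  have h3 := min_le_left w.re L
  have h4 := min_le_right w.re L
  have hTL : T' < L := by linarith
  refine Complex.norm_le_of_forall_mem_frontier_norm_le (U := Ioo T' L ×ℂ Ioo a b)
    ((Metric.isBounded_Ioo _ _).reProdIm (Metric.isBounded_Ioo _ _)) hF.diffContOnCl ?_ ?_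
  · intro z hz
    rw [frontier_reProdIm, closure_Ioo hTL.ne, frontier_Ioo hab, closure_Ioo hab.ne,
      frontier_Ioo hTL] at hz
    rcases hz with ⟨hz1, hz2⟩ | ⟨hz1, hz2⟩
    · rcases hz2 with h | h
      · linarith [ha z hz1.2 h]
      · linarith [hb z hz1.2 h]
    · rcases hz1 with h | h
      · exact (hT T' hT1 z h).le
      · linarith [hL z h hz2.1 hz2.2]
  · rw [closure_reProdIm, closure_Ioo hTL.ne, closure_Ioo hab.ne]
    exact ⟨⟨by linarith, hw⟩, hwa, hwb⟩

open Complex Filter Topology Set in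
lemma bt_tendsto_exp (p : ℝ) (hp : 0 < p) (m : ℂ) :
    Tendsto (fun w : ℂ => exp (p * (w - m))) (comap re atBot) (𝓝 0) := by
  refine Complex.tendsto_exp_comap_re_atBot.comp ?_
  rw [tendsto_comap_iff]
  have : (re ∘ fun w : ℂ => (p : ℂ) * (w - m)) = (fun x : ℝ => p * (x - m.re)) ∘ re := by
    ext w; simp
  rw [this]
  refine Tendsto.comp ?_ tendsto_comap
  exact (tendsto_atBot_add_const_right _ _ tendsto_id).const_mul_atBot hp

open Complex Filter Topology Set in
lemma bt_stepA (f : ℂ → ℂ) (hf : Differentiable ℂ f) (N κ a L : ℝ) (hN : 0 ≤ N) (hκ : 0 ≤ κ)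
    (ha : 0 < a) (hf0 : ‖f 0‖ ≤ 1)
    (h1 : ∀ w : ℂ, w.re ≤ L → |w.im| ≤ a → ‖f (exp w)‖ ≤ 1)
    (h2 : ∀ w : ℂ, w.re = L → |w.im| ≤ a → ‖f (exp w)‖ ≤ Real.exp (-κ * N))
    (w : ℂ) (hw : w.re ≤ L) (hwa : |w.im| ≤ a) :
    ‖f (exp w)‖ ≤ Real.exp (-(κ * N *
      (Real.exp (Real.pi / (2 * a) * (w.re - L)) * Real.cos (Real.pi / (2 * a) * w.im)))) := by
  set p : ℝ := Real.pi / (2 * a) with hp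
  have hp0 : 0 < p := by have := Real.pi_pos; positivity
  have hpa : p * a = Real.pi / 2 := by rw [hp]; field_simp
  let F : ℂ → ℂ := fun w => f (exp w) * exp ((κ * N : ℝ) * exp (p * (w - (L : ℂ))))
  have hnorm : ∀ w : ℂ, ‖F w‖ = ‖f (exp w)‖ *
      Real.exp (κ * N * (Real.exp (p * (w.re - L)) * Real.cos (p * w.im))) := by
    intro w
    simp only [F, norm_mul, Complex.norm_exp, re_ofReal_mul, Complex.exp_re]
    simp
  have hlim : Tendsto F (comap re atBot) (𝓝 (f 0 * exp ((κ * N : ℝ) * 0))) := by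
    apply Tendsto.mul
    · exact (hf.continuous.tendsto 0).comp Complex.tendsto_exp_comap_re_atBot
    · exact (Complex.continuous_exp.tendsto _).comp ((bt_tendsto_exp p hp0 L).const_mul _)
  have hcos : ∀ y : ℝ, |y| = a → Real.cos (p * y) = 0 := by
    intro y hy
    rw [← Real.cos_abs, abs_mul, abs_of_pos hp0, hy, hpa, Real.cos_pi_div_two]
  have hside : ∀ w : ℂ, w.re ≤ L → |w.im| = a → ‖F w‖ ≤ 1 := by
    intro w hw hwa
    rw [hnorm, hcos _ hwa]
    simpa using h1 w hw hwa.le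
  have key := bt_halfstrip F (by fun_prop) _ (by simpa using hf0) hlim (-a) a L (by linarith)
    (fun w hw h => hside w hw (by rw [h, abs_neg, abs_of_pos ha]))
    (fun w hw h => hside w hw (by rw [h, abs_of_pos ha]))
    (fun w hw h h' => by
      rw [hnorm, hw]
      have h3 := h2 w hw (abs_le.2 ⟨h, h'⟩)
      have h4 := Real.cos_le_one (p * w.im)
      calc _ ≤ Real.exp (-κ * N) * Real.exp (κ * N * (Real.exp (p * (L - L)) * 1)) := by
            gcongr
        _ = 1 := by rw [← Real.exp_add]; simp)
    w hw (abs_le.1 hwa).1 (abs_le.1 hwa).2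
  rw [hnorm] at key
  rw [Real.exp_neg, ← one_div, le_div_iff₀ (Real.exp_pos _)]
  exact key

open Complex Filter Topology Set in
lemma bt_stepB (f : ℂ → ℂ) (hf : Differentiable ℂ f) (N k p q b L M A : ℝ) (hN : 0 ≤ N)
    (hk : 0 ≤ k) (hp : 0 < p) (hq : 0 < q) (hb : b < Real.pi / 2)
    (hqb : q * (Real.pi / 2 - b) < Real.pi / 2)
    (hA0 : 0 ≤ A)
    (hA : M + k * Real.exp (p * L) ≤ A * (Real.exp (q * L) * Real.cos (q * (Real.pi / 2 - b))))
    (hf0 : ‖f 0‖ ≤ 1)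
    (h1 : ∀ w : ℂ, w.re ≤ L → w.im = b → ‖f (exp w)‖ ≤ Real.exp (-(k * N * Real.exp (p * w.re))))
    (h2 : ∀ w : ℂ, w.re ≤ L → w.im = Real.pi - b → ‖f (exp w)‖ ≤ 1)
    (h3 : ∀ w : ℂ, w.re = L → ‖f (exp w)‖ ≤ Real.exp (M * N))
    (w : ℂ) (hw : w.re ≤ L) (hwa : b ≤ w.im) (hwb : w.im ≤ Real.pi - b) :
    ‖f (exp w)‖ ≤ Real.exp (N * (A * (Real.exp (q * w.re) * Real.cos (q * (w.im - Real.pi / 2)))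
      - k * (Real.exp (p * w.re) * Real.sin (p * (Real.pi - b - w.im))))) := by
  have hpi := Real.pi_pos
  let F : ℂ → ℂ := fun w => f (exp w) * exp ((-(N * A) : ℝ) * exp (q * (w - (Real.pi / 2 : ℝ) * I)) +
    (N * k : ℝ) * (I * exp (p * (w - (Real.pi - b : ℝ) * I))))
  have hnorm : ∀ w : ℂ, ‖F w‖ = ‖f (exp w)‖ *
      Real.exp (-(N * (A * (Real.exp (q * w.re) * Real.cos (q * (w.im - Real.pi / 2)))
      - k * (Real.exp (p * w.re) * Real.sin (p * (Real.pi - b - w.im)))))) := by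
    intro w
    simp only [F, norm_mul, Complex.norm_exp, add_re, re_ofReal_mul, I_mul_re, Complex.exp_re,
      Complex.exp_im, im_ofReal_mul, sub_re, sub_im]
    have : Real.sin (p * (Real.pi - b - w.im)) = - Real.sin (p * (w.im - (Real.pi - b))) := by
      rw [← Real.sin_neg]; ring_nf
    rw [this]
    congr 2
    simp only [I_re, I_im, mul_zero, mul_one, sub_zero]
    ring
  have hlim : Tendsto F (comap re atBot)
      (𝓝 (f 0 * exp ((-(N * A) : ℝ) * 0 + (N * k : ℝ) * (I * 0)))) := by
    apply Tendsto.mul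
    · exact (hf.continuous.tendsto 0).comp Complex.tendsto_exp_comap_re_atBot
    · exact (Complex.continuous_exp.tendsto _).comp (((bt_tendsto_exp q hq _).const_mul _).add
        (((bt_tendsto_exp p hp _).const_mul _).const_mul _))
  have hcos : ∀ y : ℝ, b ≤ y → y ≤ Real.pi - b →
      Real.cos (q * (Real.pi / 2 - b)) ≤ Real.cos (q * (y - Real.pi / 2)) := by
    intro y hy hy'
    rw [← Real.cos_abs (q * (y - _)), abs_mul, abs_of_pos hq]
    apply Real.cos_le_cos_of_nonneg_of_le_pi (by positivity) (by nlinarith)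
    gcongr
    rw [abs_le]; constructor <;> linarith
  have hcos0 : 0 < Real.cos (q * (Real.pi / 2 - b)) := by
    apply Real.cos_pos_of_mem_Ioo
    have : 0 < q * (Real.pi / 2 - b) := mul_pos hq (by linarith)
    constructor <;> linarith
  have key := bt_halfstrip F (by fun_prop) _ (by simpa using hf0) hlim b (Real.pi - b) L
    (by linarith)
    (fun w hw h => by
      rw [hnorm]
      have h4 := h1 w hw h
      have h5 := Real.sin_le_one (p * (Real.pi - b - w.im))
      have h6 := hcos w.im (by linarith) (by linarith)
      calc _ ≤ Real.exp (-(k * N * Real.exp (p * w.re))) *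
              Real.exp (-(N * (A * (Real.exp (q * w.re) * 0) - k * (Real.exp (p * w.re) * 1)))) := by
            gcongr
            exact hcos0.le.trans h6
        _ = 1 := by rw [← Real.exp_add]; simp; ring)
    (fun w hw h => by
      rw [hnorm]
      have h4 := h2 w hw h
      have h6 := hcos w.im (by linarith) (by linarith)
      rw [show Real.pi - b - w.im = 0 by linarith]
      calc _ ≤ 1 * Real.exp (-(N * (A * (Real.exp (q * w.re) * 0) - k * (Real.exp (p * w.re) * Real.sin (p * 0))))) := by
            gcongr
            exact hcos0.le.trans h6
        _ = 1 := by simp)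
    (fun w hw h h' => by
      rw [hnorm]
      have h4 := h3 w hw
      have h5 := Real.sin_le_one (p * (Real.pi - b - w.im))
      have h6 := hcos w.im (by linarith) (by linarith)
      rw [hw]
      calc _ ≤ Real.exp (M * N) *
              Real.exp (-(N * (A * (Real.exp (q * L) * Real.cos (q * (Real.pi / 2 - b))) - k * (Real.exp (p * L) * 1)))) := by
            gcongr
        _ ≤ 1 := by
            rw [← Real.exp_add, Real.exp_le_one_iff]
            nlinarith)
    w hw hwa hwb
  rw [hnorm, Real.exp_neg] at key
  rwa [← div_eq_mul_inv, div_le_one (Real.exp_pos _)] at key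

open Complex Filter Topology Set in
lemma bt_gap (k p q b ϑ L M : ℝ) (hk : 0 < k) (hp : 0 < p) (hpq : p < q) (hbϑ : b < ϑ)
    (hϑ : ϑ < Real.pi / 2) (hqb : q * (Real.pi / 2 - b) < Real.pi / 2) :
    ∃ L' : ℝ, L' ≤ L ∧ ∀ (f : ℂ → ℂ) (N : ℝ), Differentiable ℂ f → 0 ≤ N → ‖f 0‖ ≤ 1 →
    (∀ w : ℂ, w.re ≤ L → w.im = b → ‖f (exp w)‖ ≤ Real.exp (-(k * N * Real.exp (p * w.re)))) →
    (∀ w : ℂ, w.re ≤ L → w.im = Real.pi - b → ‖f (exp w)‖ ≤ 1) →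
    (∀ w : ℂ, w.re = L → ‖f (exp w)‖ ≤ Real.exp (M * N)) →
    ∀ w : ℂ, w.re ≤ L' → ϑ ≤ w.im → w.im ≤ Real.pi - ϑ → ‖f (exp w)‖ ≤ 1 := by
  have hpi := Real.pi_pos
  have hq : 0 < q := hp.trans hpq
  have hcos0 : 0 < Real.cos (q * (Real.pi / 2 - b)) := by
    apply Real.cos_pos_of_mem_Ioo
    have : 0 < q * (Real.pi / 2 - b) := mul_pos hq (by linarith)
    constructor <;> linarith
  set D := Real.exp (q * L) * Real.cos (q * (Real.pi / 2 - b)) with hD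
  have hD0 : 0 < D := by positivity
  set A := (|M| + k * Real.exp (p * L)) / D with hAdef
  have hA0 : 0 < A := by positivity
  have hA : M + k * Real.exp (p * L) ≤ A * D := by
    rw [hAdef, div_mul_cancel₀ _ hD0.ne']
    linarith [le_abs_self M]
  obtain ⟨y0, hy0, hmin⟩ := (isCompact_Icc (a := ϑ) (b := Real.pi - ϑ)).exists_isMinOn
    ⟨ϑ, le_refl _, by linarith⟩
    (f := fun y => Real.sin (p * (Real.pi - b - y))) (by fun_prop)
  set σ := Real.sin (p * (Real.pi - b - y0)) with hσ
  have hσ0 : 0 < σ := by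
    apply Real.sin_pos_of_pos_of_lt_pi
    · apply mul_pos hp; linarith [hy0.2]
    · have := hy0.1
      calc p * (Real.pi - b - y0) ≤ p * (Real.pi - 2 * b) := by apply mul_le_mul_of_nonneg_left _ hp.le; linarith
        _ ≤ q * (Real.pi - 2 * b) := by gcongr; linarith
        _ < Real.pi := by linarith
  have hqp : 0 < q - p := by linarith
  refine ⟨min L (Real.log (k * σ / A) / (q - p)), min_le_left _ _, ?_⟩
  intro f N hf hN hf0 h1 h2 h3 w hw hw1 hw2
  refine (bt_stepB f hf N k p q b L M A hN hk.le hp hq (by linarith) hqb hA0.le hA hf0 h1 h2 h3 w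
    (hw.trans (min_le_left _ _)) (by linarith) (by linarith)).trans ?_
  rw [Real.exp_le_one_iff]
  apply mul_nonpos_of_nonneg_of_nonpos hN
  have h5 : σ ≤ Real.sin (p * (Real.pi - b - w.im)) := hmin (show w.im ∈ Icc _ _ from ⟨hw1, hw2⟩)
  have h6 : (q - p) * w.re ≤ Real.log (k * σ / A) := by
    have := hw.trans (min_le_right _ _)
    rw [le_div_iff₀ hqp] at this
    linarith
  have h7 : Real.exp ((q - p) * w.re) ≤ k * σ / A := by
    rw [← Real.exp_log (show 0 < k * σ / A by positivity)]
    exact Real.exp_le_exp.2 h6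
  rw [le_div_iff₀ hA0] at h7
  have h8 : Real.exp (q * w.re) = Real.exp ((q - p) * w.re) * Real.exp (p * w.re) := by
    rw [← Real.exp_add]; ring_nf
  have h9 := Real.cos_le_one (q * (w.im - Real.pi / 2))
  rw [sub_nonpos]
  calc A * (Real.exp (q * w.re) * Real.cos (q * (w.im - Real.pi / 2)))
      ≤ A * (Real.exp (q * w.re) * 1) := by gcongr
    _ = (Real.exp ((q - p) * w.re) * A) * Real.exp (p * w.re) := by rw [h8]; ring
    _ ≤ (k * σ) * Real.exp (p * w.re) := by gcongr
    _ = k * (Real.exp (p * w.re) * σ) := by ring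
    _ ≤ _ := by gcongr

open Complex Filter Topology Set in
lemma bt_stepC (k p b L ρ : ℝ) (hk : 0 < k) (hp : 0 < p) (hb : 0 < b) (hρ : 0 < ρ) :
    ∃ ε c' : ℝ, 0 < ε ∧ 0 < c' ∧ ∀ (f : ℂ → ℂ) (N : ℝ), Differentiable ℂ f → 0 ≤ N →
    (∀ z : ℂ, ‖z‖ ≤ ρ → ‖f z‖ ≤ 1) →
    (∀ w : ℂ, w.re ≤ L → |w.im| ≤ b → ‖f (exp w)‖ ≤ Real.exp (-(k * N * Real.exp (p * w.re)))) →
    ∀ z : ℂ, ‖z‖ ≤ ε → ‖f z‖ ≤ Real.exp (-(c' * N * ‖z‖ ^ p)) := by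
  have hcont : ContinuousAt Complex.log 1 := continuousAt_clog (by simp)
  obtain ⟨s0, hs0, hlog⟩ := Metric.continuousAt_iff.1 hcont (min b 1) (lt_min hb one_pos)
  simp only [Complex.log_one, dist_zero_right] at hlog
  set s := min (s0 / 2) (1 / 2) with hs
  have hspos : 0 < s := by positivity
  have hs1 : s ≤ s0 / 2 := min_le_left _ _
  have hs2 : s ≤ 1 / 2 := min_le_right _ _
  have hl2 : 0 < Real.log 2 := Real.log_pos (by norm_num)
  have hl4 : 0 < Real.log (4 / s) := Real.log_pos (by rw [lt_div_iff₀ hspos]; linarith)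
  refine ⟨min (ρ / 5) (Real.exp (L - 1)), k * Real.exp (-p) * (Real.log 2 / Real.log (4 / s)),
    by positivity, by positivity, ?_⟩
  intro f N hf hN h1 h2 z hz
  have hz1 := hz.trans (min_le_left _ _)
  have hz2 := hz.trans (min_le_right _ _)
  rcases eq_or_ne z 0 with rfl | hz0
  · simp only [norm_zero, Real.zero_rpow hp.ne', mul_zero, neg_zero, Real.exp_zero]
    exact h1 0 (by simpa using hρ.le)
  set r := ‖z‖ with hr
  have hrpos : 0 < r := norm_pos_iff.2 hz0
  have hrc : (r : ℂ) ≠ 0 := by exact_mod_cast hrpos.ne'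
  have hrn : ‖(r : ℂ)‖ = r := by rw [Complex.norm_real, Real.norm_of_nonneg hrpos.le]
  have key := bt_three_circles f hf (r : ℂ) (s * r) (2 * r) (4 * r) (k * N * (r ^ p * Real.exp (-p)))
    (by positivity) (by nlinarith) (by nlinarith) (by positivity)
    (by
      intro x hx
      have hu : ‖x / r - 1‖ ≤ s := by
        rw [div_sub_one hrc, norm_div, hrn, div_le_iff₀ hrpos]; exact hx
      have hu0 : x / r ≠ 0 := by
        intro h0
        rw [h0] at hu; norm_num at hu; linarith
      have hl := hlog (x := x / r) (by rw [dist_eq_norm]; linarith)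
      have hlb := hl.trans_le (min_le_left _ _)
      have hl1 := hl.trans_le (min_le_right _ _)
      have hre := (abs_le.1 (Complex.abs_re_le_norm (Complex.log (x / r))))
      have him := Complex.abs_im_le_norm (Complex.log (x / r))
      have hw : exp (Complex.log (x / r) + (Real.log r : ℝ)) = x := by
        rw [Complex.exp_add, Complex.exp_log hu0, ← Complex.ofReal_exp, Real.exp_log hrpos,
          div_mul_cancel₀ _ hrc]
      have hlr : Real.log r ≤ L - 1 := by
        rw [← Real.log_exp (L - 1)]; exact Real.log_le_log hrpos hz2
      have := h2 (Complex.log (x / r) + (Real.log r : ℝ))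
        (by rw [Complex.add_re, Complex.ofReal_re]; linarith)
        (by rw [Complex.add_im, Complex.ofReal_im, add_zero]; linarith)
      rw [hw] at this
      refine this.trans (Real.exp_le_exp.2 (neg_le_neg ?_))
      gcongr
      rw [Real.rpow_def_of_pos hrpos, ← Real.exp_add]
      apply Real.exp_le_exp.2
      rw [Complex.add_re, Complex.ofReal_re]
      nlinarith)
    (by
      intro x hx
      apply h1
      have : ‖x‖ ≤ ‖x - r‖ + ‖(r : ℂ)‖ := by simpa using norm_add_le (x - r) (r : ℂ)
      rw [hrn] at this
      linarith)
    z (by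
      have := norm_sub_le z (r : ℂ)
      rw [hrn] at this
      linarith)
  refine key.trans (le_of_eq ?_)
  congr 2
  rw [show 4 * r / (2 * r) = 2 by field_simp; norm_num, show 4 * r / (s * r) = 4 / s by field_simp]
  ring

open Polynomial in
lemma bt_bernstein (Q : Polynomial ℂ) (n : ℕ) (hQ : Q.natDegree ≤ n) (a : ℂ) (s : ℝ) (hs : 0 < s)
    (h : ∀ z, ‖z - a‖ ≤ s → ‖Q.eval z‖ ≤ 1) (z : ℂ) (hz : s ≤ ‖z - a‖) :
    ‖Q.eval z‖ ≤ (‖z - a‖ / s) ^ n := by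
  set P := taylor a Q with hP
  have hPd : P.natDegree ≤ n := by rw [hP, natDegree_taylor]; exact hQ
  have hPe : ∀ x, P.eval x = Q.eval (x + a) := fun x => taylor_eval a Q x
  set G := reflect n P with hG
  have hGe : ∀ x : ℂ, x ≠ 0 → G.eval x⁻¹ * x ^ n = P.eval x := by
    intro x hx
    let _ := invertibleOfNonzero hx
    have := eval₂_reflect_mul_pow (RingHom.id ℂ) x n P hPd
    rw [invOf_eq_inv] at this
    simpa [eval₂_eq_eval_map] using this
  have hGb : ∀ y : ℂ, ‖y‖ ≤ s⁻¹ → ‖G.eval y‖ ≤ s⁻¹ ^ n := by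
    intro y hy
    refine Complex.norm_le_of_forall_mem_frontier_norm_le (U := Metric.ball (0 : ℂ) s⁻¹)
      (f := fun y => G.eval y) Metric.isBounded_ball (Differentiable.diffContOnCl G.differentiable)
      ?_ ?_
    · intro x hx
      rw [frontier_ball _ (by positivity)] at hx
      have hx' : ‖x‖ = s⁻¹ := by simpa using hx
      have hx0 : x ≠ 0 := by rw [← norm_pos_iff, hx']; positivity
      have h1 := hGe x⁻¹ (inv_ne_zero hx0)
      rw [inv_inv] at h1
      have h2 : G.eval x = P.eval x⁻¹ * x ^ n := by
        rw [← h1, mul_assoc, ← mul_pow, inv_mul_cancel₀ hx0, one_pow, mul_one]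
      rw [h2, norm_mul, norm_pow, hx', hPe]
      have := h (x⁻¹ + a) (by rw [add_sub_cancel_right, norm_inv, hx', inv_inv])
      calc _ ≤ 1 * s⁻¹ ^ n := by gcongr
        _ = _ := one_mul _
    · rw [closure_ball _ (by positivity)]
      simpa using hy
  have hne : z - a ≠ 0 := by rw [← norm_pos_iff]; linarith
  have h3 := hGe (z - a) hne
  rw [hPe, sub_add_cancel] at h3
  rw [← h3, norm_mul, norm_pow, div_eq_mul_inv, mul_pow, mul_comm]
  gcongr
  apply hGb
  rw [norm_inv]
  gcongr

open Complex Filter Topology Set in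
lemma bt_core (ϑ a L0 M c : ℝ) (ha : Real.pi / 4 < a) (haϑ : a < ϑ) (hϑ : ϑ < Real.pi / 2)
    (w0 : ℂ) (hw0 : w0.re < L0) (hw0' : |w0.im| < ϑ) (W : Set ℂ) (hW : IsOpen W) (hw0W : w0 ∈ W)
    (hc : 0 < c) :
    ∃ ε c' : ℝ, 0 < ε ∧ 0 < c' ∧ ∀ (f : ℂ → ℂ) (N : ℝ), Differentiable ℂ f → 0 ≤ N →
    ‖f 0‖ ≤ 1 →
    (∀ w : ℂ, w.re ≤ L0 → |w.im| ≤ ϑ → ‖f (exp w)‖ ≤ 1) →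
    (∀ w : ℂ, w.re ≤ L0 → |w.im - Real.pi| ≤ ϑ → ‖f (exp w)‖ ≤ 1) →
    (∀ w : ℂ, w.re ≤ L0 → ‖f (exp w)‖ ≤ Real.exp (M * N)) →
    (∀ w ∈ W, ‖f (exp w)‖ ≤ Real.exp (-c * N)) →
    ∀ z : ℂ, ‖z‖ ≤ ε → ‖f z‖ ≤ Real.exp (-(c' * N * ‖z‖ ^ (Real.pi / (2 * a)))) := by
  have hpi := Real.pi_pos
  have ha0 : 0 < a := by linarith
  set L := L0 - 1 with hLdef
  obtain ⟨κ, hκ, hprop⟩ := bt_propagate (Iio L0 ×ℂ Ioo (-ϑ) ϑ) W ({L} ×ℂ Icc (-a) a)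
    (isOpen_Iio.reProdIm isOpen_Ioo)
    (Convex.isPreconnected (Convex.inter
      ((convex_Iio (𝕜 := ℝ) L0).linear_preimage Complex.reLm)
      ((convex_Ioo (𝕜 := ℝ) (-ϑ) ϑ).linear_preimage Complex.imLm))) hW
    ⟨w0, ⟨hw0, abs_lt.1 hw0'⟩, hw0W⟩ (isCompact_singleton.reProdIm isCompact_Icc)
    (by
      rintro w ⟨h1, h2⟩
      have h1' : w.re = L := h1
      exact ⟨by rw [mem_preimage, h1', mem_Iio]; linarith, by
        have := h2.1; have := h2.2; constructor <;> linarith⟩) c hc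
  set p := Real.pi / (2 * a) with hp
  have hp0 : 0 < p := by positivity
  have hpa : p * a = Real.pi / 2 := by rw [hp]; field_simp
  set b := (Real.pi / 4 + a) / 2 with hb
  have hb1 : Real.pi / 4 < b := by linarith
  have hb2 : b < a := by linarith
  have hcosb : 0 < Real.cos (p * b) := by
    apply Real.cos_pos_of_mem_Ioo
    have : 0 < p * b := mul_pos hp0 (by linarith)
    constructor
    · linarith
    · nlinarith
  set k := κ * (Real.exp (-(p * L)) * Real.cos (p * b)) with hk
  have hk0 : 0 < k := by positivity
  have hπb : 0 < Real.pi / 2 - b := by linarith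
  have hpb : p < Real.pi / 2 / (Real.pi / 2 - b) := by
    rw [lt_div_iff₀ hπb, ← hpa]
    apply mul_lt_mul_of_pos_left _ hp0
    linarith
  obtain ⟨q, hpq, hq⟩ := exists_between hpb
  rw [lt_div_iff₀ hπb] at hq
  obtain ⟨L', hL', hgap⟩ := bt_gap k p q b ϑ L M hk0 hp0 hpq (by linarith) hϑ hq
  obtain ⟨ε, c', hε, hc', hC⟩ := bt_stepC k p b L (Real.exp L') hk0 hp0 (by linarith)
    (Real.exp_pos _)
  refine ⟨ε, c', hε, hc', ?_⟩
  -- step A for an arbitrary admissible function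
  have hA : ∀ (f : ℂ → ℂ) (N : ℝ), Differentiable ℂ f → 0 ≤ N → ‖f 0‖ ≤ 1 →
      (∀ w : ℂ, w.re ≤ L0 → |w.im| ≤ ϑ → ‖f (exp w)‖ ≤ 1) →
      (∀ w ∈ W, ‖f (exp w)‖ ≤ Real.exp (-c * N)) →
      ∀ w : ℂ, w.re ≤ L → |w.im| ≤ b →
        ‖f (exp w)‖ ≤ Real.exp (-(k * N * Real.exp (p * w.re))) := by
    intro f N hf hN hf0 h1 h4 w hw hwb
    have hS := hprop (fun w => f (exp w)) N (by fun_prop) hN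
      (fun w hw => h1 w (le_of_lt hw.1) (abs_le.2 ⟨hw.2.1.le, hw.2.2.le⟩)) h4
    refine (bt_stepA f hf N κ a L hN hκ.le ha0 hf0 (fun w h h' => h1 w (by linarith) (by linarith))
      (fun w h h' => hS w ⟨h, abs_le.1 h'⟩) w hw (by linarith)).trans ?_
    apply Real.exp_le_exp.2 (neg_le_neg _)
    have hcos : Real.cos (p * b) ≤ Real.cos (p * w.im) := by
      rw [← Real.cos_abs (p * w.im), abs_mul, abs_of_pos hp0]
      apply Real.cos_le_cos_of_nonneg_of_le_pi (by positivity) (by nlinarith)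
      gcongr
    calc k * N * Real.exp (p * w.re)
        = κ * N * ((Real.exp (-(p * L)) * Real.exp (p * w.re)) * Real.cos (p * b)) := by
          rw [hk]; ring
      _ = κ * N * (Real.exp (p * (w.re - L)) * Real.cos (p * b)) := by
          rw [← Real.exp_add]; ring_nf
      _ ≤ _ := by gcongr
  intro f N hf hN hf0 h1 h2 h3 h4
  have hAf := hA f N hf hN hf0 h1 h4
  apply hC f N hf hN _ hAf
  intro z hz
  rcases eq_or_ne z 0 with rfl | hz0
  · exact hf0
  have hup := hgap f N hf hN hf0
    (fun w hw h => hAf w hw (by rw [h, abs_of_pos (by linarith)]))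
    (fun w hw h => h2 w (by linarith) (by rw [h, abs_le]; constructor <;> linarith))
    (fun w hw => h3 w (by linarith))
  have hlow := hgap (starRingEnd ℂ ∘ f ∘ starRingEnd ℂ) N
    (fun x => by
      have := DifferentiableAt.conj_conj (hf (starRingEnd ℂ x))
      rwa [Complex.conj_conj] at this) hN (by simpa using hf0)
    (fun w hw h => by
      have := hAf ((starRingEnd ℂ) w) (by simpa using hw) (by
        rw [Complex.conj_im, abs_neg, h, abs_of_pos (by linarith)])
      rw [Complex.conj_re] at this
      simpa [← Complex.exp_conj] using this)
    (fun w hw h => by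
      have := h2 ((starRingEnd ℂ) w + 2 * Real.pi * I) (by simp; linarith) (by
        simp only [Complex.add_im, Complex.conj_im, h]
        simp
        rw [abs_le]; constructor <;> linarith)
      rw [Complex.exp_periodic] at this
      simpa [← Complex.exp_conj] using this)
    (fun w hw => by
      have := h3 ((starRingEnd ℂ) w) (by simp; linarith)
      simpa [← Complex.exp_conj] using this)
  set w := Complex.log z with hw
  have hwz : exp w = z := Complex.exp_log hz0
  have hre : w.re ≤ L' := by
    rw [hw, Complex.log_re, ← Real.log_exp L']
    exact Real.log_le_log (norm_pos_iff.2 hz0) hz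
  have him1 : -Real.pi < w.im := Complex.neg_pi_lt_log_im z
  have him2 : w.im ≤ Real.pi := Complex.log_im_le_pi z
  rw [← hwz]
  rcases le_or_gt (|w.im|) ϑ with hA1 | hA1
  · exact h1 w (by linarith) hA1
  rcases le_or_gt 0 w.im with h0 | h0
  · rw [abs_of_nonneg h0] at hA1
    rcases le_or_gt w.im (Real.pi - ϑ) with hA2 | hA2
    · exact hup w hre hA1.le hA2
    · exact h2 w (by linarith) (by rw [abs_le]; constructor <;> linarith)
  · rw [abs_of_neg h0] at hA1
    rcases le_or_gt (-w.im) (Real.pi - ϑ) with hA2 | hA2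
    · have := hlow ((starRingEnd ℂ) w) (by simpa using hre) (by simpa using hA1.le)
        (by simpa using hA2)
      simpa [← Complex.exp_conj] using this
    · have := h2 (w + 2 * Real.pi * I) (by simp; linarith) (by
        simp only [Complex.add_im]
        simp
        rw [abs_le]; constructor <;> linarith)
      rwa [Complex.exp_periodic] at this

open Complex Filter Topology Set in
lemma bt_mem_bowtie (α R : ℝ) (hR : 0 < R) (w : ℂ) (hw : w.re ≤ Real.log R)
    (h : |w.im| ≤ α * Real.pi / 2 ∨ |w.im - Real.pi| ≤ α * Real.pi / 2) :
    exp w ∈ bowtie α R := by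
  refine ⟨Real.exp w.re, w.im, (Real.exp_pos _).le, ?_, h, ?_⟩
  · rw [← Real.exp_log hR]; exact Real.exp_le_exp.2 hw
  · rw [Complex.ofReal_exp, ← Complex.exp_add, Complex.re_add_im]

open Complex Filter Topology Set in
lemma bt_neg_bowtie (α R : ℝ) (z : ℂ) (hz : z ∈ bowtie α R) : -z ∈ bowtie α R := by
  obtain ⟨r, θ, h0, h1, h2, rfl⟩ := hz
  rcases h2 with h2 | h2
  · refine ⟨r, θ + Real.pi, h0, h1, Or.inr (by simpa using h2), ?_⟩
    push_cast
    rw [add_mul, Complex.exp_add, Complex.exp_pi_mul_I]; ring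
  · refine ⟨r, θ - Real.pi, h0, h1, Or.inl h2, ?_⟩
    push_cast
    rw [sub_mul, Complex.exp_sub, Complex.exp_pi_mul_I]; ring

/-- The main estimate when the set of smallness meets the right open sector. -/
lemma bt_right (α R αt : ℝ) (hα1 : 1 / 2 < α) (hα2 : α < 1)
    (hαt1 : 1 - α < αt) (hαt2 : αt < α) (hR : 0 < R)
    (V : Set ℂ) (hVopen : IsOpen V) (c : ℝ) (hc : 0 < c)
    (w0 : ℂ) (hw0 : w0.re < Real.log R) (hw0' : |w0.im| < α * Real.pi / 2)
    (hwV : Complex.exp w0 ∈ V) :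
    ∃ ε c' : ℝ, 0 < ε ∧ 0 < c' ∧
      ∀ n : ℕ, ∀ Q : Polynomial ℂ, Q.natDegree ≤ n →
        (∀ z ∈ bowtie α R, ‖Q.eval z‖ ≤ 1) →
        (∀ z ∈ V, ‖Q.eval z‖ ≤ Real.exp (-c * n)) →
        ∀ z : ℂ, ‖z‖ ≤ ε → ‖Q.eval z‖ ≤ Real.exp (-c' * n * ‖z‖ ^ ((1 : ℝ) / αt)) := by
  have hpi := Real.pi_pos
  have hαt0 : 0 < αt := by linarith
  obtain ⟨α', h1, h2⟩ := exists_between (max_lt hα1 hαt2)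
  have h3 : 1 / 2 < α' := (le_max_left _ _).trans_lt h1
  have h4 : αt < α' := (le_max_right _ _).trans_lt h1
  -- a disc in the bowtie
  have hopen : IsOpen (Complex.exp '' (Set.Iio (Real.log R) ×ℂ Set.Ioo (-(α * Real.pi / 2)) (α * Real.pi / 2))) :=
    Complex.isOpenMap_exp _ (isOpen_Iio.reProdIm isOpen_Ioo)
  obtain ⟨s, hs, hball⟩ := Metric.isOpen_iff.1 hopen (Complex.exp w0)
    ⟨w0, ⟨hw0, abs_lt.1 hw0'⟩, rfl⟩
  have hdisc : ∀ z, ‖z - Complex.exp w0‖ ≤ s / 2 → z ∈ bowtie α R := by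
    intro z hz
    obtain ⟨w, ⟨hw1, hw2⟩, rfl⟩ := hball (show z ∈ Metric.ball _ s by
      rw [Metric.mem_ball, dist_eq_norm]; linarith)
    exact bt_mem_bowtie α R hR w (le_of_lt hw1) (Or.inl (abs_le.2 ⟨hw2.1.le, hw2.2.le⟩))
  set D : ℝ := max 1 (2 * R / (s / 2)) with hD
  have hD1 : 1 ≤ D := le_max_left _ _
  have hw0R : ‖Complex.exp w0‖ ≤ R := by
    rw [Complex.norm_exp, ← Real.exp_log hR]
    exact Real.exp_le_exp.2 hw0.le
  obtain ⟨ε, c', hε, hc', hmain⟩ := bt_core (α * Real.pi / 2) (α' * Real.pi / 2) (Real.log R)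
    (Real.log D) c (by nlinarith) (by nlinarith) (by nlinarith) w0 hw0 hw0' (Complex.exp ⁻¹' V)
    (hVopen.preimage Complex.continuous_exp) hwV hc
  refine ⟨min ε 1, c', by positivity, hc', ?_⟩
  intro n Q hQ hK hV z hz
  have hz1 := hz.trans (min_le_left _ _)
  have hz2 := hz.trans (min_le_right _ _)
  have := hmain (fun z => Q.eval z) n Q.differentiable (Nat.cast_nonneg n)
    (hK 0 ⟨0, 0, le_refl _, hR.le, Or.inl (by simp; nlinarith), by simp⟩)
    (fun w hw h => hK _ (bt_mem_bowtie α R hR w hw (Or.inl h)))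
    (fun w hw h => hK _ (bt_mem_bowtie α R hR w hw (Or.inr h)))
    (fun w hw => by
      rw [mul_comm, Real.exp_nat_mul, Real.exp_log (by linarith)]
      rcases le_or_gt (s / 2) ‖Complex.exp w - Complex.exp w0‖ with h | h
      · refine (bt_bernstein Q n hQ (Complex.exp w0) (s / 2) (by positivity)
          (fun z hz => hK z (hdisc z hz)) _ h).trans ?_
        have hwR : ‖Complex.exp w‖ ≤ R := by
          rw [Complex.norm_exp, ← Real.exp_log hR]
          exact Real.exp_le_exp.2 hw
        gcongr
        refine le_trans ?_ (le_max_right _ _)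
        gcongr
        linarith [norm_sub_le (Complex.exp w) (Complex.exp w0)]
      · exact (hK _ (hdisc _ h.le)).trans (one_le_pow₀ hD1))
    (fun w hw => hV _ hw) z hz1
  refine this.trans (Real.exp_le_exp.2 ?_)
  rw [neg_mul, neg_mul, neg_le_neg_iff]
  apply mul_le_mul_of_nonneg_left _ (by positivity)
  rcases eq_or_ne z 0 with rfl | hz0
  · rw [norm_zero, Real.zero_rpow (by positivity)]; positivity
  apply Real.rpow_le_rpow_of_exponent_ge (norm_pos_iff.2 hz0) hz2
  rw [show Real.pi / (2 * (α' * Real.pi / 2)) = 1 / α' by field_simp]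
  gcongr

/-- An open set inside the bowtie meets one of the two open sectors. -/
lemma bt_point (α R : ℝ) (hα : 0 < α) (V : Set ℂ) (hVne : V.Nonempty)
    (hVopen : IsOpen V) (hV : V ⊆ bowtie α R) :
    ∃ w0 : ℂ, w0.re < Real.log R ∧ |w0.im| < α * Real.pi / 2 ∧
      (Complex.exp w0 ∈ V ∨ -Complex.exp w0 ∈ V) := by
  have hpi := Real.pi_pos
  have hϑ : 0 < α * Real.pi / 2 := by positivity
  obtain ⟨v, hvV, hv0⟩ := (dense_compl_singleton (0 : ℂ)).inter_open_nonempty V hVopen hVne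
  obtain ⟨r, θ, hr0, hrR, hθ, hv⟩ := hV hvV
  have hr : 0 < r := by
    rcases hr0.lt_or_eq with h | h
    · exact h
    · exfalso; apply hv0; rw [hv, ← h]; simp
  -- reduce to an angle in the right sector and a sign
  have hred : ∃ φ : ℝ, |φ| ≤ α * Real.pi / 2 ∧ ∃ σ : ℂ, (σ = 1 ∨ σ = -1) ∧
      v = σ * (r * Complex.exp (φ * Complex.I)) := by
    rcases hθ with h | h
    · exact ⟨θ, h, 1, Or.inl rfl, by rw [hv, one_mul]⟩
    · refine ⟨θ - Real.pi, h, -1, Or.inr rfl, ?_⟩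
      rw [hv]; push_cast
      rw [sub_mul, Complex.exp_sub, Complex.exp_pi_mul_I]; ring
  obtain ⟨φ, hφ, σ, hσ, hvσ⟩ := hred
  have hcont : Continuous (fun δ : ℝ => σ * Complex.exp (((Real.log r - δ : ℝ) : ℂ) +
      (((1 - δ) * φ : ℝ) : ℂ) * Complex.I)) := by fun_prop
  have hmem : (fun δ : ℝ => σ * Complex.exp (((Real.log r - δ : ℝ) : ℂ) +
      (((1 - δ) * φ : ℝ) : ℂ) * Complex.I)) 0 ∈ V := by
    have : σ * Complex.exp (((Real.log r - 0 : ℝ) : ℂ) + (((1 - 0) * φ : ℝ) : ℂ) * Complex.I) = v := by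
      rw [hvσ, sub_zero, sub_zero, one_mul, Complex.exp_add, ← Complex.ofReal_exp, Real.exp_log hr]
    show σ * Complex.exp (((Real.log r - 0 : ℝ) : ℂ) + (((1 - 0) * φ : ℝ) : ℂ) * Complex.I) ∈ V
    rw [this]; exact hvV
  obtain ⟨d, hd, hball⟩ := Metric.isOpen_iff.1 (hVopen.preimage hcont) 0 hmem
  set δ := min (d / 2) (1 / 2) with hδ
  have hδ0 : 0 < δ := by positivity
  have hδ1 : δ ≤ 1 / 2 := min_le_right _ _
  have hδ2 : δ ≤ d / 2 := min_le_left _ _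
  have hδV := hball (show δ ∈ Metric.ball 0 d by
    rw [Metric.mem_ball, Real.dist_eq, sub_zero, abs_of_pos hδ0]; linarith)
  refine ⟨((Real.log r - δ : ℝ) : ℂ) + (((1 - δ) * φ : ℝ) : ℂ) * Complex.I, ?_, ?_, ?_⟩
  · simp only [Complex.add_re, Complex.ofReal_re, Complex.re_ofReal_mul, Complex.I_re, mul_zero,
      add_zero]
    linarith [Real.log_le_log hr hrR]
  · simp only [Complex.add_im, Complex.ofReal_im, Complex.im_ofReal_mul, Complex.I_im, mul_one,
      zero_add]
    rw [abs_mul, abs_of_pos (by linarith)]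
    nlinarith
  · rcases hσ with rfl | rfl
    · left; simpa only [Set.mem_preimage, one_mul] using hδV
    · right; simpa only [Set.mem_preimage, neg_mul, one_mul] using hδV

theorem stmt_7 (α R αt : ℝ) (hα1 : 1 / 2 < α) (hα2 : α < 1)
    (hαt1 : 1 - α < αt) (hαt2 : αt < α) (hR : 0 < R)
    (V : Set ℂ) (hVne : V.Nonempty) (hVopen : IsOpen V)
    (hVcl : closure V ⊆ interior (bowtie α R)) (c : ℝ) (hc : 0 < c) :
    ∃ ε c' c'' C₀ : ℝ, 0 < ε ∧ 0 < c' ∧ 0 < c'' ∧ 1 ≤ C₀ ∧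
      ∀ C : ℝ, 0 < C → ∀ n : ℕ, 1 ≤ n → ∀ Q : Polynomial ℂ, Q.natDegree ≤ n →
        (∀ z ∈ bowtie α R, ‖Q.eval z‖ ≤ C) →
        (∀ z ∈ closure V, ‖Q.eval z‖ ≤ C * Real.exp (-c * n)) →
        ∀ z : ℂ, ‖z‖ ≤ ε →
          ‖Q.eval z‖ ≤ C₀ * C *
            Real.exp (-c' * n * ‖z‖ ^ ((1 : ℝ) / αt) +
              c'' * n * ‖z‖ ^ ((1 : ℝ) / (1 - α))) := by
  -- normalized version, on `V` itself
  have hnormal : ∃ ε c' : ℝ, 0 < ε ∧ 0 < c' ∧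
      ∀ n : ℕ, ∀ Q : Polynomial ℂ, Q.natDegree ≤ n →
        (∀ z ∈ bowtie α R, ‖Q.eval z‖ ≤ 1) →
        (∀ z ∈ V, ‖Q.eval z‖ ≤ Real.exp (-c * n)) →
        ∀ z : ℂ, ‖z‖ ≤ ε → ‖Q.eval z‖ ≤ Real.exp (-c' * n * ‖z‖ ^ ((1 : ℝ) / αt)) := by
    obtain ⟨w0, hw1, hw2, hw⟩ := bt_point α R (by linarith) V hVne hVopen
      (subset_closure.trans (hVcl.trans interior_subset))
    rcases hw with hw | hw
    · exact bt_right α R αt hα1 hα2 hαt1 hαt2 hR V hVopen c hc w0 hw1 hw2 hw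
    · obtain ⟨ε, c', hε, hc', h⟩ := bt_right α R αt hα1 hα2 hαt1 hαt2 hR (Neg.neg ⁻¹' V)
        (hVopen.preimage continuous_neg) c hc w0 hw1 hw2 hw
      refine ⟨ε, c', hε, hc', fun n Q hQ hK hV z hz => ?_⟩
      have hev : ∀ z, (Q.comp (-Polynomial.X)).eval z = Q.eval (-z) := by
        intro z; simp [Polynomial.eval_comp]
      have := h n (Q.comp (-Polynomial.X)) (by
          rw [Polynomial.natDegree_comp, Polynomial.natDegree_neg, Polynomial.natDegree_X, mul_one]
          exact hQ)
        (fun z hz => by rw [hev]; exact hK _ (bt_neg_bowtie α R z hz))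
        (fun z hz => by rw [hev]; exact hV _ hz) (-z) (by rwa [norm_neg])
      rwa [hev, neg_neg, norm_neg] at this
  obtain ⟨ε, c', hε, hc', h⟩ := hnormal
  refine ⟨ε, c', 1, 1, hε, hc', one_pos, le_refl _, ?_⟩
  intro C hC n _ Q hQ hK hV z hz
  have hev : ∀ z, ‖(Polynomial.C ((C : ℂ)⁻¹) * Q).eval z‖ = ‖Q.eval z‖ / C := by
    intro z
    rw [Polynomial.eval_mul, Polynomial.eval_C, norm_mul, norm_inv, Complex.norm_real,
      Real.norm_of_nonneg hC.le, div_eq_inv_mul]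
  have := h n (Polynomial.C ((C : ℂ)⁻¹) * Q) ((Polynomial.natDegree_C_mul_le _ _).trans hQ)
    (fun z hz => by rw [hev, div_le_one hC]; exact hK z hz)
    (fun z hz => by rw [hev, div_le_iff₀ hC, mul_comm]; exact hV z (subset_closure hz)) z hz
  rw [hev, div_le_iff₀ hC, mul_comm] at this
  refine this.trans ?_
  rw [one_mul]
  gcongr
  have : 0 ≤ 1 * (n : ℝ) * ‖z‖ ^ ((1 : ℝ) / (1 - α)) := by positivity
  linarith
end
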